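/- Let c be a real number with 1 < c < 4109054/1999527 and c ≠ 2, let ε > 0 be fixed and sufficiently small, and for a sufficiently large integer N set P = N^{1/c} and τ = P^{1-c-ε}. Then R_5^{(1)}(N) := ∫_{-τ}^{τ} S(α)^5 e(-Nα) dα = (Γ(1+1/c)^5 / Γ(5/c)) · N^{5/c - 1} + O(N^{5/c - 1} · exp(-(log N)^{1/4})). -/

import Mathlib

open scoped Classical
open Finset Real MeasureTheory

/-- `eC x = e(x) = e^{2πix}`. -/
noncomputable def eC (x : ℝ) : ℂ := Complex.exp ((2 * Real.pi * x : ℝ) * Complex.I)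

/-- `SS c P α = S(α) = Σ_{p ≤ P} (log p) e([p^c]α)`, the sum over primes `p ≤ P`. -/
noncomputable def SS (c P α : ℝ) : ℂ :=
  ∑ p ∈ (Finset.range (⌊P⌋₊ + 1)).filter Nat.Prime,
    (Real.log p : ℂ) * eC ((⌊(p : ℝ) ^ c⌋ : ℝ) * α)

/-- A zero-free holomorphic function on a disc which is at most `e ^ M` times its central value
has a logarithmic derivative controlled by `M`. -/
lemma norm_deriv_div_le_of_zeroFree {f : ℂ → ℂ} {r M : ℝ} (hr : 0 < r) (hM : 0 < M)
    (hf : DifferentiableOn ℂ f (Metric.ball 0 r)) (hne : ∀ z ∈ Metric.ball (0 : ℂ) r, f z ≠ 0)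
    (hB : ∀ z ∈ Metric.ball (0 : ℂ) r, ‖f z‖ ≤ Real.exp M * ‖f 0‖)
    {z : ℂ} (hz : ‖z‖ < r) : ‖deriv f z / f z‖ ≤ 8 * M * r / (r - ‖z‖) ^ 2 := by
  have h0 : (0 : ℂ) ∈ Metric.ball (0 : ℂ) r := Metric.mem_ball_self hr
  have hdf : DifferentiableOn ℂ (deriv f) (Metric.ball 0 r) := hf.deriv Metric.isOpen_ball
  obtain ⟨h, hh0, hh⟩ := (hdf.div hf hne).isExactOn_ball.with_val_at 0 0
  have hhd : DifferentiableOn ℂ h (Metric.ball 0 r) := fun w hw =>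
    (hh w hw).differentiableAt.differentiableWithinAt
  -- `f = f 0 * exp h`
  have hexp : ∀ w ∈ Metric.ball (0 : ℂ) r, f w = f 0 * Complex.exp (h w) := by
    intro w hw
    have hconst : ∀ w ∈ Metric.ball (0 : ℂ) r,
        HasDerivWithinAt (fun w => f w * Complex.exp (-h w)) 0 (Metric.ball 0 r) w := by
      intro w hw
      have h1 := (hf.differentiableAt (Metric.isOpen_ball.mem_nhds hw)).hasDerivAt
      have h2 := (hh w hw).neg.cexp
      have hv : deriv f w * Complex.exp (-h w) +
          f w * (Complex.exp (-h w) * -(deriv f w / f w)) = 0 := by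
        have := hne w hw
        field_simp
        ring
      have h3 : HasDerivWithinAt (fun w => f w * Complex.exp (-h w))
          (deriv f w * Complex.exp (-h w) + f w * (Complex.exp (-h w) * -(deriv f w / f w)))
          (Metric.ball 0 r) w := (h1.mul h2).hasDerivWithinAt
      rwa [hv] at h3
    have := (convex_ball (0 : ℂ) r).is_const_of_fderivWithin_eq_zero (𝕜 := ℂ)
      (f := fun w => f w * Complex.exp (-h w))
      (fun w hw => (hconst w hw).differentiableWithinAt) (fun w hw => by
        have := (hconst w hw).hasFDerivWithinAt.fderivWithin
          (Metric.isOpen_ball.uniqueDiffWithinAt hw)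
        rw [this]; ext; simp) hw h0
    simp only [hh0, neg_zero, Complex.exp_zero, mul_one] at this
    rw [← this, mul_assoc, ← Complex.exp_add]
    simp
  have hf0 : 0 < ‖f 0‖ := norm_pos_iff.2 (hne 0 h0)
  have hre : Set.MapsTo h (Metric.ball 0 r) {z | z.re ≤ M} := by
    intro w hw
    have h1 := hB w hw
    rw [hexp w hw, norm_mul, mul_comm, Complex.norm_exp] at h1
    exact Real.exp_le_exp.1 (le_of_mul_le_mul_right h1 hf0)
  have hzmem : z ∈ Metric.ball (0 : ℂ) r := mem_ball_zero_iff.2 hz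
  have hder : deriv h z = deriv f z / f z := (hh z hzmem).deriv
  set q := (r - ‖z‖) / 2 with hq
  have hqpos : 0 < q := by rw [hq]; linarith
  have hsub : Metric.closedBall z q ⊆ Metric.ball 0 r := by
    intro w hw
    rw [mem_closedBall_iff_norm] at hw
    rw [mem_ball_zero_iff]
    have : ‖w‖ ≤ ‖w - z‖ + ‖z‖ := by simpa using norm_add_le (w - z) z
    linarith
  have hbd : ∀ w ∈ Metric.sphere z q, ‖h w‖ ≤ 2 * M * r / q := by
    intro w hw
    have hwm := hsub (Metric.sphere_subset_closedBall hw)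
    have h1 := Complex.borelCaratheodory_zero hM hhd hre hr hwm hh0
    rw [mem_sphere_iff_norm] at hw
    have hw2 : ‖w‖ ≤ r - q := by
      have : ‖w‖ ≤ ‖w - z‖ + ‖z‖ := by simpa using norm_add_le (w - z) z
      linarith
    refine h1.trans ?_
    gcongr
    · linarith
    · linarith
  have hdc : DiffContOnCl ℂ h (Metric.ball z q) := by
    apply DifferentiableOn.diffContOnCl
    exact hhd.mono ((Metric.closure_ball_subset_closedBall).trans hsub)
  have := Complex.norm_deriv_le_of_forall_mem_sphere_norm_le hqpos hdc hbd
  rw [← hder]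
  refine this.trans (le_of_eq ?_)
  have : r - ‖z‖ ≠ 0 := by linarith
  rw [hq]
  field_simp
  ring

/-- Dividing an entire function by the Blaschke factor of the disc of radius `R` at one of its
zeros. -/
lemma exists_blaschke_quotient {f : ℂ → ℂ} {R B : ℝ} {ρ : ℂ} (hf : Differentiable ℂ f)
    (hB : ∀ z, ‖z‖ ≤ R → ‖f z‖ ≤ B) (hρR : ‖ρ‖ < R) (hρ : f ρ = 0) (hf0 : f 0 ≠ 0) :
    ∃ g : ℂ → ℂ, Differentiable ℂ g ∧ (∀ z, ‖z‖ ≤ R → ‖g z‖ ≤ B) ∧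
      (∀ z, ‖z‖ < R → g z = 0 → f z = 0) ∧ ‖g 0‖ = ‖f 0‖ * (R / ‖ρ‖) ∧
      (deriv f 0 / f 0).re =
        (deriv g 0 / g 0).re - ρ.re * (1 / ‖ρ‖ ^ 2 - 1 / R ^ 2) := by
  have hR : 0 < R := (norm_nonneg _).trans_lt hρR
  have hρ0 : ρ ≠ 0 := by rintro rfl; exact hf0 hρ
  have hds : Differentiable ℂ (dslope f ρ) := by
    rw [← differentiableOn_univ]
    exact (Complex.differentiableOn_dslope Filter.univ_mem).2 hf.differentiableOn
  have hfds : ∀ z, (z - ρ) * dslope f ρ z = f z := fun z => by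
    have := sub_smul_dslope f ρ z
    rw [hρ, sub_zero] at this
    simpa using this
  set g : ℂ → ℂ := fun z => dslope f ρ z * (((R : ℂ) ^ 2 - (starRingEnd ℂ) ρ * z) / R) with hg
  have hRC : (R : ℂ) ≠ 0 := by exact_mod_cast hR.ne'
  have hgd : Differentiable ℂ g := by
    apply hds.mul
    fun_prop
  have hnum : ∀ z, ‖z‖ ≤ R → (R : ℂ) ^ 2 - (starRingEnd ℂ) ρ * z ≠ 0 := by
    intro z hz h
    have h1 : ‖(R : ℂ) ^ 2‖ = ‖(starRingEnd ℂ) ρ * z‖ := by rw [sub_eq_zero.1 h]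
    rw [norm_mul, Complex.norm_conj, norm_pow, Complex.norm_real, Real.norm_of_nonneg hR.le] at h1
    nlinarith [norm_nonneg z, norm_nonneg ρ]
  refine ⟨g, hgd, ?_, ?_, ?_, ?_⟩
  · intro z hz
    have hfr : ∀ w ∈ frontier (Metric.ball (0 : ℂ) R), ‖g w‖ ≤ B := by
      intro w hw
      rw [frontier_ball _ hR.ne', mem_sphere_zero_iff_norm] at hw
      have hwρ : w - ρ ≠ 0 := by
        intro h
        rw [sub_eq_zero.1 h] at hw
        linarith
      have h1 := Complex.norm_canonicalFactor_eval_circle_eq_one (R := R) (w := ρ) (z := w)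
        (mem_ball_zero_iff.2 hρR) (mem_sphere_zero_iff_norm.2 hw)
      have h2 : g w = f w * Complex.canonicalFactor R ρ w := by
        rw [hg, Complex.canonicalFactor_apply, ← hfds w]
        simp only
        field_simp
      rw [h2, norm_mul, h1, mul_one]
      exact hB w hw.le
    refine Complex.norm_le_of_forall_mem_frontier_norm_le Metric.isBounded_ball
      hgd.diffContOnCl hfr ?_
    rw [closure_ball _ hR.ne']
    exact mem_closedBall_zero_iff.2 hz
  · intro z hz hgz
    rw [← hfds z]
    simp only [hg, mul_eq_zero, div_eq_zero_iff, hRC, or_false] at hgz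
    rcases hgz with h | h
    · rw [h, mul_zero]
    · exact absurd h (hnum z hz.le)
  · rw [← hfds 0, hg]
    have : ‖ρ‖ ≠ 0 := norm_ne_zero_iff.2 hρ0
    simp [abs_of_pos hR]
    field_simp
  · have hprod : ∀ z, f z * ((R : ℂ) ^ 2 - (starRingEnd ℂ) ρ * z) = g z * (R * (z - ρ)) := by
      intro z
      rw [← hfds z, hg]
      simp only
      field_simp
    have hd1 : HasDerivAt (fun z => f z * ((R : ℂ) ^ 2 - (starRingEnd ℂ) ρ * z))
        (deriv f 0 * ((R : ℂ) ^ 2 - (starRingEnd ℂ) ρ * 0) + f 0 * (-((starRingEnd ℂ) ρ * 1))) 0 :=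
      (hf 0).hasDerivAt.mul (((hasDerivAt_id (0 : ℂ)).const_mul _).const_sub _)
    have hd2 : HasDerivAt (fun z => g z * (R * (z - ρ)))
        (deriv g 0 * (R * (0 - ρ)) + g 0 * (R * 1)) 0 :=
      (hgd 0).hasDerivAt.mul (((hasDerivAt_id (0 : ℂ)).sub_const ρ).const_mul _)
    have heq := hd1.unique (by simpa only [hprod] using hd2)
    have h00 := hprod 0
    simp only [mul_zero, sub_zero, zero_sub, mul_one] at heq h00
    have hg0 : g 0 ≠ 0 := by
      intro h
      rw [h, zero_mul] at h00
      have := pow_ne_zero 2 hRC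
      exact mul_ne_zero hf0 this h00
    have hfv : f 0 = -(g 0 * ρ / R) := by
      refine mul_right_cancel₀ (pow_ne_zero 2 hRC) ?_
      rw [h00]
      field_simp
    have hfd : deriv f 0 / f 0 = deriv g 0 / g 0 - (1 / ρ - (starRingEnd ℂ) ρ / R ^ 2) := by
      have h3 : deriv f 0 = (deriv g 0 * (R * -ρ) + g 0 * R + f 0 * (starRingEnd ℂ) ρ) / R ^ 2 := by
        field_simp
        linear_combination heq
      rw [h3, hfv]
      field_simp
      ring
    rw [hfd, Complex.sub_re, Complex.sub_re]
    congr 1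
    have e1 : (1 / ρ : ℂ).re = ρ.re / ‖ρ‖ ^ 2 := by
      rw [one_div, Complex.inv_re, Complex.normSq_eq_norm_sq]
    have e2 : ((starRingEnd ℂ) ρ / R ^ 2 : ℂ).re = ρ.re / R ^ 2 := by
      rw [← Complex.ofReal_pow, Complex.div_ofReal_re, Complex.conj_re]
    rw [e1, e2]
    ring

/-- Landau's lemma: if all zeros of an entire function in a disc lie in the left half of the disc,
then the real part of its logarithmic derivative at the center is bounded below. -/
lemma neg_re_deriv_div_le {R r : ℝ} (hr : 0 < r) (hrR : r < R) (k : ℕ) :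
    ∀ {f : ℂ → ℂ} {B M : ℝ}, 0 < M → Differentiable ℂ f → (∀ z, ‖z‖ ≤ R → ‖f z‖ ≤ B) →
      f 0 ≠ 0 → (∀ z, ‖z‖ < r → f z = 0 → z.re ≤ 0) → B ≤ Real.exp M * ‖f 0‖ →
      B ≤ ‖f 0‖ * (R / r) ^ k → -(deriv f 0 / f 0).re ≤ 8 * M / r := by
  induction k with
  | zero =>
    intro f B M hM hf hB hf0 hz hBM hBk
    have hne : ∀ z ∈ Metric.ball (0 : ℂ) r, f z ≠ 0 := by
      intro z hz hfz
      rw [mem_ball_zero_iff] at hz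
      obtain ⟨g, -, hgB, -, hg0, -⟩ := exists_blaschke_quotient hf hB (hz.trans hrR) hfz hf0
      have h1 := hgB 0 (by simp; linarith)
      rw [hg0] at h1
      have hz0 : 0 < ‖z‖ := norm_pos_iff.2 (by rintro rfl; exact hf0 hfz)
      have h2 : 1 < R / ‖z‖ := by rw [one_lt_div hz0]; linarith
      have h3 : 0 < ‖f 0‖ := norm_pos_iff.2 hf0
      simp only [pow_zero, mul_one] at hBk
      nlinarith
    have := norm_deriv_div_le_of_zeroFree hr hM hf.differentiableOn hne (fun z hz =>
      (hB z ((mem_ball_zero_iff.1 hz).le.trans hrR.le)).trans hBM) (z := 0) (by simpa using hr)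
    have h2 : 8 * M * r / (r - ‖(0 : ℂ)‖) ^ 2 = 8 * M / r := by
      rw [norm_zero, sub_zero]; field_simp
    rw [h2] at this
    have h3 := (Complex.abs_re_le_norm (deriv f 0 / f 0))
    have h4 := neg_abs_le (deriv f 0 / f 0).re
    linarith
  | succ k ih =>
    intro f B M hM hf hB hf0 hz hBM hBk
    by_cases hne : ∀ z ∈ Metric.ball (0 : ℂ) r, f z ≠ 0
    · have := norm_deriv_div_le_of_zeroFree hr hM hf.differentiableOn hne (fun z hz =>
        (hB z ((mem_ball_zero_iff.1 hz).le.trans hrR.le)).trans hBM) (z := 0) (by simpa using hr)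
      have h2 : 8 * M * r / (r - ‖(0 : ℂ)‖) ^ 2 = 8 * M / r := by
        rw [norm_zero, sub_zero]; field_simp
      rw [h2] at this
      have h3 := (Complex.abs_re_le_norm (deriv f 0 / f 0))
      have h4 := neg_abs_le (deriv f 0 / f 0).re
      linarith
    · push Not at hne
      obtain ⟨ρ, hρ, hfρ⟩ := hne
      rw [mem_ball_zero_iff] at hρ
      obtain ⟨g, hgd, hgB, hgz, hg0, hgre⟩ :=
        exists_blaschke_quotient hf hB (hρ.trans hrR) hfρ hf0
      have hρ0 : 0 < ‖ρ‖ := norm_pos_iff.2 (by rintro rfl; exact hf0 hfρ)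
      have hf0' : 0 < ‖f 0‖ := norm_pos_iff.2 hf0
      have hge : ‖f 0‖ * (R / r) ≤ ‖g 0‖ := by
        rw [hg0]
        have : 0 < R := hr.trans hrR
        gcongr
      have hRr : 1 < R / r := by rwa [one_lt_div hr]
      have hge1 : ‖f 0‖ ≤ ‖g 0‖ := le_trans (by nlinarith) hge
      have := ih hM hgd hgB (norm_pos_iff.1 (hf0'.trans_le hge1))
        (fun z hz1 hz2 => hz z hz1 (hgz z (hz1.trans hrR) hz2))
        (hBM.trans (by gcongr)) (hBk.trans (by
          rw [pow_succ', ← mul_assoc]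
          gcongr))
      rw [hgre]
      have h5 := hz ρ hρ hfρ
      have h6 : 1 / R ^ 2 ≤ 1 / ‖ρ‖ ^ 2 := by
        gcongr
        exact (hρ.trans hrR).le
      nlinarith

/-- Landau's lemma, keeping the contribution of one zero. -/
lemma neg_re_deriv_div_le_of_zero {R r B M : ℝ} {f : ℂ → ℂ} (hr : 0 < r) (hrR : r < R)
    (hM : 0 < M) (hf : Differentiable ℂ f) (hB : ∀ z, ‖z‖ ≤ R → ‖f z‖ ≤ B) (hf0 : f 0 ≠ 0)
    (hz : ∀ z, ‖z‖ < r → f z = 0 → z.re ≤ 0) (hBM : B ≤ Real.exp M * ‖f 0‖) :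
    -(deriv f 0 / f 0).re ≤ 8 * M / r ∧ ∀ ρ, ‖ρ‖ < R → f ρ = 0 →
      -(deriv f 0 / f 0).re ≤ 8 * M / r + ρ.re * (1 / ‖ρ‖ ^ 2 - 1 / R ^ 2) := by
  have hRr : 1 < R / r := by rwa [one_lt_div hr]
  have hR : 0 < R := hr.trans hrR
  have key : ∀ {g : ℂ → ℂ}, Differentiable ℂ g → (∀ z, ‖z‖ ≤ R → ‖g z‖ ≤ B) →
      g 0 ≠ 0 → (∀ z, ‖z‖ < r → g z = 0 → z.re ≤ 0) → B ≤ Real.exp M * ‖g 0‖ →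
      -(deriv g 0 / g 0).re ≤ 8 * M / r := by
    intro g h1 h2 h3 h4 h5
    obtain ⟨k, hk⟩ := pow_unbounded_of_one_lt (B / ‖g 0‖) hRr
    refine neg_re_deriv_div_le hr hrR k hM h1 h2 h3 h4 h5 ?_
    rw [div_lt_iff₀ (norm_pos_iff.2 h3)] at hk
    linarith
  refine ⟨key hf hB hf0 hz hBM, fun ρ hρ hfρ => ?_⟩
  obtain ⟨g, hgd, hgB, hgz, hg0, hgre⟩ := exists_blaschke_quotient hf hB hρ hfρ hf0
  have hρ0 : 0 < ‖ρ‖ := norm_pos_iff.2 (by rintro rfl; exact hf0 hfρ)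
  have hf0' : 0 < ‖f 0‖ := norm_pos_iff.2 hf0
  have hge1 : ‖f 0‖ ≤ ‖g 0‖ := by
    rw [hg0]
    have : 1 ≤ R / ‖ρ‖ := by rw [one_le_div hρ0]; exact hρ.le
    nlinarith
  have := key hgd hgB (norm_pos_iff.1 (hf0'.trans_le hge1))
    (fun z hz1 hz2 => hz z hz1 (hgz z (hz1.trans hrR) hz2)) (hBM.trans (by gcongr))
  rw [hgre]
  linarith

/-- The fractional part cut off to `(1, ∞)`. -/
noncomputable def fractCut (t : ℝ) : ℂ := (Set.Ioi (1:ℝ)).indicator (fun t => ((Int.fract t : ℝ) : ℂ)) t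

lemma norm_fractCut_le (t : ℝ) : ‖fractCut t‖ ≤ 1 := by
  unfold fractCut
  refine (norm_indicator_le_norm_self _ _).trans ?_
  rw [Complex.norm_real, Real.norm_of_nonneg (Int.fract_nonneg t)]
  exact (Int.fract_lt_one t).le

lemma measurable_fractCut : Measurable fractCut :=
  Measurable.indicator (Complex.measurable_ofReal.comp measurable_fract) measurableSet_Ioi

lemma differentiableAt_mellin_fractCut {s : ℂ} (hs : 0 < s.re) :
    DifferentiableAt ℂ (fun s => mellin fractCut (-s)) s := by
  have h : DifferentiableAt ℂ (mellin fractCut) (-s) := by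
    apply mellin_differentiableAt_of_isBigO_rpow (a := 0) (b := -s.re - 1)
    · apply LocallyIntegrable.locallyIntegrableOn
      intro x
      refine ⟨Metric.ball x 1, Metric.ball_mem_nhds _ one_pos, ?_⟩
      refine Measure.integrableOn_of_bounded (M := 1) ?_ measurable_fractCut.aestronglyMeasurable ?_
      · exact (measure_ball_lt_top).ne
      · exact Filter.Eventually.of_forall fun t => norm_fractCut_le t
    · apply Asymptotics.IsBigO.of_bound 1
      exact Filter.Eventually.of_forall fun t => by simpa using norm_fractCut_le t
    · simpa using hs
    · apply Asymptotics.IsBigO.of_bound 1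
      have : ∀ᶠ t : ℝ in nhdsWithin 0 (Set.Ioi 0), t < 1 :=
        (gt_mem_nhds (show (0:ℝ) < 1 by norm_num)).filter_mono nhdsWithin_le_nhds
      filter_upwards [this] with t ht
      have : fractCut t = 0 := by
        unfold fractCut
        apply Set.indicator_of_notMem
        simpa using ht.le
      rw [this, norm_zero]; positivity
    · simp
  exact h.comp s differentiableAt_id.neg

lemma mellin_fractCut_eq (s : ℂ) :
    mellin fractCut (-s) = ∫ t in Set.Ioi (1:ℝ), ((Int.fract t : ℝ) : ℂ) * (t:ℂ) ^ (-(s+1)) := by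
  unfold mellin fractCut
  have : ∀ t : ℝ, (t:ℂ) ^ (-s - 1) • (Set.Ioi (1:ℝ)).indicator (fun t => ((Int.fract t : ℝ) : ℂ)) t
      = (Set.Ioi (1:ℝ)).indicator (fun t : ℝ => ((Int.fract t : ℝ) : ℂ) * (t:ℂ) ^ (-(s+1))) t := by
    intro t
    by_cases ht : t ∈ Set.Ioi (1:ℝ)
    · simp only [Set.indicator_of_mem ht]
      rw [smul_eq_mul, mul_comm]; congr 2; ring
    · simp [Set.indicator_of_notMem ht]
  simp only [this]
  rw [setIntegral_indicator measurableSet_Ioi]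
  congr 2
  ext t; simp

lemma norm_mellin_fractCut_le {s : ℂ} (hs : 0 < s.re) : ‖mellin fractCut (-s)‖ ≤ 1 / s.re := by
  rw [mellin_fractCut_eq]
  have h1 : ∫ t in Set.Ioi (1:ℝ), t ^ (-s.re - 1) = 1 / s.re := by
    rw [integral_Ioi_rpow_of_lt (by linarith) one_pos]
    simp
  rw [← h1]
  apply norm_integral_le_of_norm_le
  · exact integrableOn_Ioi_rpow_of_lt (by linarith) one_pos
  · refine (ae_restrict_iff' measurableSet_Ioi).2 (Filter.Eventually.of_forall fun t ht => ?_)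
    have ht0 : 0 < t := lt_trans one_pos ht
    rw [norm_mul, Complex.norm_real, Real.norm_of_nonneg (Int.fract_nonneg t),
      Complex.norm_cpow_eq_rpow_re_of_pos ht0]
    have : (-(s+1)).re = -s.re - 1 := by simp; ring
    rw [this]
    have h2 : 0 ≤ t ^ (-s.re - 1) := by positivity
    nlinarith [(Int.fract_lt_one t)]

lemma riemannZeta₁_eq_of_one_lt {s : ℂ} (hs : 1 < s.re) :
    riemannZeta₁ s = s - s * (s - 1) * mellin fractCut (-s) := by
  have hs1 : s ≠ 1 := by rintro rfl; simp at hs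
  have hs1' : s - 1 ≠ 0 := sub_ne_zero.2 hs1
  have h1 : riemannZeta₁ s = (s - 1) * riemannZeta s := by
    rw [riemannZeta_eq_inv_sub_mul hs1]; field_simp
  have hO : (fun n : ℕ => ∑ k ∈ Icc 1 n, ‖(1 : ℕ → ℂ) k‖) =O[Filter.atTop] fun n => (n:ℝ)^(1:ℝ) := by
    simp; exact Asymptotics.isBigO_refl _ _
  have h2 := LSeries_eq_mul_integral' (1 : ℕ → ℂ) zero_le_one hs hO
  rw [LSeries_one_eq_riemannZeta hs] at h2
  have h3 : ∫ t in Set.Ioi (1:ℝ), (∑ k ∈ Icc 1 ⌊t⌋₊, (1 : ℕ → ℂ) k) * (t:ℂ) ^ (-(s + 1))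
     = ∫ t in Set.Ioi (1:ℝ), ((t:ℂ) ^ (-s) - ((Int.fract t : ℝ) : ℂ) * (t:ℂ) ^ (-(s+1))) := by
    apply setIntegral_congr_fun measurableSet_Ioi
    intro t ht
    have ht0 : 0 < t := lt_trans one_pos ht
    have htc : (t:ℂ) ≠ 0 := by exact_mod_cast ht0.ne'
    simp only [Pi.one_apply, sum_const, Nat.card_Icc, nsmul_eq_mul, mul_one, Nat.add_sub_cancel]
    have e1 : (t:ℂ) ^ (-s) = t * (t:ℂ) ^ (-(s+1)) := by
      rw [show -s = 1 + (-(s+1)) by ring, Complex.cpow_add _ _ htc, Complex.cpow_one]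
    have e2 : ((⌊t⌋₊ : ℕ) : ℂ) = (t:ℂ) - ((Int.fract t : ℝ) : ℂ) := by
      rw [← Complex.ofReal_sub, Int.self_sub_fract, ← natCast_floor_eq_intCast_floor ht0.le]
      simp
    rw [e1, e2]; ring
  have i1 : IntegrableOn (fun t : ℝ => (t:ℂ) ^ (-s)) (Set.Ioi 1) :=
    integrableOn_Ioi_cpow_of_lt (by simpa using hs) one_pos
  have i2 : IntegrableOn (fun t : ℝ => ((Int.fract t : ℝ) : ℂ) * (t:ℂ) ^ (-(s+1))) (Set.Ioi 1) := by
    have i3 : IntegrableOn (fun t : ℝ => (t:ℂ) ^ (-(s+1))) (Set.Ioi 1) :=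
      integrableOn_Ioi_cpow_of_lt (by simp; linarith) one_pos
    refine Integrable.bdd_mul (c := 1) i3 ?_ ?_
    · exact (Complex.measurable_ofReal.comp measurable_fract).aestronglyMeasurable
    · refine Filter.Eventually.of_forall fun t => ?_
      rw [Complex.norm_real, Real.norm_of_nonneg (Int.fract_nonneg t)]
      exact (Int.fract_lt_one t).le
  rw [h3, integral_sub i1 i2, integral_Ioi_cpow_of_lt (by simpa using hs) one_pos,
    ← mellin_fractCut_eq] at h2
  rw [h1, h2]
  have : -s + 1 ≠ 0 := by intro h; apply hs1'; linear_combination -h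
  simp only [Complex.ofReal_one, Complex.one_cpow]
  field_simp
  ring

lemma riemannZeta₁_eq {s : ℂ} (hs : 0 < s.re) :
    riemannZeta₁ s = s - s * (s - 1) * mellin fractCut (-s) := by
  have ho : IsOpen {s : ℂ | 0 < s.re} := isOpen_lt continuous_const Complex.continuous_re
  have hf : AnalyticOnNhd ℂ riemannZeta₁ {s : ℂ | 0 < s.re} :=
    differentiable_riemannZeta₁.differentiableOn.analyticOnNhd ho
  have hg : AnalyticOnNhd ℂ (fun s => s - s * (s - 1) * mellin fractCut (-s)) {s : ℂ | 0 < s.re} := by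
    apply DifferentiableOn.analyticOnNhd _ ho
    intro s hs
    apply DifferentiableAt.differentiableWithinAt
    have := differentiableAt_mellin_fractCut hs
    fun_prop
  have hpre : IsPreconnected {s : ℂ | 0 < s.re} := (convex_halfSpace_re_gt 0).isPreconnected
  refine hf.eqOn_of_preconnected_of_eventuallyEq hg hpre (z₀ := 2) (by simp) ?_ hs
  have : {s : ℂ | 1 < s.re} ∈ nhds (2:ℂ) :=
    (isOpen_lt continuous_const Complex.continuous_re).mem_nhds (by simp)
  filter_upwards [this] with s hs using riemannZeta₁_eq_of_one_lt hs

lemma norm_riemannZeta₁_le {s : ℂ} (hs : 1/2 ≤ s.re) :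
    ‖riemannZeta₁ s‖ ≤ 3 * (‖s‖ + 1) ^ 2 := by
  have hs0 : 0 < s.re := by linarith
  rw [riemannZeta₁_eq hs0]
  have h1 := norm_mellin_fractCut_le hs0
  have h2 : 1 / s.re ≤ 2 := by rw [div_le_iff₀ hs0]; linarith
  have h3 : ‖s - 1‖ ≤ ‖s‖ + 1 := by simpa using norm_sub_le s 1
  calc _ ≤ ‖s‖ + ‖s * (s-1) * mellin fractCut (-s)‖ := norm_sub_le _ _
    _ = ‖s‖ + ‖s‖ * ‖s-1‖ * ‖mellin fractCut (-s)‖ := by rw [norm_mul, norm_mul]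
    _ ≤ ‖s‖ + ‖s‖ * (‖s‖+1) * 2 := by gcongr; linarith
    _ ≤ _ := by nlinarith [norm_nonneg s]

lemma riemannZeta₁_eq_mul {s : ℂ} (hs : s ≠ 1) : riemannZeta₁ s = (s - 1) * riemannZeta s := by
  have hs1' : s - 1 ≠ 0 := sub_ne_zero.2 hs
  rw [riemannZeta_eq_inv_sub_mul hs]; field_simp

lemma riemannZeta₁_ne_zero_of_one_le_re {s : ℂ} (hs : 1 ≤ s.re) : riemannZeta₁ s ≠ 0 := by
  by_cases h : s = 1
  · rw [h]; simp
  · rw [riemannZeta₁_eq_mul h]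
    exact mul_ne_zero (sub_ne_zero.2 h) (riemannZeta_ne_zero_of_one_le_re hs)

lemma ne_one_of_one_lt_re {s : ℂ} (hs : 1 < s.re) : s ≠ 1 := by rintro rfl; simp at hs

/-- The logarithmic derivative of zeta on `Re s > 1` as a von Mangoldt series. -/
lemma neg_logDeriv_riemannZeta₁ {s : ℂ} (hs : 1 < s.re) :
    -(deriv riemannZeta₁ s / riemannZeta₁ s) =
      LSeries (fun n => ((ArithmeticFunction.vonMangoldt n : ℝ) : ℂ)) s - 1 / (s - 1) := by
  have h1 := ne_one_of_one_lt_re hs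
  have h1' : s - 1 ≠ 0 := sub_ne_zero.2 h1
  have h2 := riemannZeta₁_ne_zero_of_one_le_re hs.le
  rw [ArithmeticFunction.LSeries_vonMangoldt_eq_deriv_riemannZeta_div hs,
    deriv_riemannZeta_eq_neg_inv_sub_sq_mul_add h1, riemannZeta_eq_inv_sub_mul h1]
  field_simp
  ring

lemma norm_inv_riemannZeta_le {s : ℂ} (hs : 1 < s.re) :
    ‖(riemannZeta s)⁻¹‖ ≤ ‖riemannZeta (s.re : ℂ)‖ := by
  have hs' : 1 < ((s.re : ℝ) : ℂ).re := by simpa using hs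
  have h1 : (riemannZeta s)⁻¹ = LSeries (fun n => ((ArithmeticFunction.moebius n : ℤ) : ℂ)) s := by
    have := ArithmeticFunction.LSeries_zeta_mul_Lseries_moebius hs
    rw [ArithmeticFunction.LSeries_zeta_eq_riemannZeta hs] at this
    exact (eq_inv_of_mul_eq_one_right this).symm
  have hsum : LSeriesSummable 1 ((s.re : ℝ) : ℂ) := LSeriesSummable_one_iff.2 hs'
  rw [h1, ← LSeries_one_eq_riemannZeta hs']
  have hn : ∀ n, ‖LSeries.term (fun n => ((ArithmeticFunction.moebius n : ℤ) : ℂ)) s n‖ ≤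
      (LSeries.term 1 ((s.re : ℝ) : ℂ) n).re := by
    intro n
    rcases eq_or_ne n 0 with rfl | hn
    · simp
    rw [LSeries.norm_term_eq, if_neg hn, LSeries.term_of_ne_zero hn]
    have e : ((n:ℂ) ^ ((s.re : ℝ) : ℂ)) = (((n:ℝ) ^ s.re : ℝ) : ℂ) := by
      rw [Complex.ofReal_cpow (by positivity)]; simp
    rw [e, Pi.one_apply, ← Complex.ofReal_one, ← Complex.ofReal_div, Complex.ofReal_re]
    gcongr
    rw [Complex.norm_intCast]
    exact_mod_cast ArithmeticFunction.abs_moebius_le_one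
  have hre : Summable fun n => (LSeries.term 1 ((s.re : ℝ) : ℂ) n).re :=
    (Complex.hasSum_re hsum.hasSum).summable
  calc _ ≤ ∑' n, (LSeries.term 1 ((s.re : ℝ) : ℂ) n).re := tsum_of_norm_bounded hre.hasSum hn
    _ = (LSeries 1 ((s.re : ℝ) : ℂ)).re := (Complex.hasSum_re hsum.hasSum).tsum_eq
    _ ≤ _ := Complex.re_le_norm _

lemma le_norm_riemannZeta₁ {s : ℂ} (hs : 1 < s.re) (hs2 : s.re ≤ 2) :
    (s.re - 1) ^ 2 / 27 ≤ ‖riemannZeta₁ s‖ := by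
  have h0 : 0 < s.re - 1 := by linarith
  have h1 := norm_inv_riemannZeta_le hs
  have hs' : 1 < ((s.re : ℝ) : ℂ).re := by simpa using hs
  have h2 : ‖riemannZeta₁ (s.re : ℂ)‖ ≤ 27 := by
    refine (norm_riemannZeta₁_le (by simp; linarith)).trans ?_
    rw [Complex.norm_real, Real.norm_of_nonneg (by linarith)]
    nlinarith
  rw [riemannZeta₁_eq_mul (ne_one_of_one_lt_re hs'), norm_mul, ← Complex.ofReal_one,
    ← Complex.ofReal_sub, Complex.norm_real, Real.norm_of_nonneg h0.le] at h2
  have h3 : riemannZeta s ≠ 0 := riemannZeta_ne_zero_of_one_le_re hs.le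
  have h4 : 0 < ‖riemannZeta s‖ := norm_pos_iff.2 h3
  rw [norm_inv] at h1
  rw [riemannZeta₁_eq_mul (ne_one_of_one_lt_re hs), norm_mul]
  have h5 : s.re - 1 ≤ ‖s - 1‖ := by simpa using Complex.re_le_norm (s - 1)
  have h6 : (s.re - 1) / 27 ≤ ‖riemannZeta s‖ := by
    rw [inv_le_comm₀ h4 (by
      exact lt_of_lt_of_le (inv_pos.2 h4) h1)] at h1
    refine le_trans ?_ h1
    rw [div_le_iff₀ (by norm_num), inv_mul_eq_div, le_div_iff₀]
    · exact h2
    · exact norm_pos_iff.2 (riemannZeta_ne_zero_of_one_le_re hs'.le)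
  calc _ = (s.re - 1) * ((s.re-1)/27) := by ring
    _ ≤ _ := by gcongr

lemma three_four_one (θ : ℝ) : 0 ≤ 3 + 4 * Real.cos θ + Real.cos (2 * θ) := by
  rw [Real.cos_two_mul]; nlinarith [sq_nonneg (Real.cos θ + 1)]

lemma LSeries_vonMangoldt_three_four_one {σ t : ℝ} (hσ : 1 < σ) :
    0 ≤ 3 * (LSeries (fun n => ((ArithmeticFunction.vonMangoldt n : ℝ) : ℂ)) (σ : ℂ)).re
      + 4 * (LSeries (fun n => ((ArithmeticFunction.vonMangoldt n : ℝ) : ℂ)) (σ + t * Complex.I)).re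
      + (LSeries (fun n => ((ArithmeticFunction.vonMangoldt n : ℝ) : ℂ))
          (σ + (2 * t : ℝ) * Complex.I)).re := by
  have hs : ∀ u : ℝ, HasSum (fun n => (LSeries.term
      (fun n => ((ArithmeticFunction.vonMangoldt n : ℝ) : ℂ)) (σ + u * Complex.I) n).re)
      (LSeries (fun n => ((ArithmeticFunction.vonMangoldt n : ℝ) : ℂ)) (σ + u * Complex.I)).re := by
    intro u
    exact Complex.hasSum_re
      (ArithmeticFunction.LSeriesSummable_vonMangoldt (by simpa using hσ)).hasSum
  have h0 := hs 0
  have h1 := hs t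
  have h2 := hs (2 * t)
  simp only [Complex.ofReal_zero, zero_mul, add_zero] at h0
  refine (((h0.mul_left 3).add (h1.mul_left 4)).add h2).nonneg ?_
  have hterm : ∀ (u : ℝ) (n : ℕ), n ≠ 0 → (LSeries.term
      (fun n => ((ArithmeticFunction.vonMangoldt n : ℝ) : ℂ)) (σ + u * Complex.I) n).re =
      ArithmeticFunction.vonMangoldt n * ((n:ℝ) ^ (-σ) * Real.cos (u * Real.log n)) := by
    intro u n hn
    have hn' : (n:ℂ) ≠ 0 := by exact_mod_cast hn
    rw [LSeries.term_of_ne_zero hn, div_eq_mul_inv, ← Complex.cpow_neg, Complex.re_ofReal_mul]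
    congr 1
    rw [neg_add, Complex.cpow_add _ _ hn']
    have e : ((n:ℂ) ^ (-((σ : ℝ) : ℂ))) = (((n:ℝ) ^ (-σ) : ℝ) : ℂ) := by
      rw [Complex.ofReal_cpow (by positivity)]; simp
    rw [e, Complex.re_ofReal_mul]
    congr 1
    rw [Complex.cpow_def_of_ne_zero hn', ← Complex.natCast_log]
    have : ((Real.log n : ℝ) : ℂ) * -(u * Complex.I) = ((-(u * Real.log n) : ℝ) : ℂ) * Complex.I := by
      push_cast; ring
    rw [this, Complex.exp_ofReal_mul_I_re, Real.cos_neg]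
  intro n
  rcases eq_or_ne n 0 with rfl | hn
  · simp
  have h00 := hterm 0 n hn
  simp only [Complex.ofReal_zero, zero_mul, add_zero, Real.cos_zero, mul_one] at h00
  rw [h00, hterm t n hn, hterm (2 * t) n hn, mul_assoc]
  have := three_four_one (t * Real.log n)
  have h3 : 0 ≤ ArithmeticFunction.vonMangoldt n * (n:ℝ) ^ (-σ) :=
    mul_nonneg ArithmeticFunction.vonMangoldt_nonneg (by positivity)
  calc 0 ≤ (ArithmeticFunction.vonMangoldt n * (n:ℝ) ^ (-σ)) *
      (3 + 4 * Real.cos (t * Real.log n) + Real.cos (2 * (t * Real.log n))) := mul_nonneg h3 this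
    _ = _ := by ring

lemma neg_re_logDeriv_riemannZeta₁_le {δ t u : ℝ} (hδ : δ = 1 / (10 ^ 6 * Real.log (|t| + 4)))
    (hu : |u| ≤ 2 * |t|) :
    -(deriv riemannZeta₁ (1 + δ + u * Complex.I) / riemannZeta₁ (1 + δ + u * Complex.I)).re
        ≤ 928 * Real.log (|t| + 4) ∧
      ∀ β : ℝ, 1 / 2 + δ < β → β < 1 + δ → riemannZeta₁ (β + u * Complex.I) = 0 →
        -(deriv riemannZeta₁ (1 + δ + u * Complex.I) / riemannZeta₁ (1 + δ + u * Complex.I)).re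
          ≤ 928 * Real.log (|t| + 4) - 1 / (1 + δ - β) + 4 := by
  set W := |t| + 4 with hW
  have hW4 : 4 ≤ W := by have := abs_nonneg t; linarith
  have hlogW : 1 < Real.log W := by
    rw [Real.lt_log_iff_exp_lt (by linarith)]
    have := Real.exp_one_lt_d9; linarith
  have hδ0 : 0 < δ := by rw [hδ]; positivity
  have hδ1 : δ ≤ 1 / 10 ^ 6 := by
    rw [hδ]; apply one_div_le_one_div_of_le (by norm_num); nlinarith
  set s0 : ℂ := 1 + δ + u * Complex.I with hs0
  have hs0re : s0.re = 1 + δ := by simp [hs0]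
  have hs0im : s0.im = u := by simp [hs0]
  set g : ℂ → ℂ := fun z => riemannZeta₁ (s0 + z) with hg
  have hgd : Differentiable ℂ g := by
    have := differentiable_riemannZeta₁
    intro z
    exact (this (s0 + z)).comp z (by fun_prop)
  have hdg : deriv g 0 = deriv riemannZeta₁ s0 := by
    rw [hg, deriv_comp_const_add]; simp
  have hg0 : g 0 = riemannZeta₁ s0 := by simp [hg]
  have hB : ∀ z, ‖z‖ ≤ 1/2 → ‖g z‖ ≤ 12 * W ^ 2 := by
    intro z hz
    have hre := Complex.abs_re_le_norm z
    have h1 : 1/2 ≤ (s0 + z).re := by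
      rw [Complex.add_re, hs0re]
      have := abs_le.1 (hre.trans hz); linarith
    refine (norm_riemannZeta₁_le h1).trans ?_
    have h2 : ‖s0 + z‖ ≤ 1 + δ + |u| + 1/2 := by
      refine (norm_add_le _ _).trans (add_le_add ?_ hz)
      refine (Complex.norm_le_abs_re_add_abs_im s0).trans ?_
      rw [hs0re, hs0im, abs_of_pos (by linarith)]
    have h3 : ‖s0 + z‖ + 1 ≤ 2 * W := by linarith
    nlinarith [norm_nonneg (s0 + z)]
  have hlow := le_norm_riemannZeta₁ (s := s0) (by linarith) (by rw [hs0re]; linarith)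
  rw [hs0re] at hlow
  have hf0 : g 0 ≠ 0 := by
    rw [hg0]; exact riemannZeta₁_ne_zero_of_one_le_re (by linarith)
  have hz : ∀ z, ‖z‖ < 1/4 → g z = 0 → z.re ≤ 0 := by
    intro z _ hgz
    by_contra hcon
    push Not at hcon
    exact riemannZeta₁_ne_zero_of_one_le_re (by rw [Complex.add_re, hs0re]; linarith) hgz
  have hBM : 12 * W ^ 2 ≤ Real.exp (29 * Real.log W) * ‖g 0‖ := by
    rw [hg0]
    have e1 : Real.exp (29 * Real.log W) = W ^ 29 := by
      rw [mul_comm, Real.exp_mul, Real.exp_log (by linarith)]; norm_cast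
    have e2 : 1 / (10^6 * W) ≤ δ := by
      rw [hδ]; apply one_div_le_one_div_of_le (by positivity)
      have := Real.log_le_self (x := W) (by linarith); nlinarith
    have e3 : 12 * W ^ 2 ≤ W ^ 29 * ((1 / (10^6 * W)) ^ 2 / 27) := by
      have : W ^ 29 * ((1 / (10^6 * W)) ^ 2 / 27) = W ^ 2 * (W ^ 25 / (27 * 10 ^ 12)) := by
        field_simp
      rw [this]
      have h25 : (4:ℝ) ^ 25 ≤ W ^ 25 := by gcongr
      have : 12 ≤ W ^ 25 / (27 * 10 ^ 12) := by
        rw [le_div_iff₀ (by norm_num)]; refine le_trans ?_ h25; norm_num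
      nlinarith [sq_nonneg W]
    rw [e1]
    refine e3.trans ?_
    gcongr
    refine le_trans ?_ hlow
    gcongr
    linarith
  obtain ⟨h1, h2⟩ := neg_re_deriv_div_le_of_zero (r := 1/4) (R := 1/2) (by norm_num)
    (by norm_num) (by linarith : 0 < 29 * Real.log W) hgd hB hf0 hz hBM
  rw [hdg, hg0] at h1 h2
  refine ⟨by linarith, ?_⟩
  intro β hβ1 hβ2 hβ
  have hρ := h2 ((β - 1 - δ : ℝ) : ℂ) ?_ ?_
  · refine hρ.trans ?_
    rw [Complex.norm_real, Real.norm_eq_abs, sq_abs, Complex.ofReal_re]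
    have hd : 0 < 1 + δ - β := by linarith
    have : (β - 1 - δ) * (1 / (β - 1 - δ) ^ 2 - 1 / (1 / 2) ^ 2) =
        -(1 / (1 + δ - β)) + 4 * (1 + δ - β) := by
      have : β - 1 - δ ≠ 0 := by linarith
      have h : β - 1 - δ = -(1 + δ - β) := by ring
      rw [h]; field_simp; ring
    rw [this]; linarith
  · rw [Complex.norm_real, Real.norm_eq_abs, abs_lt]; constructor <;> linarith
  · rw [hg, ← hβ]; simp only [hs0]; congr 1; push_cast; ring

lemma riemannZeta₁_zeroFree_of_one_le {β t : ℝ} (ht : 1 ≤ |t|)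
    (hβ : 1 - 1 / (10 ^ 7 * Real.log (|t| + 4)) ≤ β) : riemannZeta₁ (β + t * Complex.I) ≠ 0 := by
  intro hzero
  have hβ1 : β < 1 := by
    by_contra h
    push Not at h
    exact riemannZeta₁_ne_zero_of_one_le_re (by simpa using h) hzero
  set L := Real.log (|t| + 4) with hL
  have hL1 : 1 < L := by
    rw [hL, Real.lt_log_iff_exp_lt (by linarith)]
    have := Real.exp_one_lt_d9; linarith
  set δ := 1 / (10 ^ 6 * L) with hδ
  have hδ0 : 0 < δ := by positivity
  have hδ1 : δ ≤ 1 / 10 ^ 6 := by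
    rw [hδ]; apply one_div_le_one_div_of_le (by norm_num); nlinarith
  have hδ7 : 1 / (10 ^ 7 * L) = δ / 10 := by rw [hδ]; field_simp
  rw [hδ7] at hβ
  have a0 := (neg_re_logDeriv_riemannZeta₁_le (t := t) (u := 0) hδ (by simp)).1
  have a1 := (neg_re_logDeriv_riemannZeta₁_le (t := t) (u := t) hδ
    (by have := abs_nonneg t; linarith)).2 β (by linarith) (by linarith) hzero
  have a2 := (neg_re_logDeriv_riemannZeta₁_le (t := t) (u := 2 * t) hδ (by
    rw [abs_mul]; simp)).1
  have b := LSeries_vonMangoldt_three_four_one (σ := 1 + δ) (t := t) (by linarith)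
  have key : ∀ u : ℝ, (LSeries (fun n => ((ArithmeticFunction.vonMangoldt n : ℝ) : ℂ))
      (((1 + δ : ℝ) : ℂ) + u * Complex.I)).re =
      -(deriv riemannZeta₁ (1 + δ + u * Complex.I) / riemannZeta₁ (1 + δ + u * Complex.I)).re
       + δ / (δ ^ 2 + u ^ 2) := by
    intro u
    have h := neg_logDeriv_riemannZeta₁ (s := 1 + δ + u * Complex.I) (by simp; exact hδ0)
    have e : ((1 + δ : ℝ) : ℂ) + u * Complex.I = 1 + δ + u * Complex.I := by push_cast; ring
    rw [e, ← Complex.neg_re, h, Complex.sub_re]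
    have : (1 / ((1:ℂ) + δ + u * Complex.I - 1)).re = δ / (δ ^ 2 + u ^ 2) := by
      rw [show (1:ℂ) + δ + u * Complex.I - 1 = δ + u * Complex.I by ring]
      rw [one_div, Complex.inv_re, Complex.normSq_add_mul_I]; simp
    rw [this]; ring
  have k0 := key 0
  simp only [Complex.ofReal_zero, zero_mul, add_zero] at k0
  simp only [Complex.ofReal_zero, zero_mul, add_zero] at a0
  rw [k0, key t, key (2 * t)] at b
  have ht2 : 1 ≤ t ^ 2 := by rw [← sq_abs]; nlinarith
  have c0 : δ / (δ ^ 2 + 0 ^ 2) = 10 ^ 6 * L := by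
    rw [hδ]; field_simp; ring
  have c1 : δ / (δ ^ 2 + t ^ 2) ≤ δ := by
    apply div_le_self hδ0.le; nlinarith
  have c2 : δ / (δ ^ 2 + (2 * t) ^ 2) ≤ δ := by
    apply div_le_self hδ0.le; nlinarith
  rw [c0] at b
  have hd : 0 < 1 + δ - β := by linarith
  have hd2 : 1 + δ - β ≤ 1.1 * δ := by linarith
  have hd3 : 10 ^ 6 * L / 1.1 ≤ 1 / (1 + δ - β) := by
    rw [le_div_iff₀ hd]
    calc 10 ^ 6 * L / 1.1 * (1 + δ - β) ≤ 10 ^ 6 * L / 1.1 * (1.1 * δ) := by gcongr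
      _ = 1 := by rw [hδ]; field_simp
  norm_num at hd3 a0 a1 a2 b
  linarith

/-- The classical zero-free region. -/
lemma exists_zeroFree_region : ∃ c > 0, c ≤ 1 / 4 ∧ ∀ s : ℂ,
    1 - c / Real.log (|s.im| + 4) < s.re → riemannZeta₁ s ≠ 0 := by
  have hK : IsCompact ((fun t : ℝ => (1:ℂ) + t * Complex.I) '' Set.Icc (-1) 1) :=
    isCompact_Icc.image (by fun_prop)
  have hU : IsOpen {s | riemannZeta₁ s ≠ 0} :=
    isOpen_ne_fun differentiable_riemannZeta₁.continuous continuous_const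
  obtain ⟨ε, hε, hsub⟩ := hK.exists_thickening_subset_open hU (by
    rintro _ ⟨t, _, rfl⟩
    exact riemannZeta₁_ne_zero_of_one_le_re (by simp))
  refine ⟨min ε (1 / 10 ^ 7), by positivity, (min_le_right _ _).trans (by norm_num), ?_⟩
  intro s hs
  have hL1 : 1 < Real.log (|s.im| + 4) := by
    rw [Real.lt_log_iff_exp_lt (by positivity)]
    have := Real.exp_one_lt_d9; have := abs_nonneg s.im; linarith
  by_cases h1 : 1 ≤ s.re
  · exact riemannZeta₁_ne_zero_of_one_le_re h1
  by_cases ht : 1 ≤ |s.im|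
  · have := riemannZeta₁_zeroFree_of_one_le (β := s.re) ht ?_
    · rwa [Complex.re_add_im] at this
    · refine le_trans ?_ hs.le
      have : min ε (1 / 10 ^ 7) / Real.log (|s.im| + 4) ≤ (1 / 10 ^ 7) / Real.log (|s.im| + 4) := by
        gcongr; exact min_le_right _ _
      rw [div_div] at this; linarith
  · push Not at h1 ht
    apply hsub
    rw [Metric.mem_thickening_iff]
    refine ⟨_, ⟨s.im, ⟨by linarith [(abs_lt.1 ht).1], (abs_lt.1 ht).2.le⟩, rfl⟩, ?_⟩
    have e : s - (1 + s.im * Complex.I) = ((s.re - 1 : ℝ) : ℂ) :=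
      Complex.ext (by simp) (by simp)
    rw [dist_eq_norm, e, Complex.norm_real, Real.norm_eq_abs, abs_lt]
    have : min ε (1 / 10 ^ 7) / Real.log (|s.im| + 4) ≤ ε := by
      refine (div_le_self (by positivity) hL1.le).trans (min_le_left _ _)
    constructor <;> linarith

lemma norm_LSeries_vonMangoldt_le (s : ℂ) (hs : 1 < s.re) :
    ‖LSeries (fun n => ((ArithmeticFunction.vonMangoldt n : ℝ) : ℂ)) s‖ ≤
      ‖LSeries (fun n => ((ArithmeticFunction.vonMangoldt n : ℝ) : ℂ)) (s.re : ℂ)‖ := by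
  have hs' : 1 < ((s.re : ℝ) : ℂ).re := by simpa using hs
  have hsum := ArithmeticFunction.LSeriesSummable_vonMangoldt hs'
  have hn : ∀ n, ‖LSeries.term (fun n => ((ArithmeticFunction.vonMangoldt n : ℝ) : ℂ)) s n‖ ≤
      (LSeries.term (fun n => ((ArithmeticFunction.vonMangoldt n : ℝ) : ℂ))
        ((s.re : ℝ) : ℂ) n).re := by
    intro n
    rcases eq_or_ne n 0 with rfl | hn
    · simp
    rw [LSeries.norm_term_eq, if_neg hn, LSeries.term_of_ne_zero hn]
    have e : ((n:ℂ) ^ ((s.re : ℝ) : ℂ)) = (((n:ℝ) ^ s.re : ℝ) : ℂ) := by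
      rw [Complex.ofReal_cpow (by positivity)]; simp
    rw [e, ← Complex.ofReal_div, Complex.ofReal_re, Complex.norm_real,
      Real.norm_of_nonneg ArithmeticFunction.vonMangoldt_nonneg]
  have hre := Complex.hasSum_re hsum.hasSum
  calc _ ≤ _ := tsum_of_norm_bounded hre.summable.hasSum hn
    _ = _ := hre.tsum_eq
    _ ≤ _ := Complex.re_le_norm _

lemma exists_norm_LSeries_vonMangoldt_le : ∃ C > 0, ∀ s : ℂ, 1 < s.re → s.re ≤ 2 →
    ‖LSeries (fun n => ((ArithmeticFunction.vonMangoldt n : ℝ) : ℂ)) s‖ ≤ C / (s.re - 1) := by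
  have hc : ContinuousOn (fun σ : ℝ => deriv riemannZeta₁ σ / riemannZeta₁ σ) (Set.Icc 1 2) := by
    apply ContinuousOn.div
    · exact (differentiable_riemannZeta₁.deriv.continuous.comp Complex.continuous_ofReal).continuousOn
    · exact (differentiable_riemannZeta₁.continuous.comp Complex.continuous_ofReal).continuousOn
    · intro σ hσ; exact riemannZeta₁_ne_zero_of_one_le_re (by simpa using hσ.1)
  obtain ⟨C, hC⟩ := isCompact_Icc.exists_bound_of_continuousOn hc
  refine ⟨|C| + 1, by positivity, fun s h1 h2 => ?_⟩
  refine (norm_LSeries_vonMangoldt_le s h1).trans ?_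
  have h := neg_logDeriv_riemannZeta₁ (s := (s.re : ℂ)) (by simpa using h1)
  have hb := hC s.re ⟨h1.le, h2⟩
  have e : LSeries (fun n => ((ArithmeticFunction.vonMangoldt n : ℝ) : ℂ)) (s.re : ℂ) =
    -(deriv riemannZeta₁ (s.re : ℂ) / riemannZeta₁ (s.re : ℂ)) + 1 / ((s.re : ℂ) - 1) := by
      rw [h]; ring
  rw [e]
  refine (norm_add_le _ _).trans ?_
  rw [norm_neg]
  have h0 : 0 < s.re - 1 := by linarith
  have e2 : ‖1 / ((s.re : ℂ) - 1)‖ = 1 / (s.re - 1) := by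
    rw [← Complex.ofReal_one, ← Complex.ofReal_sub, ← Complex.ofReal_div, Complex.norm_real,
      Real.norm_of_nonneg (by positivity)]
  rw [e2, add_div]
  gcongr
  refine hb.trans ((le_abs_self C).trans ?_)
  rw [le_div_iff₀ h0]
  nlinarith [abs_nonneg C]

lemma one_lt_log_abs_add_four (t : ℝ) : 1 < Real.log (|t| + 4) := by
  rw [Real.lt_log_iff_exp_lt (by positivity)]
  have := Real.exp_one_lt_d9; have := abs_nonneg t; linarith

lemma exists_norm_logDeriv_riemannZeta₁_le : ∃ c > 0, c ≤ 1 / 8 ∧ ∃ C > 0, ∀ s : ℂ,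
    1 - c / Real.log (|s.im| + 4) ≤ s.re → s.re ≤ 2 → riemannZeta₁ s ≠ 0 ∧
      ‖deriv riemannZeta₁ s / riemannZeta₁ s‖ ≤ C * Real.log (|s.im| + 4) ^ 2 := by
  obtain ⟨c, hc0, hc1, hzf⟩ := exists_zeroFree_region
  obtain ⟨C, hC0, hC⟩ := exists_norm_LSeries_vonMangoldt_le
  set K := |Real.log (324 * 64 / c ^ 2)| + 4 with hK
  refine ⟨c / 8, by positivity, by linarith, 8 * K * (8 / c) + (C + 1) * (8 / c), by positivity, ?_⟩
  intro s hs hs2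
  set W := |s.im| + 4 with hW
  set L := Real.log W with hL
  have hL1 : 1 < L := one_lt_log_abs_add_four s.im
  have hW4 : 4 ≤ W := by have := abs_nonneg s.im; linarith
  set η := c / 8 / L with hη
  have hη0 : 0 < η := by positivity
  have hη1 : η ≤ 1 / 32 := by
    refine (div_le_self (by positivity) hL1.le).trans (by linarith)
  have hηc : 8 / c * L = 1 / η := by rw [hη]; field_simp
  have hne : riemannZeta₁ s ≠ 0 := by
    apply hzf
    refine lt_of_lt_of_le ?_ hs
    have : c / 8 / L < c / L := by gcongr; linarith
    linarith
  refine ⟨hne, ?_⟩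
  by_cases hcase : 1 + η ≤ s.re
  · have h := neg_logDeriv_riemannZeta₁ (s := s) (by linarith)
    rw [← norm_neg, h]
    have h2 := hC s (by linarith) hs2
    have h3 : ‖1 / (s - 1)‖ ≤ 1 / η := by
      rw [norm_div, norm_one]
      gcongr
      have := Complex.re_le_norm (s - 1)
      simp at this; linarith
    calc _ ≤ C / (s.re - 1) + 1 / η := (norm_sub_le _ _).trans (by gcongr)
      _ ≤ C / η + 1 / η := by gcongr; linarith
      _ = (C + 1) * (8 / c) * L := by rw [mul_assoc, hηc]; ring
      _ ≤ (C + 1) * (8 / c) * L ^ 2 := by gcongr; nlinarith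
      _ ≤ _ := by gcongr; linarith [show 0 < 8 * K * (8 / c) by positivity]
  · push Not at hcase
    set s0 : ℂ := 1 + η + s.im * Complex.I with hs0
    have hs0re : s0.re = 1 + η := by simp [hs0]
    have hs0im : s0.im = s.im := by simp [hs0]
    set g : ℂ → ℂ := fun z => riemannZeta₁ (s0 + z) with hg
    have hgd : Differentiable ℂ g := by
      have := differentiable_riemannZeta₁
      intro z
      exact (this (s0 + z)).comp z (by fun_prop)
    have hdg : ∀ z, deriv g z = deriv riemannZeta₁ (s0 + z) := by
      intro z; rw [hg, deriv_comp_const_add]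
    have hgne : ∀ z ∈ Metric.ball (0:ℂ) (4 * η), g z ≠ 0 := by
      intro z hz
      rw [mem_ball_zero_iff] at hz
      apply hzf
      have h1 := Complex.abs_re_le_norm z
      have h2 := Complex.abs_im_le_norm z
      rw [Complex.add_re, Complex.add_im, hs0re, hs0im]
      have h3 : Real.log (|s.im + z.im| + 4) ≤ 2 * L := by
        have : |s.im + z.im| + 4 ≤ W ^ 2 := by
          have := abs_add_le s.im z.im
          nlinarith
        have h := Real.log_le_log (by positivity) this
        rwa [Real.log_pow] at h
      have h4 : 4 * η ≤ c / Real.log (|s.im + z.im| + 4) := by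
        have : 4 * η = c / (2 * L) := by rw [hη]; field_simp; norm_num
        rw [this]
        have := one_lt_log_abs_add_four (s.im + z.im)
        gcongr
      have := (abs_le.1 (h1.trans hz.le)).1
      linarith
    have hB : ∀ z ∈ Metric.ball (0:ℂ) (4 * η), ‖g z‖ ≤ Real.exp (K * L) * ‖g 0‖ := by
      intro z hz
      rw [mem_ball_zero_iff] at hz
      have hre := Complex.abs_re_le_norm z
      have h1 : 1/2 ≤ (s0 + z).re := by
        rw [Complex.add_re, hs0re]
        have := abs_le.1 (hre.trans hz.le); linarith
      have hb : ‖g z‖ ≤ 12 * W ^ 2 := by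
        refine (norm_riemannZeta₁_le h1).trans ?_
        have h2 : ‖s0 + z‖ ≤ 1 + η + |s.im| + 1/2 := by
          refine (norm_add_le _ _).trans (add_le_add ?_ (by linarith))
          refine (Complex.norm_le_abs_re_add_abs_im s0).trans ?_
          rw [hs0re, hs0im, abs_of_pos (by linarith)]
        have h3 : ‖s0 + z‖ + 1 ≤ 2 * W := by linarith
        nlinarith [norm_nonneg (s0 + z)]
      refine hb.trans ?_
      have hlow := le_norm_riemannZeta₁ (s := s0) (by linarith) (by rw [hs0re]; linarith)
      rw [hs0re] at hlow
      have hg0 : g 0 = riemannZeta₁ s0 := by simp [hg]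
      rw [hg0]
      have e1 : 324 * 64 / c ^ 2 * W ^ 4 ≤ Real.exp (K * L) := by
        have : 324 * 64 / c ^ 2 * W ^ 4 = Real.exp (Real.log (324 * 64 / c ^ 2) + 4 * L) := by
          rw [Real.exp_add, Real.exp_log (by positivity), mul_comm 4 L, Real.exp_mul,
            Real.exp_log (by linarith)]
          norm_cast
        rw [this]
        apply Real.exp_le_exp.2
        have := le_abs_self (Real.log (324 * 64 / c ^ 2))
        have := abs_nonneg (Real.log (324 * 64 / c ^ 2))
        rw [hK]; nlinarith
      calc 12 * W ^ 2 = 324 * 64 / c ^ 2 * (W ^ 2 * L ^ 2) * ((1 + η - 1) ^ 2 / 27) := by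
            rw [hη]; field_simp; ring
        _ ≤ 324 * 64 / c ^ 2 * W ^ 4 * ((1 + η - 1) ^ 2 / 27) := by
            gcongr
            have : L ≤ W := Real.log_le_self (by linarith)
            calc W ^ 2 * L ^ 2 ≤ W ^ 2 * W ^ 2 := by gcongr
              _ = W ^ 4 := by ring
        _ ≤ _ := by gcongr
    have hz : ‖s - s0‖ ≤ 2 * η := by
      have e : s - s0 = ((s.re - (1 + η) : ℝ) : ℂ) :=
        Complex.ext (by simp [hs0]) (by simp [hs0])
      rw [e, Complex.norm_real, Real.norm_eq_abs, abs_le]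
      constructor <;> linarith
    have hfin := norm_deriv_div_le_of_zeroFree (by positivity) (by positivity : 0 < K * L)
      hgd.differentiableOn hgne hB (z := s - s0) (by linarith)
    rw [hdg, hg] at hfin
    simp only [add_sub_cancel] at hfin
    calc _ ≤ _ := hfin
      _ ≤ 8 * (K * L) * (4 * η) / (4 * η - 2 * η) ^ 2 := by
        gcongr
        · exact pow_pos (by linarith) 2
        · linarith
      _ = 8 * K * (1 / η) * L := by field_simp; ring
      _ = 8 * K * (8 / c) * L ^ 2 := by rw [← hηc]; ring
      _ ≤ _ := by gcongr; linarith [show 0 < (C + 1) * (8 / c) by positivity]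

/-- The hat weight `(1 - y)₊`. -/
noncomputable def hatWeight (y : ℝ) : ℝ := max 0 (1 - y)

/-- The integral of the hat weight, `∫_1^∞ (1 - u y)₊ du`. -/
noncomputable def hatIntegral (y : ℝ) : ℝ := max 0 (1 - y) ^ 2 / (2 * y)

lemma hasMellin_hatWeight {s : ℂ} (hs : 0 < s.re) :
    HasMellin (fun y => ((hatWeight y : ℝ) : ℂ)) s (1 / (s * (s + 1))) := by
  have h0 := hasMellin_one_Ioc hs
  have h1 := hasMellin_cpow_Ioc 1 (s := s) (by simp; linarith)
  have h := hasMellin_sub h0.1 h1.1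
  rw [h0.2, h1.2] at h
  have hs0 : s ≠ 0 := by rintro rfl; simp at hs
  have hs1 : s + 1 ≠ 0 := by
    intro h; have := congrArg Complex.re h; simp at this; linarith
  have e : 1 / s - 1 / (s + 1) = 1 / (s * (s + 1)) := by field_simp; ring
  rw [e] at h
  have hfun : ∀ t ∈ Set.Ioi (0:ℝ), (Set.Ioc (0:ℝ) 1).indicator (fun _ => (1:ℂ)) t -
      (Set.Ioc (0:ℝ) 1).indicator (fun t : ℝ => (t:ℂ) ^ (1:ℂ)) t = ((hatWeight t : ℝ) : ℂ) := by
    intro t ht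
    unfold hatWeight
    by_cases h1 : t ≤ 1
    · have hmem : t ∈ Set.Ioc (0:ℝ) 1 := ⟨ht, h1⟩
      rw [Set.indicator_of_mem hmem, Set.indicator_of_mem hmem, max_eq_right (by linarith)]
      simp
    · have : t ∉ Set.Ioc (0:ℝ) 1 := fun h => h1 h.2
      rw [Set.indicator_of_notMem this, Set.indicator_of_notMem this, max_eq_left (by linarith)]
      simp
  refine ⟨?_, ?_⟩
  · refine h.1.congr_fun (fun t ht => ?_) measurableSet_Ioi
    simp only [hfun t ht]
  · rw [← h.2]
    refine setIntegral_congr_fun measurableSet_Ioi fun t ht => ?_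
    simp only [hfun t ht]

lemma hasMellin_hatIntegral {s : ℂ} (hs : 1 < s.re) :
    HasMellin (fun y => ((hatIntegral y : ℝ) : ℂ)) s (1 / ((s - 1) * (s * (s + 1)))) := by
  have h0 := hasMellin_one_Ioc (s := s) (by linarith)
  have h1 := hasMellin_cpow_Ioc 1 (s := s) (by simp; linarith)
  have h2 := hasMellin_cpow_Ioc (-1) (s := s) (by simp; linarith)
  have h3 := hasMellin_add h2.1 h1.1
  have h4 := hasMellin_const_smul h3.1 (1/2 : ℂ)
  have h := hasMellin_sub h4.1 h0.1
  rw [h4.2, h3.2, h0.2, h1.2, h2.2] at h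
  have hs0 : s ≠ 0 := by rintro rfl; norm_num at hs
  have hs1 : s + 1 ≠ 0 := by
    intro h; have := congrArg Complex.re h; simp at this; linarith
  have hs2 : s - 1 ≠ 0 := by
    intro h; have := congrArg Complex.re h; simp at this; linarith
  have e : (1/2 : ℂ) • (1 / (s + -1) + 1 / (s + 1)) - 1 / s = 1 / ((s - 1) * (s * (s + 1))) := by
    rw [← sub_eq_add_neg, smul_eq_mul]; field_simp; ring
  rw [e] at h
  have hfun : ∀ t ∈ Set.Ioi (0:ℝ),
      (1/2 : ℂ) • ((Set.Ioc (0:ℝ) 1).indicator (fun t : ℝ => (t:ℂ) ^ (-1:ℂ)) t +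
      (Set.Ioc (0:ℝ) 1).indicator (fun t : ℝ => (t:ℂ) ^ (1:ℂ)) t) -
      (Set.Ioc (0:ℝ) 1).indicator (fun _ => (1:ℂ)) t = ((hatIntegral t : ℝ) : ℂ) := by
    intro t ht
    have ht0 : (t:ℂ) ≠ 0 := by exact_mod_cast (ne_of_gt ht)
    unfold hatIntegral
    by_cases h1 : t ≤ 1
    · have hmem : t ∈ Set.Ioc (0:ℝ) 1 := ⟨ht, h1⟩
      rw [Set.indicator_of_mem hmem, Set.indicator_of_mem hmem, Set.indicator_of_mem hmem, max_eq_right (by linarith)]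
      rw [Complex.cpow_neg_one, Complex.cpow_one]
      push_cast
      rw [smul_eq_mul]; field_simp; ring
    · have : t ∉ Set.Ioc (0:ℝ) 1 := fun h => h1 h.2
      rw [Set.indicator_of_notMem this, Set.indicator_of_notMem this,
        Set.indicator_of_notMem this, max_eq_left (by linarith)]
      simp
  refine ⟨?_, ?_⟩
  · refine h.1.congr_fun (fun t ht => ?_) measurableSet_Ioi
    simp only [hfun t ht]
  · rw [← h.2]
    refine setIntegral_congr_fun measurableSet_Ioi fun t ht => ?_
    simp only [hfun t ht]

lemma norm_inv_mul_add_one_le {σ v : ℝ} (hσ : 1 ≤ σ) :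
    ‖1 / (((σ:ℂ) + v * Complex.I) * ((σ:ℂ) + v * Complex.I + 1))‖ ≤ (1 + v ^ 2)⁻¹ := by
  rw [norm_div, norm_one, one_div]
  apply inv_anti₀ (by positivity)
  rw [norm_mul]
  have h1 : ‖(σ:ℂ) + v * Complex.I‖ ^ 2 = σ ^ 2 + v ^ 2 := by
    rw [← Complex.normSq_eq_norm_sq, Complex.normSq_add_mul_I]
  have h2 : ‖(σ:ℂ) + v * Complex.I + 1‖ ^ 2 = (σ + 1) ^ 2 + v ^ 2 := by
    have : (σ:ℂ) + v * Complex.I + 1 = ((σ + 1 : ℝ) : ℂ) + v * Complex.I := by push_cast; ring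
    rw [this, ← Complex.normSq_eq_norm_sq, Complex.normSq_add_mul_I]
  have h3 : ‖(σ:ℂ) + v * Complex.I‖ ≤ ‖(σ:ℂ) + v * Complex.I + 1‖ := by
    rw [← sq_le_sq₀ (norm_nonneg _) (norm_nonneg _), h1, h2]; nlinarith
  calc 1 + v ^ 2 ≤ ‖(σ:ℂ) + v * Complex.I‖ ^ 2 := by rw [h1]; nlinarith
    _ ≤ _ := by rw [sq]; gcongr

lemma continuous_vertical_kernel {σ : ℝ} (hσ : 1 ≤ σ) :
    Continuous fun v : ℝ => 1 / (((σ:ℂ) + v * Complex.I) * ((σ:ℂ) + v * Complex.I + 1)) := by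
  apply Continuous.div (by fun_prop) (by fun_prop)
  intro v
  apply mul_ne_zero
  · intro h; have := congrArg Complex.re h; simp at this; linarith
  · intro h; have := congrArg Complex.re h; simp at this; linarith

lemma verticalIntegrable_kernel {σ : ℝ} (hσ : 1 ≤ σ) :
    Integrable fun v : ℝ => 1 / (((σ:ℂ) + v * Complex.I) * ((σ:ℂ) + v * Complex.I + 1)) :=
  integrable_inv_one_add_sq.mono' (continuous_vertical_kernel hσ).aestronglyMeasurable
    (Filter.Eventually.of_forall fun _ => norm_inv_mul_add_one_le hσ)

lemma re_sub_one_ne_zero {σ v : ℝ} (hσ : 1 < σ) : (σ:ℂ) + v * Complex.I - 1 ≠ 0 := by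
  intro h; have := congrArg Complex.re h; simp at this; linarith

lemma norm_inv_sub_one_le {σ v : ℝ} (hσ : 1 < σ) :
    ‖1 / ((σ:ℂ) + v * Complex.I - 1)‖ ≤ 1 / (σ - 1) := by
  rw [norm_div, norm_one]
  have : 0 < σ - 1 := by linarith
  gcongr
  have := Complex.re_le_norm ((σ:ℂ) + v * Complex.I - 1)
  simpa using this

lemma hatWeight_inversion {σ y : ℝ} (hσ : 1 < σ) (hy : 0 < y) :
    ((hatWeight y : ℝ) : ℂ) = (1 / (2 * π)) • ∫ v : ℝ, (y : ℂ) ^ (-((σ:ℂ) + v * Complex.I)) *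
      (1 / (((σ:ℂ) + v * Complex.I) * ((σ:ℂ) + v * Complex.I + 1))) := by
  have hm : ∀ v : ℝ, mellin (fun y => ((hatWeight y : ℝ) : ℂ)) ((σ:ℂ) + v * Complex.I) =
      1 / (((σ:ℂ) + v * Complex.I) * ((σ:ℂ) + v * Complex.I + 1)) := fun v =>
    (hasMellin_hatWeight (by simp; linarith)).2
  have h := mellinInv_mellin_eq σ (fun y => ((hatWeight y : ℝ) : ℂ)) hy
    (hasMellin_hatWeight (by simp; linarith)).1 ?_ ?_
  · rw [← h]
    unfold mellinInv
    simp only [hm, smul_eq_mul]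
  · unfold Complex.VerticalIntegrable
    simp only [hm]
    exact verticalIntegrable_kernel hσ.le
  · apply Continuous.continuousAt
    unfold hatWeight
    fun_prop

lemma hatIntegral_inversion {σ y : ℝ} (hσ : 1 < σ) (hy : 0 < y) :
    ((hatIntegral y : ℝ) : ℂ) = (1 / (2 * π)) • ∫ v : ℝ, (y : ℂ) ^ (-((σ:ℂ) + v * Complex.I)) *
      (1 / ((σ:ℂ) + v * Complex.I - 1) *
        (1 / (((σ:ℂ) + v * Complex.I) * ((σ:ℂ) + v * Complex.I + 1)))) := by
  have hm : ∀ v : ℝ, mellin (fun y => ((hatIntegral y : ℝ) : ℂ)) ((σ:ℂ) + v * Complex.I) =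
      1 / ((σ:ℂ) + v * Complex.I - 1) *
        (1 / (((σ:ℂ) + v * Complex.I) * ((σ:ℂ) + v * Complex.I + 1))) := fun v => by
    rw [(hasMellin_hatIntegral (by simp; linarith)).2, one_div_mul_one_div]
  have h := mellinInv_mellin_eq σ (fun y => ((hatIntegral y : ℝ) : ℂ)) hy
    (hasMellin_hatIntegral (by simp; linarith)).1 ?_ ?_
  · rw [← h]
    unfold mellinInv
    simp only [hm, smul_eq_mul]
  · unfold Complex.VerticalIntegrable
    simp only [hm]
    refine Integrable.bdd_mul (c := 1 / (σ - 1)) (verticalIntegrable_kernel hσ.le) ?_ ?_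
    · apply Continuous.aestronglyMeasurable
      exact Continuous.div (by fun_prop) (by fun_prop) fun v => re_sub_one_ne_zero hσ
    · exact Filter.Eventually.of_forall fun v => norm_inv_sub_one_le hσ
  · apply ContinuousAt.comp Complex.continuous_ofReal.continuousAt
    unfold hatIntegral
    apply ContinuousAt.div (by fun_prop) (by fun_prop)
    positivity

/-- The integrand of the smoothed explicit formula. -/
noncomputable def perronIntegrand (x : ℝ) (s : ℂ) : ℂ :=
  (x : ℂ) ^ s * (-(deriv riemannZeta₁ s / riemannZeta₁ s)) * (1 / (s * (s + 1)))

lemma smoothed_explicit_formula {σ x : ℝ} (hσ : 1 < σ) (hx : 0 < x) :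
    ((∑' n : ℕ, ArithmeticFunction.vonMangoldt n * hatWeight (n / x) - hatIntegral (1 / x) : ℝ) : ℂ)
      = (1 / (2 * π)) • ∫ v : ℝ, perronIntegrand x ((σ:ℂ) + v * Complex.I) := by
  have hxc : (x:ℂ) ≠ 0 := by exact_mod_cast hx.ne'
  set Λc : ℕ → ℂ := fun n => ((ArithmeticFunction.vonMangoldt n : ℝ) : ℂ) with hΛc
  set k : ℝ → ℂ := fun v => 1 / (((σ:ℂ) + v * Complex.I) * ((σ:ℂ) + v * Complex.I + 1)) with hk
  set S : ℝ → ℂ := fun v => (σ:ℂ) + v * Complex.I with hS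
  have hkint : Integrable k := verticalIntegrable_kernel hσ.le
  have hScont : Continuous S := by fun_prop
  have hSre : ∀ v, (S v).re = σ := fun v => by simp [hS]
  have hsumm : ∀ v, LSeriesSummable Λc (S v) := fun v =>
    ArithmeticFunction.LSeriesSummable_vonMangoldt (by rw [hSre]; exact hσ)
  set Fn : ℕ → ℝ → ℂ := fun n v => (x:ℂ) ^ (S v) * LSeries.term Λc (S v) n * k v with hFn
  have hcont : ∀ n, Continuous fun v => (x:ℂ) ^ (S v) * LSeries.term Λc (S v) n := by
    intro n
    apply Continuous.mul
    · exact hScont.const_cpow (Or.inl hxc)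
    · rcases eq_or_ne n 0 with rfl | hn
      · simp only [LSeries.term_zero]; exact continuous_const
      · simp only [LSeries.term_of_ne_zero hn]
        apply Continuous.div continuous_const (hScont.const_cpow (Or.inl (by exact_mod_cast hn)))
        intro v
        rw [Complex.cpow_ne_zero_iff]; left; exact_mod_cast hn
  have hnorm : ∀ n v, ‖(x:ℂ) ^ (S v) * LSeries.term Λc (S v) n‖ =
      x ^ σ * ‖LSeries.term Λc (σ:ℂ) n‖ := by
    intro n v
    rw [norm_mul, Complex.norm_cpow_eq_rpow_re_of_pos hx, hSre, LSeries.norm_term_eq,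
      LSeries.norm_term_eq, hSre, Complex.ofReal_re]
  have hFint : ∀ n, Integrable (Fn n) := by
    intro n
    refine Integrable.bdd_mul (c := x ^ σ * ‖LSeries.term Λc (σ:ℂ) n‖) hkint
      (hcont n).aestronglyMeasurable (Filter.Eventually.of_forall fun v => (hnorm n v).le)
  have hFsum : Summable fun n => ∫ v, ‖Fn n v‖ := by
    have : ∀ n, ∫ v, ‖Fn n v‖ = ‖LSeries.term Λc (σ:ℂ) n‖ * (x ^ σ * ∫ v, ‖k v‖) := by
      intro n
      simp only [hFn]
      rw [← integral_const_mul, ← integral_const_mul]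
      congr 1; ext v
      rw [norm_mul, hnorm]; ring
    simp only [this]
    refine Summable.mul_right _ ?_
    exact (ArithmeticFunction.LSeriesSummable_vonMangoldt (s := (σ:ℂ)) (by simpa using hσ)).norm
  have hmain := hasSum_integral_of_summable_integral_norm hFint hFsum
  have hinv : ∀ n : ℕ, ∫ v, Fn n v = (2 * π : ℝ) •
      ((ArithmeticFunction.vonMangoldt n * hatWeight (n / x) : ℝ) : ℂ) := by
    intro n
    rcases eq_or_ne n 0 with rfl | hn
    · simp [hFn]
    have hn0 : (0:ℝ) < n := by exact_mod_cast Nat.pos_of_ne_zero hn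
    push_cast
    rw [hatWeight_inversion hσ (div_pos hn0 hx), mul_smul_comm, smul_smul]
    have : (2 * π) * (1 / (2 * π)) = 1 := by field_simp
    rw [this, one_smul, ← integral_const_mul]
    congr 1; ext v
    simp only [hFn, LSeries.term_of_ne_zero hn, hΛc, hk, hS]
    rw [Complex.cpow_neg, Complex.ofReal_div, Complex.div_cpow_ofReal_nonneg hn0.le hx.le, inv_div,
      Complex.ofReal_natCast]
    ring
  have htsum : ∀ v, ∑' n, Fn n v = (x:ℂ) ^ (S v) * LSeries Λc (S v) * k v := by
    intro v
    simp only [hFn]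
    rw [tsum_mul_right, tsum_mul_left]; rfl
  simp only [htsum] at hmain
  have hL : ∀ v, LSeries Λc (S v) =
      -(deriv riemannZeta₁ (S v) / riemannZeta₁ (S v)) + 1 / (S v - 1) := by
    intro v
    rw [neg_logDeriv_riemannZeta₁ (by rw [hSre]; exact hσ)]; ring
  have hLcont : Continuous fun v => LSeries Λc (S v) := by
    simp only [hL]
    refine Continuous.add (Continuous.neg (Continuous.div ?_ ?_ fun v => ?_))
      (Continuous.div (by fun_prop) (by fun_prop) fun v => re_sub_one_ne_zero hσ)
    · exact differentiable_riemannZeta₁.deriv.continuous.comp hScont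
    · exact differentiable_riemannZeta₁.continuous.comp hScont
    · exact riemannZeta₁_ne_zero_of_one_le_re (by rw [hSre]; exact hσ.le)
  have hxcont : Continuous fun v => (x:ℂ) ^ (S v) := hScont.const_cpow (Or.inl hxc)
  have hxnorm : ∀ v, ‖(x:ℂ) ^ (S v)‖ = x ^ σ := fun v => by
    rw [Complex.norm_cpow_eq_rpow_re_of_pos hx, hSre]
  have hsumm_int : Integrable fun v => (x:ℂ) ^ (S v) * LSeries Λc (S v) * k v := by
    refine Integrable.bdd_mul (c := x ^ σ * ‖LSeries Λc (σ:ℂ)‖) hkint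
      (hxcont.mul hLcont).aestronglyMeasurable (Filter.Eventually.of_forall fun v => ?_)
    rw [norm_mul, hxnorm]
    gcongr
    have := norm_LSeries_vonMangoldt_le (S v) (by rw [hSre]; exact hσ)
    rwa [hSre] at this
  have hsub_int : Integrable fun v => (x:ℂ) ^ (S v) * (1 / (S v - 1)) * k v := by
    refine Integrable.bdd_mul (c := x ^ σ * (1 / (σ - 1))) hkint
      (hxcont.mul (Continuous.div (by fun_prop) (by fun_prop)
        fun v => re_sub_one_ne_zero hσ)).aestronglyMeasurable
      (Filter.Eventually.of_forall fun v => ?_)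
    rw [norm_mul, hxnorm]
    gcongr
    exact norm_inv_sub_one_le hσ
  have hI := hatIntegral_inversion hσ (one_div_pos.2 hx)
  have hI' : ((hatIntegral (1 / x) : ℝ) : ℂ) =
      (1 / (2 * π)) • ∫ v, (x:ℂ) ^ (S v) * (1 / (S v - 1)) * k v := by
    rw [hI]
    congr 2; ext v
    have : (((1 / x : ℝ) : ℂ)) ^ (-(S v)) = (x:ℂ) ^ (S v) := by
      rw [one_div, Complex.ofReal_inv, Complex.inv_cpow_ofReal_nonneg hx.le, Complex.cpow_neg,
        inv_inv]
    simp only [hS] at this ⊢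
    rw [this, mul_assoc]
  have hΛ : ((∑' n : ℕ, ArithmeticFunction.vonMangoldt n * hatWeight (n / x) : ℝ) : ℂ) =
      (1 / (2 * π)) • ∫ v, (x:ℂ) ^ (S v) * LSeries Λc (S v) * k v := by
    simp only [hinv] at hmain
    rw [← hmain.tsum_eq, tsum_const_smul'', smul_smul, Complex.ofReal_tsum]
    have : (1 / (2 * π)) * (2 * π) = 1 := by field_simp
    rw [this, one_smul]
  rw [Complex.ofReal_sub, hI', hΛ, ← smul_sub, ← integral_sub hsumm_int hsub_int]
  congr 2; ext v
  rw [hL]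
  simp only [perronIntegrand, hk, hS]
  ring

lemma norm_perronIntegrand_le {x : ℝ} (hx : 0 < x) {s : ℂ} {F k : ℝ}
    (hF : ‖deriv riemannZeta₁ s / riemannZeta₁ s‖ ≤ F) (hk : ‖1 / (s * (s + 1))‖ ≤ k) :
    ‖perronIntegrand x s‖ ≤ x ^ s.re * F * k := by
  unfold perronIntegrand
  rw [norm_mul, norm_mul, Complex.norm_cpow_eq_rpow_re_of_pos hx, norm_neg]
  have := (norm_nonneg _).trans hF
  gcongr

lemma continuous_perronIntegrand_vertical {x σ : ℝ} (hx : 0 < x) (hσ : 1 < σ) :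
    Continuous fun v : ℝ => perronIntegrand x ((σ:ℂ) + v * Complex.I) := by
  unfold perronIntegrand
  have hS : Continuous fun v : ℝ => (σ:ℂ) + v * Complex.I := by fun_prop
  refine Continuous.mul (Continuous.mul (hS.const_cpow (Or.inl (by exact_mod_cast hx.ne')))
    (Continuous.neg (Continuous.div (differentiable_riemannZeta₁.deriv.continuous.comp hS)
      (differentiable_riemannZeta₁.continuous.comp hS) fun v =>
        riemannZeta₁_ne_zero_of_one_le_re (by simpa using hσ.le)))) (continuous_vertical_kernel hσ.le)

lemma norm_integral_sub_intervalIntegral_le {G : ℝ → ℂ} {A T : ℝ} (hG : Continuous G) (hT : 0 < T)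
    (hA : ∀ v, ‖G v‖ ≤ A * (1 + v ^ 2)⁻¹) :
    ‖(∫ v, G v) - ∫ v in (-T)..T, G v‖ ≤ 2 * A / T := by
  have hintg : Integrable G := (integrable_inv_one_add_sq.const_mul A).mono'
    hG.aestronglyMeasurable (Filter.Eventually.of_forall hA)
  have hint2 := integrable_inv_one_add_sq.const_mul A
  have hA0 : 0 ≤ A := by have := (norm_nonneg _).trans (hA 0); simpa using this
  have e : (∫ v, G v) - ∫ v in (-T)..T, G v = (∫ v in Set.Iic (-T), G v) + ∫ v in Set.Ioi T, G v := by
    rw [← intervalIntegral.integral_Iic_add_Ioi (b := T) hintg.integrableOn hintg.integrableOn,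
      ← intervalIntegral.integral_Iic_sub_Iic (a := -T) hintg.integrableOn hintg.integrableOn]
    ring
  have harc : π / 2 - Real.arctan T ≤ 1 / T := by
    rw [← Real.arctan_inv_of_pos hT, one_div]
    have h0 : 0 ≤ Real.arctan T⁻¹ := Real.arctan_nonneg.2 (by positivity)
    exact (Real.le_tan h0 (Real.arctan_lt_pi_div_two _)).trans_eq (Real.tan_arctan _)
  have h1 : ‖∫ v in Set.Iic (-T), G v‖ ≤ A * (1 / T) := by
    refine (norm_integral_le_of_norm_le hint2.integrableOn (Filter.Eventually.of_forall hA)).trans ?_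
    rw [integral_const_mul, integral_Iic_inv_one_add_sq, Real.arctan_neg]
    gcongr; linarith
  have h2 : ‖∫ v in Set.Ioi T, G v‖ ≤ A * (1 / T) := by
    refine (norm_integral_le_of_norm_le hint2.integrableOn (Filter.Eventually.of_forall hA)).trans ?_
    rw [integral_const_mul, integral_Ioi_inv_one_add_sq]
    gcongr
  rw [e]
  calc _ ≤ A * (1 / T) + A * (1 / T) := (norm_add_le _ _).trans (add_le_add h1 h2)
    _ = _ := by ring

set_option maxHeartbeats 2000000 in
lemma exists_smoothed_psi_bound : ∃ a > 0, ∃ C > 0, ∀ x : ℝ, 3 ≤ x →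
    |∑' n : ℕ, ArithmeticFunction.vonMangoldt n * hatWeight (n / x) - hatIntegral (1 / x)| ≤
      C * x * Real.exp (-(a * √(Real.log x))) := by
  obtain ⟨c, hc0, hc1, C2, hC20, hreg⟩ := exists_norm_logDeriv_riemannZeta₁_le
  obtain ⟨C1, hC10, hC1⟩ := exists_norm_LSeries_vonMangoldt_le
  set a := c / 6 with ha
  have ha0 : 0 < a := by positivity
  set K := 2 * (Real.exp 1 * (C1 + 1)) + 36 * Real.exp 1 * C2 + 18 * C2 with hK
  have hK0 : 0 < K := by positivity
  refine ⟨a / 2, by positivity, K * (8 / a ^ 2), by positivity, ?_⟩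
  intro x hx3
  have hx : 0 < x := by linarith
  set l := Real.log x with hl
  have hl1 : 1 < l := by
    rw [hl, Real.lt_log_iff_exp_lt hx]
    have := Real.exp_one_lt_d9; linarith
  set y := √l with hy
  have hyl : y ^ 2 = l := Real.sq_sqrt (by linarith)
  have hy1 : 1 ≤ y := by rw [hy, Real.one_le_sqrt]; linarith
  set σ := 1 + 1 / l with hσ
  have hσ1 : 1 < σ := by rw [hσ]; have : 0 < 1 / l := by positivity
                         linarith
  have hσ2 : σ ≤ 2 := by
    have : 1 / l ≤ 1 := by rw [div_le_one (by linarith)]; linarith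
    linarith
  have hxσ : x ^ σ = Real.exp 1 * x := by
    rw [Real.rpow_def_of_pos hx, ← hl, hσ, mul_add, Real.exp_add, mul_one, hl, Real.exp_log hx,
      mul_one_div_cancel (by linarith)]; ring
  set T := Real.exp (a * y) with hT
  have hT1 : 1 ≤ T := by rw [hT]; apply Real.one_le_exp; positivity
  have hT0 : 0 < T := by linarith
  set LT := Real.log (T + 4) with hLT
  have hLT1 : 1 < LT := by have := one_lt_log_abs_add_four T; rwa [abs_of_pos hT0] at this
  have hLT3 : LT ≤ 3 * y := by
    have h5 : Real.log 5 ≤ 2 := by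
      rw [Real.log_le_iff_le_exp (by norm_num)]
      have : (2.7:ℝ) ^ 2 ≤ Real.exp 1 ^ 2 := by
        gcongr; have := Real.exp_one_gt_d9; linarith
      rw [← Real.exp_nat_mul] at this; norm_num at this; linarith
    have : LT ≤ Real.log (5 * T) := Real.log_le_log (by linarith) (by linarith)
    rw [Real.log_mul (by norm_num) hT0.ne', hT, Real.log_exp] at this
    nlinarith
  have hLTl : LT ^ 2 ≤ 9 * l := by rw [← hyl]; nlinarith
  set σ1 := 1 - c / LT with hσ1'
  have hcLT : c / LT ≤ 1 / 8 := (div_le_self hc0.le hLT1.le).trans hc1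
  have hcLT0 : 0 < c / LT := by positivity
  have hreg' : ∀ s : ℂ, σ1 ≤ s.re → s.re ≤ σ → |s.im| ≤ T → riemannZeta₁ s ≠ 0 ∧
      ‖deriv riemannZeta₁ s / riemannZeta₁ s‖ ≤ C2 * LT ^ 2 := by
    intro s h1 h2 h3
    have hle : Real.log (|s.im| + 4) ≤ LT := Real.log_le_log (by positivity) (by linarith)
    have hlt := one_lt_log_abs_add_four s.im
    have h4 : c / LT ≤ c / Real.log (|s.im| + 4) := by gcongr
    obtain ⟨h5, h6⟩ := hreg s (by linarith) (by linarith)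
    refine ⟨h5, h6.trans ?_⟩
    gcongr
  have hexpl := smoothed_explicit_formula hσ1 hx
  set Q := ∑' n : ℕ, ArithmeticFunction.vonMangoldt n * hatWeight (n / x) - hatIntegral (1 / x)
  set G : ℝ → ℂ := fun v => perronIntegrand x ((σ:ℂ) + v * Complex.I) with hG
  have hGcont : Continuous G := continuous_perronIntegrand_vertical hx hσ1
  have hGbound : ∀ v, ‖G v‖ ≤ (Real.exp 1 * x * ((C1 + 1) * l)) * (1 + v ^ 2)⁻¹ := by
    intro v
    have hre : ((σ:ℂ) + v * Complex.I).re = σ := by simp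
    have h := norm_perronIntegrand_le hx (s := (σ:ℂ) + v * Complex.I) (F := (C1 + 1) * l)
      ?_ (norm_inv_mul_add_one_le hσ1.le)
    · rw [hre, hxσ] at h; exact h
    · rw [← norm_neg, neg_logDeriv_riemannZeta₁ (by rw [hre]; exact hσ1)]
      have h1 := hC1 ((σ:ℂ) + v * Complex.I) (by rw [hre]; exact hσ1) (by rw [hre]; exact hσ2)
      rw [hre] at h1
      have h2 := norm_inv_sub_one_le (v := v) hσ1
      have h3 : σ - 1 = 1 / l := by rw [hσ]; ring
      rw [h3] at h1 h2
      refine (norm_sub_le _ _).trans ((add_le_add h1 h2).trans (le_of_eq ?_))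
      field_simp
  have htail := norm_integral_sub_intervalIntegral_le hGcont hT0 hGbound
  have hrect := Complex.integral_boundary_rect_eq_zero_of_differentiableOn (perronIntegrand x)
    ⟨σ1, -T⟩ ⟨σ, T⟩ ?_
  swap
  · intro s hs
    rw [Complex.mem_reProdIm, Set.uIcc_of_le (by simp; linarith), Set.uIcc_of_le (by simp; linarith)] at hs
    obtain ⟨⟨h1, h2⟩, h3, h4⟩ := hs
    have hne := (hreg' s h1 h2 (abs_le.2 ⟨h3, h4⟩)).1
    have hs0 : s ≠ 0 := by rintro rfl; simp at h1; linarith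
    have hs1 : s + 1 ≠ 0 := by
      intro h; have := congrArg Complex.re h; simp at this h1; linarith
    have hxc : (x:ℂ) ≠ 0 := by exact_mod_cast hx.ne'
    have d1 := (differentiable_riemannZeta₁.deriv s)
    have d2 := (differentiable_riemannZeta₁ s)
    apply DifferentiableAt.differentiableWithinAt
    unfold perronIntegrand
    refine ((differentiableAt_id.const_cpow (Or.inl hxc)).mul (d1.div d2 hne).neg).mul ?_
    exact (differentiableAt_const _).div (differentiableAt_id.mul (differentiableAt_id.add_const _))
      (mul_ne_zero hs0 hs1)
  simp only at hrect
  have hhor : ∀ t : ℝ, |t| = T → ‖∫ u : ℝ in σ1..σ, perronIntegrand x (u + t * Complex.I)‖ ≤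
      2 * (Real.exp 1 * x * (C2 * LT ^ 2) * (1 / T)) := by
    intro t ht
    have := intervalIntegral.norm_integral_le_of_norm_le_const (a := σ1) (b := σ)
      (f := fun u : ℝ => perronIntegrand x (u + t * Complex.I))
      (C := Real.exp 1 * x * (C2 * LT ^ 2) * (1 / T)) ?_
    · refine this.trans ?_
      rw [mul_comm 2, abs_of_pos (by linarith)]
      gcongr
      linarith
    · intro u hu
      rw [Set.uIoc_of_le (by linarith)] at hu
      have hre : ((u:ℂ) + t * Complex.I).re = u := by simp
      have him : ((u:ℂ) + t * Complex.I).im = t := by simp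
      have h := norm_perronIntegrand_le hx (s := (u:ℂ) + t * Complex.I) (k := 1 / T)
        (hreg' _ (by rw [hre]; exact hu.1.le) (by rw [hre]; exact hu.2) (by rw [him, ht])).2 ?_
      · refine h.trans ?_
        rw [hre, ← hxσ]
        gcongr
        · linarith
        · exact hu.2
      · rw [norm_div, norm_one, norm_mul]
        gcongr
        have h1 : T ≤ ‖(u:ℂ) + t * Complex.I‖ := by
          have := Complex.abs_im_le_norm ((u:ℂ) + t * Complex.I); rwa [him, ht] at this
        have h2 : T ≤ ‖(u:ℂ) + t * Complex.I + 1‖ := by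
          have := Complex.abs_im_le_norm ((u:ℂ) + t * Complex.I + 1)
          rwa [Complex.add_im, him, Complex.one_im, add_zero, ht] at this
        nlinarith
  have hver : ‖∫ v : ℝ in (-T)..T, perronIntegrand x (σ1 + v * Complex.I)‖ ≤
      x ^ σ1 * (C2 * LT ^ 2) * 1 * (2 * T) := by
    have := intervalIntegral.norm_integral_le_of_norm_le_const (a := -T) (b := T)
      (f := fun v : ℝ => perronIntegrand x (σ1 + v * Complex.I))
      (C := x ^ σ1 * (C2 * LT ^ 2) * 1) ?_
    · refine this.trans (le_of_eq ?_)
      rw [abs_of_pos (by linarith)]; ring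
    · intro v hv
      rw [Set.uIoc_of_le (by linarith)] at hv
      have hre : ((σ1:ℂ) + v * Complex.I).re = σ1 := by simp
      have him : ((σ1:ℂ) + v * Complex.I).im = v := by simp
      have h := norm_perronIntegrand_le hx (s := (σ1:ℂ) + v * Complex.I) (k := 1)
        (hreg' _ (by rw [hre]) (by rw [hre]; linarith)
          (by rw [him, abs_le]; exact ⟨hv.1.le, hv.2⟩)).2 ?_
      · rwa [hre] at h
      · rw [norm_div, norm_one, norm_mul]
        apply div_le_one_of_le₀ _ (by positivity)
        have h1 : 7 / 8 ≤ ‖(σ1:ℂ) + v * Complex.I‖ := by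
          have := Complex.re_le_norm ((σ1:ℂ) + v * Complex.I); rw [hre] at this; linarith
        have h2 : 15 / 8 ≤ ‖(σ1:ℂ) + v * Complex.I + 1‖ := by
          have := Complex.re_le_norm ((σ1:ℂ) + v * Complex.I + 1)
          rw [Complex.add_re, hre, Complex.one_re] at this; linarith
        nlinarith
  have h1 := hhor (-T) (by rw [abs_neg, abs_of_pos hT0])
  have h2 := hhor T (abs_of_pos hT0)
  have hmid : ‖∫ v : ℝ in (-T)..T, G v‖ ≤ 2 * (2 * (Real.exp 1 * x * (C2 * LT ^ 2) * (1 / T))) +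
      x ^ σ1 * (C2 * LT ^ 2) * 1 * (2 * T) := by
    have e : ∫ v : ℝ in (-T)..T, G v = (∫ v : ℝ in (-T)..T, perronIntegrand x (σ1 + v * Complex.I)) +
      Complex.I * ((∫ u : ℝ in σ1..σ, perronIntegrand x (u + (-T : ℝ) * Complex.I)) -
        ∫ u : ℝ in σ1..σ, perronIntegrand x (u + T * Complex.I)) := by
      simp only [smul_eq_mul] at hrect
      linear_combination (-Complex.I) * hrect + ((∫ v : ℝ in (-T)..T, G v) -
        (∫ v : ℝ in (-T)..T, perronIntegrand x (σ1 + v * Complex.I))) * Complex.I_mul_I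
    rw [e]
    calc _ ≤ _ := norm_add_le _ _
      _ ≤ x ^ σ1 * (C2 * LT ^ 2) * 1 * (2 * T) +
          (2 * (Real.exp 1 * x * (C2 * LT ^ 2) * (1 / T)) +
            2 * (Real.exp 1 * x * (C2 * LT ^ 2) * (1 / T))) := by
        refine add_le_add hver ?_
        rw [norm_mul, Complex.norm_I, one_mul]
        exact (norm_sub_le _ _).trans (add_le_add h1 h2)
      _ = _ := by ring
  have hTinv : 1 / T = Real.exp (-(a * y)) := by rw [hT, Real.exp_neg, one_div]
  have hxσ1 : x ^ σ1 * T ≤ x * Real.exp (-(a * y)) := by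
    have : x ^ σ1 = x * Real.exp (-(l * (c / LT))) := by
      rw [Real.rpow_def_of_pos hx, ← hl, hσ1', mul_sub, sub_eq_add_neg, Real.exp_add, mul_one, hl,
        Real.exp_log hx]
    rw [this, mul_assoc, hT, ← Real.exp_add]
    gcongr
    have : 2 * a * y ≤ l * (c / LT) := by
      have e : l * (c / LT) = l * c / LT := by ring
      rw [e, le_div_iff₀ (by linarith), ← hyl, ha]
      calc 2 * (c / 6) * y * LT ≤ 2 * (c / 6) * y * (3 * y) := by gcongr
        _ = _ := by ring
    linarith
  have hQ : |Q| ≤ ‖∫ v, G v‖ := by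
    have : |Q| = ‖(Q : ℂ)‖ := by rw [Complex.norm_real, Real.norm_eq_abs]
    rw [this, hexpl, norm_smul, Real.norm_of_nonneg (by positivity)]
    have hpi : 1 / (2 * π) ≤ 1 := by
      rw [div_le_one (by positivity)]; have := Real.pi_gt_three; linarith
    have := norm_nonneg (∫ v, G v)
    nlinarith
  have htot : ‖∫ v, G v‖ ≤ K * x * (l * Real.exp (-(a * y))) := by
    have e : (∫ v, G v) = ((∫ v, G v) - ∫ v in (-T)..T, G v) + ∫ v in (-T)..T, G v := by ring
    rw [e]
    refine (norm_add_le _ _).trans ((add_le_add htail hmid).trans ?_)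
    rw [← hTinv] at hxσ1 ⊢
    calc 2 * (Real.exp 1 * x * ((C1 + 1) * l)) / T +
          (2 * (2 * (Real.exp 1 * x * (C2 * LT ^ 2) * (1 / T))) +
            x ^ σ1 * (C2 * LT ^ 2) * 1 * (2 * T))
        = 2 * (Real.exp 1 * (C1 + 1)) * x * (l * (1 / T)) +
          4 * Real.exp 1 * C2 * x * (1 / T) * LT ^ 2 + 2 * C2 * LT ^ 2 * (x ^ σ1 * T) := by ring
      _ ≤ 2 * (Real.exp 1 * (C1 + 1)) * x * (l * (1 / T)) +
          4 * Real.exp 1 * C2 * x * (1 / T) * (9 * l) + 2 * C2 * (9 * l) * (x * (1 / T)) := by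
        gcongr
      _ = K * x * (l * (1 / T)) := by rw [hK]; ring
  refine hQ.trans (htot.trans ?_)
  have hfin : l * Real.exp (-(a * y)) ≤ 8 / a ^ 2 * Real.exp (-(a / 2 * y)) := by
    have h3 := Real.quadratic_le_exp_of_nonneg (x := a / 2 * y) (by positivity)
    have h4 : l ≤ 8 / a ^ 2 * Real.exp (a / 2 * y) := by
      calc l = 8 / a ^ 2 * ((a / 2 * y) ^ 2 / 2) := by rw [← hyl]; field_simp; norm_num
        _ ≤ _ := by
          gcongr
          have : 0 < a / 2 * y := by positivity
          linarith
    calc l * Real.exp (-(a * y)) ≤ 8 / a ^ 2 * Real.exp (a / 2 * y) * Real.exp (-(a * y)) := by gcongr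
      _ = _ := by rw [mul_assoc, ← Real.exp_add]; congr 2; ring
  calc K * x * (l * Real.exp (-(a * y))) ≤ K * x * (8 / a ^ 2 * Real.exp (-(a / 2 * y))) := by gcongr
    _ = _ := by ring

lemma mul_tsum_vonMangoldt_hatWeight {x : ℝ} (hx : 0 < x) {M : ℕ} (hM : x < M) :
    x * ∑' n : ℕ, ArithmeticFunction.vonMangoldt n * hatWeight (n / x) =
      ∑ n ∈ Finset.range M, ArithmeticFunction.vonMangoldt n * max 0 (x - n) := by
  rw [tsum_eq_sum (s := Finset.range M), Finset.mul_sum]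
  · refine Finset.sum_congr rfl fun n _ => ?_
    have : x * hatWeight (n / x) = max 0 (x - n) := by
      rw [hatWeight, mul_max_of_nonneg _ _ hx.le, mul_zero, mul_sub, mul_one,
        mul_div_cancel₀ _ hx.ne']
    rw [← this]; ring
  · intro n hn
    have hn' : (M : ℝ) ≤ n := by
      have := Finset.mem_range.not.1 hn
      exact_mod_cast (not_lt.1 this)
    have : 1 ≤ (n : ℝ) / x := by rw [le_div_iff₀ hx]; linarith
    rw [hatWeight, max_eq_left (by linarith), mul_zero]

lemma psi_eq_sum_range_ite {x : ℝ} (hx : 0 ≤ x) {M : ℕ} (hM : x < M) :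
    Chebyshev.psi x =
      ∑ n ∈ Finset.range M, if (n : ℝ) ≤ x then ArithmeticFunction.vonMangoldt n else 0 := by
  rw [Chebyshev.psi_eq_sum_Icc, ← Finset.sum_filter]
  refine Finset.sum_congr ?_ fun _ _ => rfl
  ext n
  simp only [Finset.mem_Icc, Finset.mem_filter, Finset.mem_range, Nat.le_floor_iff hx]
  constructor
  · rintro ⟨_, h⟩
    exact ⟨by exact_mod_cast h.trans_lt hM, h⟩
  · rintro ⟨_, h⟩
    exact ⟨Nat.zero_le _, h⟩

lemma mul_psi_le_sub {x h : ℝ} (hx : 0 < x) (hh : 0 ≤ h) {G : ℝ → ℝ}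
    (hG : ∀ y, 0 < y → G y = y * ∑' n : ℕ, ArithmeticFunction.vonMangoldt n * hatWeight (n / y)) :
    h * Chebyshev.psi x ≤ G (x + h) - G x := by
  obtain ⟨M, hM⟩ := exists_nat_gt (x + h)
  rw [hG _ (by linarith), hG _ hx, mul_tsum_vonMangoldt_hatWeight hx (M := M) (by linarith),
    mul_tsum_vonMangoldt_hatWeight (by linarith) hM, psi_eq_sum_range_ite hx.le (M := M) (by linarith),
    Finset.mul_sum, ← Finset.sum_sub_distrib]
  refine Finset.sum_le_sum fun n _ => ?_
  have h0 : 0 ≤ ArithmeticFunction.vonMangoldt n := ArithmeticFunction.vonMangoldt_nonneg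
  rw [← mul_sub]
  split_ifs with hn
  · rw [mul_comm, max_eq_right (by linarith), max_eq_right (by linarith)]
    exact le_of_eq (by ring)
  · rw [mul_zero]
    refine mul_nonneg h0 (sub_nonneg.2 (max_le_max le_rfl (by linarith)))

lemma sub_le_mul_psi {x h : ℝ} (hx : 0 < x - h) (hh : 0 ≤ h) {G : ℝ → ℝ}
    (hG : ∀ y, 0 < y → G y = y * ∑' n : ℕ, ArithmeticFunction.vonMangoldt n * hatWeight (n / y)) :
    G x - G (x - h) ≤ h * Chebyshev.psi x := by
  obtain ⟨M, hM⟩ := exists_nat_gt x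
  rw [hG _ (by linarith), hG _ hx, mul_tsum_vonMangoldt_hatWeight hx (M := M) (by linarith),
    mul_tsum_vonMangoldt_hatWeight (by linarith) hM, psi_eq_sum_range_ite (by linarith) hM,
    Finset.mul_sum, ← Finset.sum_sub_distrib]
  refine Finset.sum_le_sum fun n _ => ?_
  have h0 : 0 ≤ ArithmeticFunction.vonMangoldt n := ArithmeticFunction.vonMangoldt_nonneg
  rw [← mul_sub]
  split_ifs with hn
  · rw [mul_comm h]
    refine mul_le_mul_of_nonneg_left ?_ h0
    rw [max_eq_right (by linarith)]
    have := le_max_right 0 (x - h - n)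
    linarith
  · rw [mul_zero, max_eq_left (by linarith), max_eq_left (by linarith)]
    simp

lemma mul_sqrt_le_add_sq {a l b : ℝ} (hl : 0 ≤ l) (hb : 0 < b) : a * √l ≤ b * l + a ^ 2 / (4 * b) := by
  have h := sq_nonneg (2 * b * √l - a)
  have h2 := Real.sq_sqrt hl
  rw [← sub_nonneg]
  have : b * l + a ^ 2 / (4 * b) - a * √l = (2 * b * √l - a) ^ 2 / (4 * b) := by
    field_simp
    linear_combination (-4 * b ^ 2) * h2
  rw [this]; positivity

lemma exists_abs_psi_sub_le : ∃ a > 0, ∃ C > 0, ∀ x : ℝ, 6 ≤ x →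
    |Chebyshev.psi x - x| ≤ C * x * Real.exp (-(a * √(Real.log x))) := by
  obtain ⟨a, ha, C, hC, hQ⟩ := exists_smoothed_psi_bound
  set G : ℝ → ℝ := fun y => y * ∑' n : ℕ, ArithmeticFunction.vonMangoldt n * hatWeight (n / y)
  have hG : ∀ y, 0 < y → G y = y * ∑' n : ℕ, ArithmeticFunction.vonMangoldt n * hatWeight (n / y) :=
    fun _ _ => rfl
  set K := C + Real.exp (a ^ 2 / 4) with hK
  have hK0 : 0 < K := by positivity
  have hGb : ∀ u : ℝ, 3 ≤ u → |G u - u ^ 2 / 2| ≤ K * u ^ 2 * Real.exp (-(a * √(Real.log u))) := by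
    intro u hu
    have hu0 : 0 < u := by linarith
    have h1 := hQ u hu
    have hintg : u * hatIntegral (1 / u) = (u - 1) ^ 2 / 2 := by
      have : 1 / u ≤ 1 := by rw [div_le_one hu0]; linarith
      rw [hatIntegral, max_eq_right (by linarith)]
      field_simp
    have h2 : G u - u ^ 2 / 2 =
        u * (∑' n : ℕ, ArithmeticFunction.vonMangoldt n * hatWeight (n / u) - hatIntegral (1 / u))
          - (u - 1 / 2) := by
      rw [mul_sub, hintg]; ring
    have h3 : u ≤ Real.exp (a ^ 2 / 4) * u ^ 2 * Real.exp (-(a * √(Real.log u))) := by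
      have h4 := mul_sqrt_le_add_sq (a := a) (Real.log_nonneg (by linarith : (1:ℝ) ≤ u)) one_pos
      have : u = u ^ 2 * Real.exp (- Real.log u) := by
        rw [Real.exp_neg, Real.exp_log hu0]; field_simp
      calc u = u ^ 2 * Real.exp (- Real.log u) := this
        _ ≤ u ^ 2 * Real.exp (a ^ 2 / 4 + -(a * √(Real.log u))) := by
            gcongr; linarith
        _ = _ := by rw [Real.exp_add]; ring
    rw [h2]
    refine (abs_sub _ _).trans ?_
    rw [abs_mul, abs_of_pos hu0, abs_of_nonneg (by linarith : 0 ≤ u - 1 / 2)]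
    calc _ ≤ u * (C * u * Real.exp (-(a * √(Real.log u)))) +
          Real.exp (a ^ 2 / 4) * u ^ 2 * Real.exp (-(a * √(Real.log u))) := by
          gcongr; linarith
      _ = _ := by rw [hK]; ring
  refine ⟨a / 2, by positivity, (1 + 16 * K) * Real.exp (a / 2), by positivity, fun x hx => ?_⟩
  have hx0 : 0 < x := by linarith
  set y := √(Real.log (x / 2))
  set s := Real.exp (-(a / 2 * y)) with hs
  have hs0 : 0 < s := Real.exp_pos _
  have hy0 : 0 ≤ y := Real.sqrt_nonneg _
  have hs1 : s ≤ 1 := Real.exp_le_one_iff.2 (by have := mul_nonneg ha.le hy0; linarith)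
  have hE : ∀ u, x / 2 ≤ u → u ≤ 2 * x → |G u - u ^ 2 / 2| ≤ 4 * K * x ^ 2 * s ^ 2 := by
    intro u hu1 hu2
    refine (hGb u (by linarith)).trans ?_
    have : Real.exp (-(a * √(Real.log u))) ≤ s ^ 2 := by
      rw [hs, ← Real.exp_nat_mul]
      refine Real.exp_le_exp.2 ?_
      have : y ≤ √(Real.log u) := Real.sqrt_le_sqrt (Real.log_le_log (by linarith) hu1)
      push_cast
      nlinarith
    calc K * u ^ 2 * Real.exp (-(a * √(Real.log u))) ≤ K * (2 * x) ^ 2 * s ^ 2 := by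
          gcongr; linarith
      _ = _ := by ring
  set h := x * s / 2 with hh
  have hh0 : 0 < h := by positivity
  have hhx : h ≤ x / 2 := by rw [hh]; nlinarith
  have hup := mul_psi_le_sub hx0 hh0.le hG
  have hlo := sub_le_mul_psi (x := x) (h := h) (by linarith) hh0.le hG
  have e1 := abs_le.1 (hE (x + h) (by linarith) (by linarith))
  have e2 := abs_le.1 (hE x (by linarith) (by linarith))
  have e3 := abs_le.1 (hE (x - h) (by linarith) (by linarith))
  have hkey : |h * (Chebyshev.psi x - x)| ≤ h * ((1 + 16 * K) * x * s) := by
    have e4 : h * ((1 + 16 * K) * x * s) = x ^ 2 * s ^ 2 / 2 + 8 * K * x ^ 2 * s ^ 2 := by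
      rw [hh]; ring
    have e5 : h ^ 2 / 2 ≤ x ^ 2 * s ^ 2 / 2 := by
      rw [hh]; have : 0 ≤ x ^ 2 * s ^ 2 := by positivity
      nlinarith
    rw [e4, abs_le]
    constructor <;> nlinarith
  rw [abs_mul, abs_of_pos hh0] at hkey
  refine (le_of_mul_le_mul_left hkey hh0).trans ?_
  have hsx : s ≤ Real.exp (a / 2) * Real.exp (-(a / 2 * √(Real.log x))) := by
    rw [hs, ← Real.exp_add]
    refine Real.exp_le_exp.2 ?_
    have : √(Real.log x) ≤ y + 1 := by
      have hl : Real.log x = Real.log (x / 2) + Real.log 2 := by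
        rw [← Real.log_mul (by positivity) (by norm_num)]; congr 1; ring
      rw [hl]
      have h2 : Real.log 2 ≤ 1 := by have := Real.log_two_lt_d9; linarith
      have h3 : 0 ≤ Real.log (x / 2) := Real.log_nonneg (by linarith)
      rw [Real.sqrt_le_left (by linarith)]
      have := Real.sq_sqrt h3
      change y ^ 2 = _ at this
      nlinarith
    nlinarith
  calc (1 + 16 * K) * x * s ≤ (1 + 16 * K) * x * (Real.exp (a / 2) * Real.exp (-(a / 2 * √(Real.log x)))) := by
        gcongr
    _ = _ := by ring

/-- The prime number theorem with classical error term, for Chebyshev's `θ`. -/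
lemma exists_abs_theta_sub_le : ∃ a > 0, ∃ C > 0, ∀ x : ℝ, 1 ≤ x →
    |Chebyshev.theta x - x| ≤ C * x * Real.exp (-(a * √(Real.log x))) := by
  obtain ⟨a, ha, C, hC, hpsi⟩ := exists_abs_psi_sub_le
  refine ⟨a, ha, C + 8 * Real.exp (a ^ 2) + Real.exp (a * √(Real.log 6)), by positivity,
    fun x hx => ?_⟩
  have hx0 : 0 < x := by linarith
  rcases le_total 6 x with h6 | h6
  · have h1 := hpsi x h6
    have h2 := Chebyshev.abs_psi_sub_theta_le_sqrt_mul_log hx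
    set l := Real.log x with hl
    have hl0 : 0 ≤ l := Real.log_nonneg hx
    have hxe : x = Real.exp l := (Real.exp_log hx0).symm
    have h3 : 2 * √x * l ≤ 8 * Real.exp (a ^ 2) * x * Real.exp (-(a * √l)) := by
      have e1 : √x = Real.exp (l / 2) := by
        rw [hxe, Real.exp_half]
      have e2 : l ≤ 4 * Real.exp (l / 4) := by
        have := Real.add_one_le_exp (l / 4); linarith
      have e3 := mul_sqrt_le_add_sq (a := a) hl0 (by norm_num : (0:ℝ) < 1 / 4)
      calc 2 * √x * l ≤ 2 * Real.exp (l / 2) * (4 * Real.exp (l / 4)) := by rw [e1]; gcongr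
        _ = 8 * Real.exp (l / 2 + l / 4) := by rw [Real.exp_add]; ring
        _ ≤ 8 * Real.exp (a ^ 2 + l + -(a * √l)) := by
            refine mul_le_mul_of_nonneg_left (Real.exp_le_exp.2 ?_) (by norm_num)
            norm_num at e3
            linarith
        _ = _ := by rw [Real.exp_add, Real.exp_add, ← hxe]; ring
    calc |Chebyshev.theta x - x| = |(Chebyshev.psi x - x) - (Chebyshev.psi x - Chebyshev.theta x)| := by
          congr 1; ring
      _ ≤ |Chebyshev.psi x - x| + |Chebyshev.psi x - Chebyshev.theta x| := abs_sub _ _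
      _ ≤ C * x * Real.exp (-(a * √l)) + 8 * Real.exp (a ^ 2) * x * Real.exp (-(a * √l)) :=
          add_le_add h1 (h2.trans h3)
      _ = (C + 8 * Real.exp (a ^ 2)) * x * Real.exp (-(a * √l)) := by ring
      _ ≤ _ := by
          have := (Real.exp_pos (a * √(Real.log 6))).le
          rw [mul_assoc, mul_assoc]
          refine mul_le_mul_of_nonneg_right (by linarith) (by positivity)
  · have h1 := Chebyshev.theta_le_log4_mul_x hx0.le
    have h2 := Chebyshev.theta_nonneg x
    have h3 : Real.log 4 ≤ 2 := by
      have : (4:ℝ) = 2 ^ 2 := by norm_num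
      rw [this, Real.log_pow]; have := Real.log_two_lt_d9; push_cast; linarith
    have h4 : |Chebyshev.theta x - x| ≤ x := by
      rw [abs_le]; constructor <;> nlinarith
    have h5 : 1 ≤ Real.exp (a * √(Real.log 6)) * Real.exp (-(a * √(Real.log x))) := by
      rw [← Real.exp_add]
      refine Real.one_le_exp ?_
      have : √(Real.log x) ≤ √(Real.log 6) := Real.sqrt_le_sqrt (Real.log_le_log hx0 h6)
      nlinarith
    calc |Chebyshev.theta x - x| ≤ x * 1 := by linarith
      _ ≤ x * (Real.exp (a * √(Real.log 6)) * Real.exp (-(a * √(Real.log x)))) := by gcongr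
      _ = Real.exp (a * √(Real.log 6)) * x * Real.exp (-(a * √(Real.log x))) := by ring
      _ ≤ _ := by
          have := (Real.exp_pos (a ^ 2)).le
          rw [mul_assoc, mul_assoc]
          refine mul_le_mul_of_nonneg_right (by linarith) (by positivity)

lemma norm_eC (x : ℝ) : ‖eC x‖ = 1 := Complex.norm_exp_ofReal_mul_I _

lemma eC_add (x y : ℝ) : eC (x + y) = eC x * eC y := by
  rw [eC, eC, eC, ← Complex.exp_add]; congr 1; push_cast; ring

lemma eC_neg (x : ℝ) : eC (-x) = (starRingEnd ℂ) (eC x) := by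
  rw [eC, eC, ← Complex.exp_conj, map_mul, Complex.conj_ofReal, Complex.conj_I]; congr 1
  push_cast; ring

/-- `1 / (1 - e(g))`, written through the cotangent. -/
noncomputable def geomWeight (g : ℝ) : ℂ :=
  1 / 2 + ((Real.cos (π * g) / (2 * Real.sin (π * g)) : ℝ) : ℂ) * Complex.I

lemma sin_pi_mul_ge {g : ℝ} (h0 : 0 ≤ g) (h1 : g ≤ 1 / 2) : 2 * g ≤ Real.sin (π * g) := by
  have := Real.mul_le_sin (x := π * g) (by positivity) (by nlinarith [Real.pi_pos])
  calc 2 * g = 2 / π * (π * g) := by field_simp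
    _ ≤ _ := this

lemma one_sub_eC_mul_geomWeight {g : ℝ} (h0 : 0 < g) (h1 : g ≤ 1 / 2) :
    (1 - eC g) * geomWeight g = 1 := by
  have hs : 0 < Real.sin (π * g) := lt_of_lt_of_le (by positivity) (sin_pi_mul_ge h0.le h1)
  have he : eC g = ((Real.cos (2 * (π * g)) : ℝ) : ℂ) + ((Real.sin (2 * (π * g)) : ℝ) : ℂ) * Complex.I := by
    rw [eC, Complex.exp_mul_I, ← Complex.ofReal_cos, ← Complex.ofReal_sin, mul_assoc]
  have hcs := Real.sin_sq_add_cos_sq (π * g)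
  rw [he, geomWeight, Real.cos_two_mul, Real.sin_two_mul]
  set s := Real.sin (π * g)
  set k := Real.cos (π * g)
  have hs' : (s : ℂ) ≠ 0 := by exact_mod_cast hs.ne'
  have hcs' : (s : ℂ) ^ 2 + (k : ℂ) ^ 2 = 1 := by exact_mod_cast hcs
  push_cast
  field_simp
  linear_combination (-2 * (k : ℂ) ^ 2 * s) * Complex.I_sq - 2 * k * Complex.I * hcs'

lemma norm_geomWeight_le {g δ : ℝ} (hδ : 0 < δ) (h0 : δ ≤ g) (h1 : g ≤ 1 / 2) :
    ‖geomWeight g‖ ≤ 1 / (4 * δ) := by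
  have hs : 2 * g ≤ Real.sin (π * g) := sin_pi_mul_ge (by linarith) h1
  have hs0 : 0 < Real.sin (π * g) := by linarith
  have hcs := Real.sin_sq_add_cos_sq (π * g)
  have : ‖geomWeight g‖ ^ 2 = (1 / (2 * Real.sin (π * g))) ^ 2 := by
    have e : geomWeight g = ((1 / 2 : ℝ) : ℂ) +
        ((Real.cos (π * g) / (2 * Real.sin (π * g)) : ℝ) : ℂ) * Complex.I := by
      rw [geomWeight]; push_cast; ring
    rw [← Complex.normSq_eq_norm_sq, e, Complex.normSq_add_mul_I]
    field_simp
    nlinarith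
  have h2 : ‖geomWeight g‖ = 1 / (2 * Real.sin (π * g)) :=
    (pow_left_inj₀ (norm_nonneg _) (by positivity) two_ne_zero).1 this
  rw [h2]
  exact one_div_le_one_div_of_le (by positivity) (by linarith)

lemma cot_div_two_le {g δ : ℝ} (hδ : 0 < δ) (h0 : δ ≤ g) (h1 : g ≤ 1 / 2) :
    Real.cos (π * g) / (2 * Real.sin (π * g)) ≤ 1 / (4 * δ) := by
  have hs : 2 * g ≤ Real.sin (π * g) := sin_pi_mul_ge (by linarith) h1
  have hs0 : 0 < Real.sin (π * g) := by linarith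
  calc _ ≤ 1 / (2 * Real.sin (π * g)) := by gcongr; exact Real.cos_le_one _
    _ ≤ _ := one_div_le_one_div_of_le (by positivity) (by linarith)

lemma cot_div_two_nonneg {g : ℝ} (h0 : 0 < g) (h1 : g ≤ 1 / 2) :
    0 ≤ Real.cos (π * g) / (2 * Real.sin (π * g)) := by
  have hs : 2 * g ≤ Real.sin (π * g) := sin_pi_mul_ge (by linarith) h1
  have : 0 ≤ Real.cos (π * g) := Real.cos_nonneg_of_mem_Icc
    ⟨by nlinarith [Real.pi_pos], by nlinarith [Real.pi_pos]⟩
  exact div_nonneg this (by linarith)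

lemma norm_geomWeight_sub {g g' : ℝ} (h0 : 0 < g) (h : g ≤ g') (h1 : g' ≤ 1 / 2) :
    ‖geomWeight g' - geomWeight g‖ =
      Real.cos (π * g) / (2 * Real.sin (π * g)) - Real.cos (π * g') / (2 * Real.sin (π * g')) := by
  have hs : 0 < Real.sin (π * g) := lt_of_lt_of_le (by positivity) (sin_pi_mul_ge h0.le (by linarith))
  have hs' : 0 < Real.sin (π * g') :=
    lt_of_lt_of_le (by linarith) (sin_pi_mul_ge (by linarith) h1)
  have hd : 0 ≤ Real.sin (π * g' - π * g) :=
    Real.sin_nonneg_of_nonneg_of_le_pi (by nlinarith [Real.pi_pos]) (by nlinarith [Real.pi_pos])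
  rw [Real.sin_sub] at hd
  have e : geomWeight g' - geomWeight g = ((Real.cos (π * g') / (2 * Real.sin (π * g')) -
      Real.cos (π * g) / (2 * Real.sin (π * g)) : ℝ) : ℂ) * Complex.I := by
    rw [geomWeight, geomWeight]; push_cast; ring
  rw [e, norm_mul, Complex.norm_I, mul_one, Complex.norm_real, Real.norm_eq_abs, abs_sub_comm,
    abs_of_nonneg]
  rw [sub_nonneg, div_le_div_iff₀ (by positivity) (by positivity)]
  nlinarith

/-- The Kusmin-Landau inequality for steps in `[δ, 1/2]`. -/
lemma norm_sum_eC_le_of_monotone_sub {x : ℕ → ℝ} {m : ℕ} {δ : ℝ} (hδ : 0 < δ) (hδ2 : δ ≤ 1 / 2)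
    (hlo : ∀ n, n + 1 < m → δ ≤ x (n + 1) - x n) (hhi : ∀ n, n + 1 < m → x (n + 1) - x n ≤ 1 / 2)
    (hmono : ∀ n, n + 2 < m → x (n + 1) - x n ≤ x (n + 2) - x (n + 1)) :
    ‖∑ n ∈ Finset.range m, eC (x n)‖ ≤ 2 / δ := by
  have h1δ : 1 ≤ 1 / δ := by rw [le_div_iff₀ hδ]; linarith
  have h2δ : 2 / δ = 1 / δ + 1 / δ := by ring
  obtain rfl | rfl | ⟨k, rfl⟩ : m = 0 ∨ m = 1 ∨ ∃ k, m = k + 2 := by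
    rcases m with _ | _ | k
    · simp
    · simp
    · exact Or.inr (Or.inr ⟨k, rfl⟩)
  · simp; positivity
  · simp [norm_eC]; linarith
  set g : ℕ → ℝ := fun n => x (n + 1) - x n with hg
  have hE : ∀ n, eC (x (n + 1)) = eC (x n) * eC (g n) := fun n => by
    rw [← eC_add]; congr 1; simp [hg]
  have key : ∀ j, j ≤ k → ‖(∑ n ∈ Finset.range (j + 1), eC (x n)) + eC (x (j + 1)) * geomWeight (g j)‖ ≤
      1 / (4 * δ) + (Real.cos (π * g 0) / (2 * Real.sin (π * g 0)) -
        Real.cos (π * g j) / (2 * Real.sin (π * g j))) := by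
    intro j
    induction j with
    | zero =>
      intro _
      have hw := one_sub_eC_mul_geomWeight (lt_of_lt_of_le hδ (hlo 0 (by omega))) (hhi 0 (by omega))
      have : (∑ n ∈ Finset.range (0 + 1), eC (x n)) + eC (x (0 + 1)) * geomWeight (g 0) =
          eC (x 0) * geomWeight (g 0) := by
        rw [zero_add, Finset.sum_range_one, ← zero_add 1, hE 0]
        linear_combination (-eC (x 0)) * hw
      rw [this, norm_mul, norm_eC, one_mul, sub_self, add_zero]
      exact norm_geomWeight_le hδ (hlo 0 (by omega)) (hhi 0 (by omega))
    | succ j ih =>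
      intro hj
      have hw := one_sub_eC_mul_geomWeight (lt_of_lt_of_le hδ (hlo (j + 1) (by omega)))
        (hhi (j + 1) (by omega))
      have e : (∑ n ∈ Finset.range (j + 1 + 1), eC (x n)) +
          eC (x (j + 1 + 1)) * geomWeight (g (j + 1)) =
          ((∑ n ∈ Finset.range (j + 1), eC (x n)) + eC (x (j + 1)) * geomWeight (g j)) +
            eC (x (j + 1)) * (geomWeight (g (j + 1)) - geomWeight (g j)) := by
        rw [Finset.sum_range_succ, hE (j + 1)]
        linear_combination (-eC (x (j + 1))) * hw
      rw [e]
      refine (norm_add_le _ _).trans ?_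
      rw [norm_mul, norm_eC, one_mul, norm_geomWeight_sub (lt_of_lt_of_le hδ (hlo j (by omega)))
        (hmono j (by omega)) (hhi (j + 1) (by omega))]
      linarith [ih (by omega)]
  have hk := key k le_rfl
  have hc0 := cot_div_two_le hδ (hlo 0 (by omega)) (hhi 0 (by omega))
  have hck := cot_div_two_nonneg (lt_of_lt_of_le hδ (hlo k (by omega))) (hhi k (by omega))
  have hwk := norm_geomWeight_le hδ (hlo k (by omega)) (hhi k (by omega))
  have e : ∑ n ∈ Finset.range (k + 2), eC (x n) =
      ((∑ n ∈ Finset.range (k + 1), eC (x n)) + eC (x (k + 1)) * geomWeight (g k)) +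
        (eC (x (k + 1)) - eC (x (k + 1)) * geomWeight (g k)) := by
    rw [Finset.sum_range_succ]; ring
  rw [e]
  have h4 : 1 / (4 * δ) = 1 / δ / 4 := by field_simp
  calc _ ≤ _ := norm_add_le _ _
    _ ≤ (1 / (4 * δ) + 1 / (4 * δ)) + (1 + 1 / (4 * δ)) := by
      refine add_le_add (by linarith!) ((norm_sub_le _ _).trans ?_)
      rw [norm_mul, norm_eC, one_mul]
      linarith!
    _ ≤ 2 / δ := by rw [h4, h2δ]; linarith

lemma rpow_tangent_le {c x y : ℝ} (hc : 1 ≤ c) (hx : 0 < x) (hy : 0 ≤ y) :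
    x ^ c + c * x ^ (c - 1) * (y - x) ≤ y ^ c := by
  have h := one_add_mul_self_le_rpow_one_add (s := y / x - 1) (by have := div_nonneg hy hx.le; linarith) hc
  have h2 : x ^ c * (1 + c * (y / x - 1)) ≤ x ^ c * (1 + (y / x - 1)) ^ c := by gcongr
  have h3 : x ^ c * (1 + (y / x - 1)) ^ c = y ^ c := by
    rw [add_sub_cancel, Real.div_rpow hy hx.le]; field_simp
  have h4 : x ^ c = x ^ (c - 1) * x := by
    rw [← Real.rpow_add_one hx.ne']; congr 1; ring
  rw [h3] at h2
  refine le_trans (le_of_eq ?_) h2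
  rw [h4]; field_simp

lemma norm_sum_eC_rpow_le {c β δ : ℝ} (hc : 1 ≤ c) (hβ : 0 ≤ β) {a b : ℕ} (hδ : 0 < δ)
    (hδ2 : δ ≤ 1 / 2) (hlo : a < b → δ ≤ c * β * ((a : ℝ) + 1) ^ (c - 1))
    (hhi : c * β * (b : ℝ) ^ (c - 1) ≤ 1 / 2) :
    ‖∑ m ∈ Finset.Ioc a b, eC (β * (m : ℝ) ^ c)‖ ≤ 2 / δ := by
  have e : ∑ m ∈ Finset.Ioc a b, eC (β * (m : ℝ) ^ c) =
      ∑ n ∈ Finset.range (b - a), eC (β * ((a + 1 + n : ℕ) : ℝ) ^ c) := by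
    rw [show Finset.Ioc a b = Finset.Ico (a + 1) (b + 1) by ext; simp, Finset.sum_Ico_eq_sum_range]
    simp
  rw [e]
  have c0 : 0 ≤ c - 1 := by linarith
  refine norm_sum_eC_le_of_monotone_sub hδ hδ2 ?_ ?_ ?_
  · intro n hn
    have hab : a < b := by omega
    have h := rpow_tangent_le hc (x := ((a + 1 + n : ℕ) : ℝ)) (y := ((a + 1 + (n + 1) : ℕ) : ℝ))
      (by positivity) (by positivity)
    have h2 : ((a : ℝ) + 1) ^ (c - 1) ≤ ((a + 1 + n : ℕ) : ℝ) ^ (c - 1) :=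
      Real.rpow_le_rpow (by positivity) (by push_cast; linarith [n.cast_nonneg (α := ℝ)]) c0
    have h3 : c * ((a + 1 + n : ℕ) : ℝ) ^ (c - 1) ≤
        ((a + 1 + (n + 1) : ℕ) : ℝ) ^ c - ((a + 1 + n : ℕ) : ℝ) ^ c := by
      have : ((a + 1 + (n + 1) : ℕ) : ℝ) - ((a + 1 + n : ℕ) : ℝ) = 1 := by push_cast; ring
      rw [this] at h; linarith
    calc δ ≤ c * β * ((a : ℝ) + 1) ^ (c - 1) := hlo hab
      _ ≤ c * β * ((a + 1 + n : ℕ) : ℝ) ^ (c - 1) := by gcongr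
      _ = β * (c * ((a + 1 + n : ℕ) : ℝ) ^ (c - 1)) := by ring
      _ ≤ β * _ := mul_le_mul_of_nonneg_left h3 hβ
      _ = _ := by ring
  · intro n hn
    have h := rpow_tangent_le hc (y := ((a + 1 + n : ℕ) : ℝ)) (x := ((a + 1 + (n + 1) : ℕ) : ℝ))
      (by positivity) (by positivity)
    have h2 : ((a + 1 + (n + 1) : ℕ) : ℝ) ^ (c - 1) ≤ (b : ℝ) ^ (c - 1) :=
      Real.rpow_le_rpow (by positivity) (by exact_mod_cast (by omega)) c0
    have h3 : ((a + 1 + (n + 1) : ℕ) : ℝ) ^ c - ((a + 1 + n : ℕ) : ℝ) ^ c ≤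
        c * ((a + 1 + (n + 1) : ℕ) : ℝ) ^ (c - 1) := by
      have : ((a + 1 + n : ℕ) : ℝ) - ((a + 1 + (n + 1) : ℕ) : ℝ) = -1 := by push_cast; ring
      rw [this] at h; linarith
    calc _ = β * (((a + 1 + (n + 1) : ℕ) : ℝ) ^ c - ((a + 1 + n : ℕ) : ℝ) ^ c) := by ring
      _ ≤ β * (c * ((a + 1 + (n + 1) : ℕ) : ℝ) ^ (c - 1)) := mul_le_mul_of_nonneg_left h3 hβ
      _ = c * β * ((a + 1 + (n + 1) : ℕ) : ℝ) ^ (c - 1) := by ring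
      _ ≤ c * β * (b : ℝ) ^ (c - 1) := by gcongr
      _ ≤ _ := hhi
  · intro n hn
    have h := rpow_tangent_le hc (y := ((a + 1 + n : ℕ) : ℝ)) (x := ((a + 1 + (n + 1) : ℕ) : ℝ))
      (by positivity) (by positivity)
    have h' := rpow_tangent_le hc (y := ((a + 1 + (n + 2) : ℕ) : ℝ)) (x := ((a + 1 + (n + 1) : ℕ) : ℝ))
      (by positivity) (by positivity)
    have e1 : ((a + 1 + n : ℕ) : ℝ) - ((a + 1 + (n + 1) : ℕ) : ℝ) = -1 := by push_cast; ring
    have e2 : ((a + 1 + (n + 2) : ℕ) : ℝ) - ((a + 1 + (n + 1) : ℕ) : ℝ) = 1 := by push_cast; ring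
    rw [e1] at h
    rw [e2] at h'
    rw [← mul_sub, ← mul_sub]
    exact mul_le_mul_of_nonneg_left (by linarith) hβ

lemma norm_sum_monotone_mul_le {w : ℕ → ℝ} {z : ℕ → ℂ} {a b : ℕ} {B : ℝ} (hab : a ≤ b)
    (hw : ∀ m, a ≤ m → m < b → w m ≤ w (m + 1)) (hw0 : 0 ≤ w a)
    (hB : ∀ a', a ≤ a' → ‖∑ m ∈ Finset.Ioc a' b, z m‖ ≤ B) :
    ‖∑ m ∈ Finset.Ioc a b, (w m : ℂ) * z m‖ ≤ w b * B := by
  have key : ∀ d a', a ≤ a' → a' + d = b →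
      ‖∑ m ∈ Finset.Ioc a' b, ((w m - w a' : ℝ) : ℂ) * z m‖ ≤ (w b - w a') * B := by
    intro d
    induction d with
    | zero => intro a' _ h; simp at h; simp [h]
    | succ d ih =>
      intro a' ha' h
      have hs : Finset.Ioc a' b = insert (a' + 1) (Finset.Ioc (a' + 1) b) := by
        ext; simp; omega
      have e : ∑ m ∈ Finset.Ioc a' b, ((w m - w a' : ℝ) : ℂ) * z m =
          ∑ m ∈ Finset.Ioc (a' + 1) b, ((w m - w (a' + 1) : ℝ) : ℂ) * z m +
            ((w (a' + 1) - w a' : ℝ) : ℂ) * ∑ m ∈ Finset.Ioc a' b, z m := by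
        rw [hs, Finset.sum_insert (by simp), Finset.sum_insert (by simp), mul_add, Finset.mul_sum,
          add_left_comm, ← Finset.sum_add_distrib]
        congr 1
        refine Finset.sum_congr rfl fun m _ => ?_
        push_cast; ring
      rw [e]
      have hw' := hw a' ha' (by omega)
      have h1 := ih (a' + 1) (by omega) (by omega)
      have h2 := hB a' ha'
      refine (norm_add_le _ _).trans ?_
      rw [norm_mul, Complex.norm_real, Real.norm_of_nonneg (by linarith)]
      nlinarith
  have h1 := key (b - a) a le_rfl (by omega)
  have h2 := hB a le_rfl
  have e : ∑ m ∈ Finset.Ioc a b, (w m : ℂ) * z m =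
      ∑ m ∈ Finset.Ioc a b, ((w m - w a : ℝ) : ℂ) * z m + (w a : ℂ) * ∑ m ∈ Finset.Ioc a b, z m := by
    rw [Finset.mul_sum, ← Finset.sum_add_distrib]
    refine Finset.sum_congr rfl fun m _ => ?_
    push_cast; ring
  rw [e]
  refine (norm_add_le _ _).trans ?_
  rw [norm_mul, Complex.norm_real, Real.norm_of_nonneg hw0]
  nlinarith

lemma sum_Ioc_convolution_mul (f g : ArithmeticFunction ℝ) (z : ℕ → ℂ) (N₀ N₁ : ℕ) :
    ∑ n ∈ Finset.Ioc N₀ N₁, (((f * g) n : ℝ) : ℂ) * z n =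
      ∑ k ∈ Finset.Ioc 0 N₁, (f k : ℂ) * ∑ m ∈ Finset.Ioc (N₀ / k) (N₁ / k), (g m : ℂ) * z (k * m) := by
  have h1 : ∀ n ∈ Finset.Ioc N₀ N₁, (((f * g) n : ℝ) : ℂ) * z n =
      ∑ x ∈ Finset.Ioc 0 N₁ ×ˢ Finset.Ioc 0 N₁,
        if x.1 * x.2 = n then (f x.1 : ℂ) * (g x.2 : ℂ) * z (x.1 * x.2) else 0 := by
    intro n hn
    rw [Finset.mem_Ioc] at hn
    rw [ArithmeticFunction.mul_apply,
      Nat.divisorsAntidiagonal_eq_prod_filter_of_le (by omega : n ≠ 0) hn.2, ← Finset.sum_filter]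
    push_cast
    rw [Finset.sum_mul]
    refine Finset.sum_congr rfl fun x hx => ?_
    rw [(Finset.mem_filter.1 hx).2]
  rw [Finset.sum_congr rfl h1, Finset.sum_comm, Finset.sum_product]
  refine Finset.sum_congr rfl fun k hk => ?_
  rw [Finset.mem_Ioc] at hk
  rw [Finset.mul_sum]
  simp_rw [Finset.sum_ite_eq]
  rw [← Finset.sum_filter]
  refine Finset.sum_congr ?_ fun m _ => by ring
  ext m
  simp only [Finset.mem_filter, Finset.mem_Ioc]
  rw [Nat.div_lt_iff_lt_mul hk.1, Nat.le_div_iff_mul_le hk.1, mul_comm m k]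
  constructor
  · rintro ⟨_, h⟩; exact h
  · rintro ⟨h2, h3⟩
    refine ⟨⟨?_, ?_⟩, h2, h3⟩
    · exact Nat.pos_of_ne_zero fun h => by simp [h] at h2
    · exact (Nat.le_mul_of_pos_left m hk.1).trans h3

lemma sum_Ioc_one_div_le (n : ℕ) : ∑ k ∈ Finset.Ioc 0 n, (1 : ℝ) / k ≤ 1 + Real.log n := by
  have h := harmonic_le_one_add_log n
  rw [harmonic_eq_sum_Icc] at h
  push_cast at h
  simp_rw [one_div]
  exact h

lemma card_divisors_sq_le {k K : ℕ} (hk : k ∈ Finset.Ioc 0 K) :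
    k.divisors.card ^ 2 ≤ (((Finset.Ioc 0 K) ×ˢ (Finset.Ioc 0 K) ×ˢ (Finset.Ioc 0 K)).filter
      fun x => x.1 * x.2.1 * x.2.2 ∣ k).card := by
  rw [sq, ← Finset.card_product]
  rw [Finset.mem_Ioc] at hk
  refine Finset.card_le_card_of_injOn
    (fun d => (Nat.gcd d.1 d.2, d.1 / Nat.gcd d.1 d.2, d.2 / Nat.gcd d.1 d.2)) ?_ ?_
  · rintro ⟨a, b⟩ h
    simp only [Finset.coe_product, Set.mem_prod, Finset.mem_coe, Nat.mem_divisors] at h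
    obtain ⟨⟨ha, _⟩, hb, _⟩ := h
    have ha0 : 0 < a := Nat.pos_of_dvd_of_pos ha hk.1
    have hb0 : 0 < b := Nat.pos_of_dvd_of_pos hb hk.1
    have hak := Nat.le_of_dvd hk.1 ha
    have hbk := Nat.le_of_dvd hk.1 hb
    have hg := Nat.gcd_pos_of_pos_left b ha0
    have hga := Nat.gcd_le_left b ha0
    have hgb := Nat.le_of_dvd hb0 (Nat.gcd_dvd_right a b)
    have e : Nat.gcd a b * (a / Nat.gcd a b) * (b / Nat.gcd a b) = Nat.lcm a b := by
      rw [Nat.mul_div_cancel' (Nat.gcd_dvd_left a b), Nat.lcm, Nat.mul_div_assoc _ (Nat.gcd_dvd_right a b)]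
    simp only [Finset.coe_filter, Finset.mem_product, Finset.mem_Ioc, Set.mem_ofPred_eq]
    refine ⟨⟨⟨hg, by omega⟩, ⟨Nat.div_pos hga hg, (Nat.div_le_self _ _).trans (by omega)⟩,
      Nat.div_pos hgb hg, (Nat.div_le_self _ _).trans (by omega)⟩, ?_⟩
    rw [e]
    exact Nat.lcm_dvd ha hb
  · rintro ⟨a, b⟩ _ ⟨a', b'⟩ _ h
    simp only [Prod.mk.injEq] at h ⊢
    obtain ⟨h1, h2, h3⟩ := h
    constructor
    · rw [← Nat.mul_div_cancel' (Nat.gcd_dvd_left a b), ← Nat.mul_div_cancel' (Nat.gcd_dvd_left a' b'),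
        h2, h1]
    · rw [← Nat.mul_div_cancel' (Nat.gcd_dvd_right a b), ← Nat.mul_div_cancel' (Nat.gcd_dvd_right a' b'),
        h3, h1]

lemma sum_card_divisors_sq_le (K : ℕ) :
    ∑ k ∈ Finset.Ioc 0 K, (k.divisors.card : ℝ) ^ 2 ≤ K * (1 + Real.log K) ^ 3 := by
  set S := (Finset.Ioc 0 K) ×ˢ (Finset.Ioc 0 K) ×ˢ (Finset.Ioc 0 K)
  calc ∑ k ∈ Finset.Ioc 0 K, (k.divisors.card : ℝ) ^ 2
      ≤ ∑ k ∈ Finset.Ioc 0 K, ∑ x ∈ S, if x.1 * x.2.1 * x.2.2 ∣ k then (1 : ℝ) else 0 := by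
        refine Finset.sum_le_sum fun k hk => ?_
        rw [← Finset.sum_filter, Finset.sum_const, nsmul_one]
        exact_mod_cast card_divisors_sq_le hk
    _ = ∑ x ∈ S, ((K / (x.1 * x.2.1 * x.2.2) : ℕ) : ℝ) := by
        rw [Finset.sum_comm]
        refine Finset.sum_congr rfl fun x _ => ?_
        rw [← Finset.sum_filter, Finset.sum_const, nsmul_one, Nat.Ioc_filter_dvd_card_eq_div]
    _ ≤ ∑ x ∈ S, (K : ℝ) * (1 / x.1 * (1 / x.2.1 * (1 / x.2.2))) := by
        refine Finset.sum_le_sum fun x _ => ?_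
        refine Nat.cast_div_le.trans (le_of_eq ?_)
        push_cast
        simp only [div_eq_mul_inv, mul_inv, one_mul]
        ring
    _ = K * (∑ k ∈ Finset.Ioc 0 K, (1 : ℝ) / k) ^ 3 := by
        rw [← Finset.mul_sum, Finset.sum_product]
        simp_rw [Finset.sum_product, ← Finset.mul_sum, ← Finset.sum_mul]
        ring
    _ ≤ _ := by
        gcongr
        exact sum_Ioc_one_div_le K

lemma norm_sq_bilinear_le {M K : Finset ℕ} {a b : ℕ → ℝ} {φ : ℕ → ℕ → ℂ} {w : ℕ → ℕ → ℝ} {R : ℝ}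
    (hw : ∀ k ∈ K, ∀ l ∈ K, ‖∑ m ∈ M, φ m k * (starRingEnd ℂ) (φ m l)‖ ≤ w k l)
    (hsymm : ∀ k l, w k l = w l k) (hR : ∀ k ∈ K, ∑ l ∈ K, w k l ≤ R) :
    ‖∑ m ∈ M, (a m : ℂ) * ∑ k ∈ K, (b k : ℂ) * φ m k‖ ^ 2 ≤
      (∑ m ∈ M, a m ^ 2) * ((∑ k ∈ K, b k ^ 2) * R) := by
  have h1 : ‖∑ m ∈ M, (a m : ℂ) * ∑ k ∈ K, (b k : ℂ) * φ m k‖ ≤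
      ∑ m ∈ M, |a m| * ‖∑ k ∈ K, (b k : ℂ) * φ m k‖ := by
    refine (norm_sum_le _ _).trans (le_of_eq (Finset.sum_congr rfl fun m _ => ?_))
    rw [norm_mul, Complex.norm_real, Real.norm_eq_abs]
  have h2 := Finset.sum_mul_sq_le_sq_mul_sq M (fun m => |a m|) fun m => ‖∑ k ∈ K, (b k : ℂ) * φ m k‖
  have h3 : ∑ m ∈ M, ‖∑ k ∈ K, (b k : ℂ) * φ m k‖ ^ 2 ≤ (∑ k ∈ K, b k ^ 2) * R := by
    have e : ((∑ m ∈ M, ‖∑ k ∈ K, (b k : ℂ) * φ m k‖ ^ 2 : ℝ) : ℂ) =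
        ∑ k ∈ K, ∑ l ∈ K, ((b k : ℂ) * b l) * ∑ m ∈ M, φ m k * (starRingEnd ℂ) (φ m l) := by
      push_cast
      have : ∀ m ∈ M, ((‖∑ k ∈ K, (b k : ℂ) * φ m k‖ : ℂ)) ^ 2 =
          ∑ k ∈ K, ∑ l ∈ K, ((b k : ℂ) * b l) * (φ m k * (starRingEnd ℂ) (φ m l)) := by
        intro m _
        rw [← Complex.mul_conj', map_sum, Finset.sum_mul_sum]
        refine Finset.sum_congr rfl fun k _ => Finset.sum_congr rfl fun l _ => ?_
        rw [map_mul, Complex.conj_ofReal]; ring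
      rw [Finset.sum_congr rfl this, Finset.sum_comm]
      refine Finset.sum_congr rfl fun k _ => ?_
      rw [Finset.sum_comm]
      refine Finset.sum_congr rfl fun l _ => ?_
      rw [Finset.mul_sum]
    have h4 : ∑ m ∈ M, ‖∑ k ∈ K, (b k : ℂ) * φ m k‖ ^ 2 =
        ‖((∑ m ∈ M, ‖∑ k ∈ K, (b k : ℂ) * φ m k‖ ^ 2 : ℝ) : ℂ)‖ := by
      rw [Complex.norm_real, Real.norm_of_nonneg (Finset.sum_nonneg fun _ _ => sq_nonneg _)]
    rw [h4, e]
    calc _ ≤ ∑ k ∈ K, ∑ l ∈ K, (b k ^ 2 / 2 * w k l + b l ^ 2 / 2 * w l k) := by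
          refine (norm_sum_le _ _).trans (Finset.sum_le_sum fun k hk => ?_)
          refine (norm_sum_le _ _).trans (Finset.sum_le_sum fun l hl => ?_)
          rw [norm_mul, norm_mul, Complex.norm_real, Complex.norm_real, hsymm l k, ← add_mul]
          have h0 := hw k hk l hl
          have h5 : ‖b k‖ * ‖b l‖ ≤ b k ^ 2 / 2 + b l ^ 2 / 2 := by
            rw [Real.norm_eq_abs, Real.norm_eq_abs, ← sq_abs (b k), ← sq_abs (b l)]
            nlinarith [sq_nonneg (|b k| - |b l|)]
          exact mul_le_mul h5 h0 (norm_nonneg _) (by positivity)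
      _ = ∑ k ∈ K, b k ^ 2 * ∑ l ∈ K, w k l := by
          simp_rw [Finset.sum_add_distrib]
          rw [Finset.sum_comm (f := fun k l => b l ^ 2 / 2 * w l k), ← Finset.sum_add_distrib]
          refine Finset.sum_congr rfl fun k _ => ?_
          rw [← Finset.mul_sum]; ring
      _ ≤ ∑ k ∈ K, b k ^ 2 * R := by
          refine Finset.sum_le_sum fun k hk => ?_
          exact mul_le_mul_of_nonneg_left (hR k hk) (sq_nonneg _)
      _ = _ := by rw [Finset.sum_mul]
  calc _ ≤ (∑ m ∈ M, |a m| * ‖∑ k ∈ K, (b k : ℂ) * φ m k‖) ^ 2 := by gcongr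
    _ ≤ _ := h2
    _ ≤ _ := by
      simp_rw [sq_abs]
      exact mul_le_mul_of_nonneg_left h3 (Finset.sum_nonneg fun _ _ => sq_nonneg _)

/-- The truncation of an arithmetic function to arguments at most `U`. -/
noncomputable def arithTrunc (f : ArithmeticFunction ℝ) (U : ℕ) : ArithmeticFunction ℝ :=
  ⟨fun n => if n ≤ U then f n else 0, by simp⟩

lemma arithTrunc_apply (f : ArithmeticFunction ℝ) (U n : ℕ) :
    arithTrunc f U n = if n ≤ U then f n else 0 := rfl

/-- The real-valued Möbius function. -/
noncomputable def moebiusReal : ArithmeticFunction ℝ :=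
  ((ArithmeticFunction.moebius : ArithmeticFunction ℤ) : ArithmeticFunction ℝ)

lemma abs_moebiusReal_le_one (n : ℕ) : |moebiusReal n| ≤ 1 := by
  have := ArithmeticFunction.abs_moebius_le_one (n := n)
  rw [moebiusReal, ArithmeticFunction.intCoe_apply]
  exact_mod_cast this

/-- The coefficients `1 - μ_{≤ U} * ζ` in Vaughan's identity. -/
noncomputable def vaughanCoeff (U : ℕ) : ArithmeticFunction ℝ :=
  1 - arithTrunc moebiusReal U * (ArithmeticFunction.zeta : ArithmeticFunction ℝ)

lemma vaughan_identity (U : ℕ) :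
    ArithmeticFunction.vonMangoldt = arithTrunc ArithmeticFunction.vonMangoldt U +
      arithTrunc moebiusReal U * ArithmeticFunction.log -
      (arithTrunc moebiusReal U * arithTrunc ArithmeticFunction.vonMangoldt U) *
        (ArithmeticFunction.zeta : ArithmeticFunction ℝ) +
      vaughanCoeff U *
        (ArithmeticFunction.vonMangoldt - arithTrunc ArithmeticFunction.vonMangoldt U) := by
  rw [vaughanCoeff, ← ArithmeticFunction.zeta_mul_vonMangoldt]
  ring

lemma vaughanCoeff_eq_zero {U k : ℕ} (hU : k ≤ U) : vaughanCoeff U k = 0 := by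
  rcases Nat.eq_zero_or_pos k with rfl | hk
  · simp
  have h1 : (arithTrunc moebiusReal U * (ArithmeticFunction.zeta : ArithmeticFunction ℝ)) k =
      (moebiusReal * (ArithmeticFunction.zeta : ArithmeticFunction ℝ)) k := by
    rw [ArithmeticFunction.mul_apply, ArithmeticFunction.mul_apply]
    refine Finset.sum_congr rfl fun x hx => ?_
    have : x.1 ≤ k := Nat.divisor_le (Nat.fst_mem_divisors_of_mem_antidiagonal hx)
    rw [arithTrunc_apply, if_pos (by omega)]
  have h2 : moebiusReal * (ArithmeticFunction.zeta : ArithmeticFunction ℝ) = 1 :=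
    ArithmeticFunction.coe_moebius_mul_coe_zeta
  rw [vaughanCoeff, sub_eq_add_neg, ArithmeticFunction.add_apply, ArithmeticFunction.neg_apply, h1, h2, add_neg_cancel]

lemma abs_vaughanCoeff_le {U k : ℕ} (hk : 1 < k) : |vaughanCoeff U k| ≤ k.divisors.card := by
  rw [vaughanCoeff, sub_eq_add_neg, ArithmeticFunction.add_apply, ArithmeticFunction.neg_apply,
    ArithmeticFunction.one_apply_ne hk.ne', zero_add, abs_neg, ArithmeticFunction.mul_apply]
  refine (Finset.abs_sum_le_sum_abs _ _).trans ?_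
  calc _ ≤ ∑ x ∈ k.divisorsAntidiagonal, (1 : ℝ) := by
        refine Finset.sum_le_sum fun x hx => ?_
        rw [abs_mul]
        have h1 : |arithTrunc moebiusReal U x.1| ≤ 1 := by
          rw [arithTrunc_apply]; split_ifs
          · exact abs_moebiusReal_le_one _
          · simp
        have h2 : |((ArithmeticFunction.zeta : ArithmeticFunction ℝ)) x.2| ≤ 1 := by
          rw [ArithmeticFunction.natCoe_apply, ArithmeticFunction.zeta_apply]
          split_ifs <;> simp
        exact mul_le_one₀ h1 (abs_nonneg _) h2
    _ = _ := by
        rw [Finset.sum_const, nsmul_one, ← Nat.map_div_right_divisors, Finset.card_map]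

lemma abs_arithTrunc_mul_le {U d : ℕ} :
    |(arithTrunc moebiusReal U * arithTrunc ArithmeticFunction.vonMangoldt U) d| ≤ Real.log d := by
  rw [ArithmeticFunction.mul_apply, ← ArithmeticFunction.vonMangoldt_sum,
    ← Nat.sum_divisorsAntidiagonal' (f := fun _ j => ArithmeticFunction.vonMangoldt j)]
  refine (Finset.abs_sum_le_sum_abs _ _).trans (Finset.sum_le_sum fun x _ => ?_)
  have h0 : 0 ≤ ArithmeticFunction.vonMangoldt x.2 := ArithmeticFunction.vonMangoldt_nonneg
  have h1 : |arithTrunc moebiusReal U x.1| ≤ 1 := by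
    rw [arithTrunc_apply]; split_ifs
    · exact abs_moebiusReal_le_one _
    · simp
  have h2 : |arithTrunc ArithmeticFunction.vonMangoldt U x.2| ≤ ArithmeticFunction.vonMangoldt x.2 := by
    rw [arithTrunc_apply]; split_ifs
    · rw [abs_of_nonneg h0]
    · simp
  rw [abs_mul]
  calc _ ≤ 1 * ArithmeticFunction.vonMangoldt x.2 := mul_le_mul h1 h2 (abs_nonneg _) zero_le_one
    _ = _ := one_mul _

lemma arithTrunc_mul_eq_zero {f g : ArithmeticFunction ℝ} {U d : ℕ} (hd : U * U < d) :
    (arithTrunc f U * arithTrunc g U) d = 0 := by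
  rw [ArithmeticFunction.mul_apply]
  refine Finset.sum_eq_zero fun x hx => ?_
  have := (Nat.mem_divisorsAntidiagonal.1 hx).1
  rw [arithTrunc_apply, arithTrunc_apply]
  split_ifs with h1 h2
  · exact absurd (Nat.mul_le_mul h1 h2) (by omega)
  all_goals simp

lemma lt_mul_div_succ (N k : ℕ) (hk : 0 < k) : (N : ℝ) ≤ k * (((N / k : ℕ) : ℝ) + 1) := by
  have := Nat.lt_mul_div_succ N hk
  exact_mod_cast this.le

lemma mul_div_cast_le (N k : ℕ) : (k : ℝ) * ((N / k : ℕ) : ℝ) ≤ N := by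
  exact_mod_cast Nat.mul_div_le N k

lemma rpow_sub_one_mul_self {x c : ℝ} (hx : 0 < x) : x ^ c = x ^ (c - 1) * x := by
  rw [← Real.rpow_add_one hx.ne']; congr 1; ring

lemma norm_sum_linear_phase_le {c α δ₁ : ℝ} {N₀ N₁ k a' : ℕ} (hc : 1 ≤ c) (hα : 0 < α) (hk : 0 < k)
    (hδ₁ : 0 < δ₁) (hδ : δ₁ ≤ α * (N₀ : ℝ) ^ (c - 1)) (hN : N₀ ≤ N₁)
    (hup : c * (α * (N₁ : ℝ) ^ (c - 1)) * k ≤ 1 / 2) (ha' : N₀ / k ≤ a') :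
    ‖∑ m ∈ Finset.Ioc a' (N₁ / k), eC (α * ((k * m : ℕ) : ℝ) ^ c)‖ ≤ 2 / (k * δ₁) := by
  have hk' : (0 : ℝ) < k := by exact_mod_cast hk
  have c0 : 0 ≤ c - 1 := by linarith
  have e : ∀ m : ℕ, α * ((k * m : ℕ) : ℝ) ^ c = (α * (k : ℝ) ^ c) * (m : ℝ) ^ c := by
    intro m
    push_cast
    rw [Real.mul_rpow hk'.le (Nat.cast_nonneg m)]; ring
  simp_rw [e]
  have hNN : (N₀ : ℝ) ^ (c - 1) ≤ (N₁ : ℝ) ^ (c - 1) :=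
    Real.rpow_le_rpow (by positivity) (by exact_mod_cast hN) c0
  have hδN : δ₁ ≤ α * (N₁ : ℝ) ^ (c - 1) := hδ.trans (by gcongr)
  refine norm_sum_eC_rpow_le hc (by positivity) (by positivity) ?_ ?_ ?_
  · calc k * δ₁ ≤ k * (α * (N₁ : ℝ) ^ (c - 1)) := by gcongr
      _ ≤ c * (k * (α * (N₁ : ℝ) ^ (c - 1))) := le_mul_of_one_le_left (by positivity) hc
      _ ≤ _ := by linarith
  · intro _
    have h1 : (N₀ : ℝ) ≤ k * ((a' : ℝ) + 1) := by
      refine (lt_mul_div_succ N₀ k hk).trans ?_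
      gcongr
    have h2 : (N₀ : ℝ) ^ (c - 1) ≤ (k : ℝ) ^ (c - 1) * ((a' : ℝ) + 1) ^ (c - 1) := by
      rw [← Real.mul_rpow hk'.le (by positivity)]
      exact Real.rpow_le_rpow (by positivity) h1 c0
    calc k * δ₁ ≤ k * (α * (N₀ : ℝ) ^ (c - 1)) := by gcongr
      _ ≤ k * (α * ((k : ℝ) ^ (c - 1) * ((a' : ℝ) + 1) ^ (c - 1))) := by gcongr
      _ = 1 * (α * (k : ℝ) ^ c) * ((a' : ℝ) + 1) ^ (c - 1) := by
          rw [rpow_sub_one_mul_self (c := c) hk']; ring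
      _ ≤ c * (α * (k : ℝ) ^ c) * ((a' : ℝ) + 1) ^ (c - 1) := by gcongr
  · have h2 : (k : ℝ) ^ (c - 1) * ((N₁ / k : ℕ) : ℝ) ^ (c - 1) ≤ (N₁ : ℝ) ^ (c - 1) := by
      rw [← Real.mul_rpow hk'.le (by positivity)]
      exact Real.rpow_le_rpow (by positivity) (mul_div_cast_le N₁ k) c0
    calc _ = c * (α * ((k : ℝ) ^ (c - 1) * ((N₁ / k : ℕ) : ℝ) ^ (c - 1))) * k := by
          rw [rpow_sub_one_mul_self (c := c) hk']; ring
      _ ≤ c * (α * (N₁ : ℝ) ^ (c - 1)) * k := by gcongr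
      _ ≤ _ := hup

lemma norm_sum_phase_pair_le {c α δ₁ : ℝ} {N₀ N₁ k l : ℕ} (hc : 1 ≤ c) (hα : 0 < α) (hk : 0 < k)
    (hkl : k < l) (hδ₁ : 0 < δ₁) (hδ : δ₁ ≤ α * (N₀ : ℝ) ^ (c - 1)) (hN : N₀ ≤ N₁)
    (hup : c ^ 2 * (α * (N₁ : ℝ) ^ (c - 1)) * ((l : ℝ) - k) ≤ 1 / 2) :
    ‖∑ m ∈ Finset.Ioc (N₀ / k) (N₁ / l), eC (α * ((k * m : ℕ) : ℝ) ^ c) *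
      (starRingEnd ℂ) (eC (α * ((l * m : ℕ) : ℝ) ^ c))‖ ≤ 2 / (((l : ℝ) - k) * δ₁) := by
  have hk' : (0 : ℝ) < k := by exact_mod_cast hk
  have hl' : (0 : ℝ) < l := by exact_mod_cast hk.trans hkl
  have hlk : (0 : ℝ) < (l : ℝ) - k := sub_pos.2 (by exact_mod_cast hkl)
  have c0 : 0 ≤ c - 1 := by linarith
  have t1 := rpow_tangent_le hc hk' hl'.le
  have t2 := rpow_tangent_le hc hl' hk'.le
  have hβlo : c * (k : ℝ) ^ (c - 1) * ((l : ℝ) - k) ≤ (l : ℝ) ^ c - (k : ℝ) ^ c := by linarith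
  have hβhi : (l : ℝ) ^ c - (k : ℝ) ^ c ≤ c * (l : ℝ) ^ (c - 1) * ((l : ℝ) - k) := by linarith
  have e : ∀ m : ℕ, eC (α * ((k * m : ℕ) : ℝ) ^ c) * (starRingEnd ℂ) (eC (α * ((l * m : ℕ) : ℝ) ^ c)) =
      (starRingEnd ℂ) (eC ((α * ((l : ℝ) ^ c - (k : ℝ) ^ c)) * (m : ℝ) ^ c)) := by
    intro m
    rw [← eC_neg, ← eC_neg, ← eC_add]
    push_cast
    rw [Real.mul_rpow hk'.le (Nat.cast_nonneg m), Real.mul_rpow hl'.le (Nat.cast_nonneg m)]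
    congr 1; ring
  simp_rw [e]
  rw [← map_sum, RCLike.norm_conj]
  have hNN : (N₀ : ℝ) ^ (c - 1) ≤ (N₁ : ℝ) ^ (c - 1) :=
    Real.rpow_le_rpow (by positivity) (by exact_mod_cast hN) c0
  have hδN : δ₁ ≤ α * (N₁ : ℝ) ^ (c - 1) := hδ.trans (by gcongr)
  have hc2 : 1 ≤ c ^ 2 := one_le_pow₀ hc
  have hβ0 : 0 ≤ (l : ℝ) ^ c - (k : ℝ) ^ c := le_trans (by positivity) hβlo
  refine norm_sum_eC_rpow_le hc (by positivity) (by positivity) ?_ ?_ ?_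
  · calc ((l : ℝ) - k) * δ₁ ≤ ((l : ℝ) - k) * (α * (N₁ : ℝ) ^ (c - 1)) := by gcongr
      _ ≤ c ^ 2 * (((l : ℝ) - k) * (α * (N₁ : ℝ) ^ (c - 1))) := le_mul_of_one_le_left (by positivity) hc2
      _ ≤ _ := by linarith
  · intro _
    have h2 : (N₀ : ℝ) ^ (c - 1) ≤ (k : ℝ) ^ (c - 1) * (((N₀ / k : ℕ) : ℝ) + 1) ^ (c - 1) := by
      rw [← Real.mul_rpow hk'.le (by positivity)]
      exact Real.rpow_le_rpow (by positivity) (lt_mul_div_succ N₀ k hk) c0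
    calc ((l : ℝ) - k) * δ₁ ≤ ((l : ℝ) - k) * (α * (N₀ : ℝ) ^ (c - 1)) := by gcongr
      _ ≤ c ^ 2 * (((l : ℝ) - k) * (α * (N₀ : ℝ) ^ (c - 1))) := le_mul_of_one_le_left (by positivity) hc2
      _ ≤ c ^ 2 * (((l : ℝ) - k) * (α * ((k : ℝ) ^ (c - 1) * (((N₀ / k : ℕ) : ℝ) + 1) ^ (c - 1)))) := by
          gcongr
      _ = c * (α * (c * (k : ℝ) ^ (c - 1) * ((l : ℝ) - k))) * (((N₀ / k : ℕ) : ℝ) + 1) ^ (c - 1) := by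
          ring
      _ ≤ _ := by gcongr
  · have h2 : (l : ℝ) ^ (c - 1) * ((N₁ / l : ℕ) : ℝ) ^ (c - 1) ≤ (N₁ : ℝ) ^ (c - 1) := by
      rw [← Real.mul_rpow hl'.le (by positivity)]
      exact Real.rpow_le_rpow (by positivity) (mul_div_cast_le N₁ l) c0
    calc _ ≤ c * (α * (c * (l : ℝ) ^ (c - 1) * ((l : ℝ) - k))) * ((N₁ / l : ℕ) : ℝ) ^ (c - 1) := by
          gcongr
      _ = c ^ 2 * (α * ((l : ℝ) ^ (c - 1) * ((N₁ / l : ℕ) : ℝ) ^ (c - 1))) * ((l : ℝ) - k) := by ring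
      _ ≤ c ^ 2 * (α * (N₁ : ℝ) ^ (c - 1)) * ((l : ℝ) - k) := by gcongr
      _ ≤ _ := hup

/-- The phase `e(α (km)^c)`, restricted to `N₀ < km ≤ N₁`. -/
noncomputable def cutPhase (c α : ℝ) (N₀ N₁ m k : ℕ) : ℂ :=
  if N₀ < k * m ∧ k * m ≤ N₁ then eC (α * ((k * m : ℕ) : ℝ) ^ c) else 0

lemma norm_cutPhase_le (c α : ℝ) (N₀ N₁ m k : ℕ) : ‖cutPhase c α N₀ N₁ m k‖ ≤ 1 := by
  rw [cutPhase]; split_ifs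
  · exact (norm_eC _).le
  · simp

lemma norm_sum_cutPhase_pair_le {c α δ₁ : ℝ} {N₀ N₁ K k l : ℕ} (hc : 1 ≤ c) (hα : 0 < α) (hK : 0 < K)
    (hk : K < k) (hkl : k < l) (hδ₁ : 0 < δ₁) (hδ : δ₁ ≤ α * (N₀ : ℝ) ^ (c - 1)) (hN : N₀ ≤ N₁)
    (hup : c ^ 2 * (α * (N₁ : ℝ) ^ (c - 1)) * ((l : ℝ) - k) ≤ 1 / 2) :
    ‖∑ m ∈ Finset.Ioc 0 (N₁ / K), cutPhase c α N₀ N₁ m k *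
      (starRingEnd ℂ) (cutPhase c α N₀ N₁ m l)‖ ≤ 2 / (((l : ℝ) - k) * δ₁) := by
  have e : ∑ m ∈ Finset.Ioc 0 (N₁ / K), cutPhase c α N₀ N₁ m k *
      (starRingEnd ℂ) (cutPhase c α N₀ N₁ m l) =
      ∑ m ∈ Finset.Ioc (N₀ / k) (N₁ / l), eC (α * ((k * m : ℕ) : ℝ) ^ c) *
      (starRingEnd ℂ) (eC (α * ((l * m : ℕ) : ℝ) ^ c)) := by
    have hmem : ∀ m, m ∈ Finset.Ioc (N₀ / k) (N₁ / l) ↔ (N₀ < k * m ∧ l * m ≤ N₁) := by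
      intro m
      rw [Finset.mem_Ioc, Nat.div_lt_iff_lt_mul (by omega), Nat.le_div_iff_mul_le (by omega),
        mul_comm m k, mul_comm m l]
    refine (Finset.sum_subset (s₁ := Finset.Ioc (N₀ / k) (N₁ / l)) ?_ ?_).symm.trans
      (Finset.sum_congr rfl fun m hm => ?_)
    · intro m hm
      have h := (hmem m).1 hm
      rw [Finset.mem_Ioc, Nat.le_div_iff_mul_le hK]
      refine ⟨Nat.pos_of_ne_zero fun h0 => by simp [h0] at h, ?_⟩
      rw [mul_comm]
      exact (Nat.mul_le_mul_right m (by omega)).trans h.2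
    · intro m _ hm
      rw [hmem] at hm
      rw [cutPhase, cutPhase]
      split_ifs with h1 h2
      · exact absurd ⟨h1.1, h2.2⟩ hm
      all_goals simp
    · have h := (hmem m).1 hm
      have h3 : k * m ≤ l * m := Nat.mul_le_mul_right m hkl.le
      rw [cutPhase, cutPhase, if_pos ⟨h.1, h3.trans h.2⟩, if_pos ⟨h.1.trans_le h3, h.2⟩]
  rw [e]
  exact norm_sum_phase_pair_le hc hα (by omega) hkl hδ₁ hδ hN hup

lemma sum_one_div_abs_sub_le {F : Finset ℕ} {k H : ℕ} (hF : ∀ l ∈ F, |(l : ℝ) - k| < H) :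
    ∑ l ∈ F, (if l = k then 0 else 1 / |(l : ℝ) - k|) ≤ 2 * (1 + Real.log H) := by
  have h1 : ∀ l ∈ F, (if l = k then (0 : ℝ) else 1 / |(l : ℝ) - k|) =
      (if k < l then 1 / ((l - k : ℕ) : ℝ) else 0) + (if l < k then 1 / ((k - l : ℕ) : ℝ) else 0) := by
    intro l _
    rcases lt_trichotomy l k with h | rfl | h
    · rw [if_neg h.ne, if_neg (by omega), if_pos h, zero_add, Nat.cast_sub h.le, abs_sub_comm,
        abs_of_nonneg (sub_nonneg.2 (by exact_mod_cast h.le))]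
    · simp
    · rw [if_neg h.ne', if_pos h, if_neg (by omega), add_zero, Nat.cast_sub h.le,
        abs_of_nonneg (sub_nonneg.2 (by exact_mod_cast h.le))]
  rw [Finset.sum_congr rfl h1, Finset.sum_add_distrib, ← Finset.sum_filter, ← Finset.sum_filter]
  have h2 := sum_Ioc_one_div_le H
  have h3 : ∑ l ∈ F with k < l, 1 / ((l - k : ℕ) : ℝ) ≤ ∑ h ∈ Finset.Ioc 0 H, (1 : ℝ) / h := by
    rw [← Finset.sum_image (f := fun h : ℕ => (1 : ℝ) / h) (g := fun l => l - k)]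
    · refine Finset.sum_le_sum_of_subset_of_nonneg ?_ fun _ _ _ => by positivity
      intro h hh
      obtain ⟨l, hl, rfl⟩ := Finset.mem_image.1 hh
      rw [Finset.mem_filter] at hl
      have h4 := (abs_lt.1 (hF l hl.1)).2
      have : (l : ℝ) < H + k := by linarith
      have : l < H + k := by exact_mod_cast this
      rw [Finset.mem_Ioc]; omega
    · intro a ha b hb hab
      simp only [Finset.coe_filter, Set.mem_ofPred_eq] at ha hb
      simp only at hab
      omega
  have h4 : ∑ l ∈ F with l < k, 1 / ((k - l : ℕ) : ℝ) ≤ ∑ h ∈ Finset.Ioc 0 H, (1 : ℝ) / h := by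
    rw [← Finset.sum_image (f := fun h : ℕ => (1 : ℝ) / h) (g := fun l => k - l)]
    · refine Finset.sum_le_sum_of_subset_of_nonneg ?_ fun _ _ _ => by positivity
      intro h hh
      obtain ⟨l, hl, rfl⟩ := Finset.mem_image.1 hh
      rw [Finset.mem_filter] at hl
      have h4 := (abs_lt.1 (hF l hl.1)).1
      have : (k : ℝ) < H + l := by linarith
      have : k < H + l := by exact_mod_cast this
      rw [Finset.mem_Ioc]; omega
    · intro a ha b hb hab
      simp only [Finset.coe_filter, Set.mem_ofPred_eq] at ha hb
      simp only at hab
      omega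
  linarith

lemma norm_sq_bilinear_block_le {c α δ₁ : ℝ} {N₀ N₁ K H : ℕ} {F : Finset ℕ} (a b : ℕ → ℝ) (hc : 1 ≤ c)
    (hα : 0 < α) (hK : 0 < K) (hF : ∀ k ∈ F, K < k)
    (hFH : ∀ k ∈ F, ∀ l ∈ F, |(l : ℝ) - k| < H) (hδ₁ : 0 < δ₁)
    (hδ : δ₁ ≤ α * (N₀ : ℝ) ^ (c - 1)) (hN : N₀ ≤ N₁)
    (hup : c ^ 2 * (α * (N₁ : ℝ) ^ (c - 1)) * H ≤ 1 / 2) :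
    ‖∑ m ∈ Finset.Ioc 0 (N₁ / K), (a m : ℂ) * ∑ k ∈ F, (b k : ℂ) * cutPhase c α N₀ N₁ m k‖ ^ 2 ≤
      (∑ m ∈ Finset.Ioc 0 (N₁ / K), a m ^ 2) *
        ((∑ k ∈ F, b k ^ 2) * (N₁ / K + 4 * (1 + Real.log H) / δ₁)) := by
  have hNK : (((N₁ / K : ℕ) : ℝ)) ≤ N₁ / K := Nat.cast_div_le
  have hlt : ∀ k ∈ F, ∀ l ∈ F, k < l → ‖∑ m ∈ Finset.Ioc 0 (N₁ / K), cutPhase c α N₀ N₁ m k *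
      (starRingEnd ℂ) (cutPhase c α N₀ N₁ m l)‖ ≤ 2 / δ₁ * (1 / |(l : ℝ) - k|) := by
    intro k hk l hl hkl
    have hkl' : (0 : ℝ) < (l : ℝ) - k := sub_pos.2 (by exact_mod_cast hkl)
    have h1 := (abs_lt.1 (hFH k hk l hl)).2
    refine (norm_sum_cutPhase_pair_le hc hα hK (hF k hk) hkl hδ₁ hδ hN ?_).trans (le_of_eq ?_)
    · refine le_trans ?_ hup
      gcongr
    · rw [abs_of_pos hkl']; field_simp
  refine norm_sq_bilinear_le
    (w := fun k l => (if l = k then (N₁ : ℝ) / K else 0) +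
      2 / δ₁ * (if l = k then 0 else 1 / |(l : ℝ) - k|)) ?_ ?_ ?_
  · intro k hk l hl
    rcases lt_trichotomy k l with h | rfl | h
    · rw [if_neg h.ne', if_neg h.ne', zero_add]
      exact hlt k hk l hl h
    · rw [if_pos rfl, if_pos rfl, mul_zero, add_zero]
      refine (norm_sum_le _ _).trans (le_trans ?_ hNK)
      calc _ ≤ ∑ m ∈ Finset.Ioc 0 (N₁ / K), (1 : ℝ) := by
            refine Finset.sum_le_sum fun m _ => ?_
            rw [norm_mul, RCLike.norm_conj]
            exact mul_le_one₀ (norm_cutPhase_le _ _ _ _ _ _) (norm_nonneg _) (norm_cutPhase_le _ _ _ _ _ _)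
        _ = _ := by simp
    · rw [if_neg h.ne, if_neg h.ne, zero_add, abs_sub_comm]
      refine le_trans (le_of_eq ?_) (hlt l hl k hk h)
      rw [← RCLike.norm_conj, map_sum]
      congr 1
      refine Finset.sum_congr rfl fun m _ => ?_
      rw [map_mul, Complex.conj_conj, mul_comm]
  · intro k l
    simp only [eq_comm (a := k) (b := l), abs_sub_comm (k : ℝ) (l : ℝ)]
  · intro k hk
    rw [Finset.sum_add_distrib, ← Finset.mul_sum, Finset.sum_ite_eq' F k, if_pos hk]
    have := sum_one_div_abs_sub_le (F := F) (k := k) (H := H) (fun l hl => hFH k hk l hl)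
    have h2 : 2 / δ₁ * ∑ l ∈ F, (if l = k then 0 else 1 / |(l : ℝ) - k|) ≤
        2 / δ₁ * (2 * (1 + Real.log H)) := by gcongr
    have h3 : 2 / δ₁ * (2 * (1 + Real.log H)) = 4 * (1 + Real.log H) / δ₁ := by ring
    linarith

lemma norm_sq_bilinear_dyadic_le {c α δ₁ : ℝ} {N₀ N₁ K H : ℕ} (a b : ℕ → ℝ) (hc : 1 ≤ c)
    (hα : 0 < α) (hK : 0 < K) (hH : 0 < H) (hδ₁ : 0 < δ₁)
    (hδ : δ₁ ≤ α * (N₀ : ℝ) ^ (c - 1)) (hN : N₀ ≤ N₁)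
    (hup : c ^ 2 * (α * (N₁ : ℝ) ^ (c - 1)) * H ≤ 1 / 2) :
    ‖∑ k ∈ Finset.Ioc K (2 * K), (b k : ℂ) *
        ∑ m ∈ Finset.Ioc 0 (N₁ / K), (a m : ℂ) * cutPhase c α N₀ N₁ m k‖ ^ 2 ≤
      ((K : ℝ) / H + 2) * ((∑ m ∈ Finset.Ioc 0 (N₁ / K), a m ^ 2) *
        ((∑ k ∈ Finset.Ioc K (2 * K), b k ^ 2) * (N₁ / K + 4 * (1 + Real.log H) / δ₁))) := by
  set F := Finset.Ioc K (2 * K)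
  set J := Finset.Icc (K / H) (2 * K / H)
  have hmaps : ∀ k ∈ F, k / H ∈ J := by
    intro k hk
    have := Finset.mem_Ioc.1 hk
    exact Finset.mem_Icc.2 ⟨Nat.div_le_div_right this.1.le, Nat.div_le_div_right this.2⟩
  have hcard : (J.card : ℝ) ≤ (K : ℝ) / H + 2 := by
    have h1 : J.card ≤ K / H + 2 := by
      rw [Nat.card_Icc]
      have : 2 * K / H ≤ 2 * (K / H) + 1 := by
        have h2 := Nat.lt_mul_div_succ K hH
        have h3 : 2 * K / H < 2 * (K / H) + 2 := by
          rw [Nat.div_lt_iff_lt_mul hH]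
          calc 2 * K < 2 * (H * (K / H + 1)) := by omega
            _ = _ := by ring
        omega
      omega
    calc (J.card : ℝ) ≤ ((K / H + 2 : ℕ) : ℝ) := by exact_mod_cast h1
      _ = ((K / H : ℕ) : ℝ) + 2 := by push_cast; ring
      _ ≤ _ := by gcongr; exact Nat.cast_div_le
  rw [← Finset.sum_fiberwise_of_maps_to hmaps, ← Finset.sum_fiberwise_of_maps_to (s := F) hmaps (fun k => b k ^ 2)]
  have hA : 0 ≤ ∑ m ∈ Finset.Ioc 0 (N₁ / K), a m ^ 2 := Finset.sum_nonneg fun _ _ => sq_nonneg _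
  have hblock : ∀ j ∈ J, ‖∑ k ∈ F with k / H = j, (b k : ℂ) *
      ∑ m ∈ Finset.Ioc 0 (N₁ / K), (a m : ℂ) * cutPhase c α N₀ N₁ m k‖ ^ 2 ≤
      (∑ m ∈ Finset.Ioc 0 (N₁ / K), a m ^ 2) *
        ((∑ k ∈ F with k / H = j, b k ^ 2) * (N₁ / K + 4 * (1 + Real.log H) / δ₁)) := by
    intro j _
    have e : ∑ k ∈ F with k / H = j, (b k : ℂ) *
        ∑ m ∈ Finset.Ioc 0 (N₁ / K), (a m : ℂ) * cutPhase c α N₀ N₁ m k =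
        ∑ m ∈ Finset.Ioc 0 (N₁ / K), (a m : ℂ) *
          ∑ k ∈ F with k / H = j, (b k : ℂ) * cutPhase c α N₀ N₁ m k := by
      simp_rw [Finset.mul_sum]
      rw [Finset.sum_comm]
      refine Finset.sum_congr rfl fun m _ => Finset.sum_congr rfl fun k _ => by ring
    rw [e]
    refine norm_sq_bilinear_block_le a b hc hα hK ?_ ?_ hδ₁ hδ hN hup
    · intro k hk
      exact (Finset.mem_Ioc.1 (Finset.mem_filter.1 hk).1).1
    · intro k hk l hl
      have hk := (Finset.mem_filter.1 hk).2
      have hl := (Finset.mem_filter.1 hl).2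
      have k1 := Nat.lt_mul_div_succ k hH
      have k2 := Nat.mul_div_le k H
      have l1 := Nat.lt_mul_div_succ l hH
      have l2 := Nat.mul_div_le l H
      rw [hk] at k1 k2
      rw [hl] at l1 l2
      rw [mul_add, mul_one] at k1 l1
      have q1 : (k : ℝ) < l + H := by exact_mod_cast (by omega : k < l + H)
      have q2 : (l : ℝ) < k + H := by exact_mod_cast (by omega : l < k + H)
      rw [abs_lt]
      constructor <;> linarith
  calc _ ≤ (∑ j ∈ J, ‖∑ k ∈ F with k / H = j, (b k : ℂ) *
        ∑ m ∈ Finset.Ioc 0 (N₁ / K), (a m : ℂ) * cutPhase c α N₀ N₁ m k‖) ^ 2 := by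
        gcongr; exact norm_sum_le _ _
    _ ≤ J.card * ∑ j ∈ J, ‖∑ k ∈ F with k / H = j, (b k : ℂ) *
        ∑ m ∈ Finset.Ioc 0 (N₁ / K), (a m : ℂ) * cutPhase c α N₀ N₁ m k‖ ^ 2 :=
        sq_sum_le_card_mul_sum_sq
    _ ≤ ((K : ℝ) / H + 2) * ∑ j ∈ J, ((∑ m ∈ Finset.Ioc 0 (N₁ / K), a m ^ 2) *
        ((∑ k ∈ F with k / H = j, b k ^ 2) * (N₁ / K + 4 * (1 + Real.log H) / δ₁))) := by
        exact mul_le_mul hcard (Finset.sum_le_sum hblock)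
          (Finset.sum_nonneg fun _ _ => sq_nonneg _) (by positivity)
    _ = _ := by rw [← Finset.mul_sum, ← Finset.sum_mul]

lemma natLog_two_add_one_le {n : ℕ} (hn : 1 ≤ n) : ((Nat.log 2 n + 1 : ℕ) : ℝ) ≤ 2 * (1 + Real.log n) := by
  have h1 : (2 : ℝ) ^ Nat.log 2 n ≤ n := by exact_mod_cast Nat.pow_log_le_self 2 (by omega)
  have h2 := Real.log_le_log (by positivity) h1
  rw [Real.log_pow] at h2
  have h3 := Real.log_two_gt_d9
  have h4 : (0 : ℝ) ≤ Nat.log 2 n := Nat.cast_nonneg _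
  push_cast
  nlinarith

lemma norm_sum_Ioc_le_of_dyadic {g : ℕ → ℂ} {U : ℕ} {D : ℝ}
    (hD : ∀ j : ℕ, ‖∑ k ∈ Finset.Ioc (2 ^ j * U) (2 * (2 ^ j * U)), g k‖ ≤ D) (J : ℕ) :
    ‖∑ k ∈ Finset.Ioc U (2 ^ J * U), g k‖ ≤ J * D := by
  induction J with
  | zero => simp
  | succ J ih =>
    have h : 2 ^ (J + 1) * U = 2 * (2 ^ J * U) := by ring
    rw [h, ← Finset.sum_Ioc_consecutive g (n := 2 ^ J * U)]
    · refine (norm_add_le _ _).trans ((add_le_add ih (hD J)).trans (le_of_eq ?_))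
      push_cast; ring
    · exact Nat.le_mul_of_pos_left U (by positivity)
    · omega

section VaughanBounds

variable {c α δ₁ ℓ : ℝ} {N₀ N₁ U : ℕ}

lemma norm_typeI_log_le (hc : 1 ≤ c) (hα : 0 < α) (hδ₁ : 0 < δ₁)
    (hδ : δ₁ ≤ α * (N₀ : ℝ) ^ (c - 1)) (hN : N₀ ≤ N₁) (hU : 1 ≤ U) (hUN : U ≤ N₁)
    (hup : c * (α * (N₁ : ℝ) ^ (c - 1)) * U ≤ 1 / 2) (hℓ : ℓ = 1 + Real.log N₁) :
    ‖∑ n ∈ Finset.Ioc N₀ N₁, (((arithTrunc moebiusReal U * ArithmeticFunction.log) n : ℝ) : ℂ) *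
      eC (α * (n : ℝ) ^ c)‖ ≤ 2 * ℓ ^ 2 / δ₁ := by
  have hlogN : 0 ≤ Real.log N₁ := Real.log_natCast_nonneg _
  have hℓ1 : 1 ≤ ℓ := by linarith
  rw [sum_Ioc_convolution_mul _ _ (fun n => eC (α * (n : ℝ) ^ c))]
  have hterm : ∀ k ∈ Finset.Ioc 0 N₁, ‖((arithTrunc moebiusReal U k : ℝ) : ℂ) *
      ∑ m ∈ Finset.Ioc (N₀ / k) (N₁ / k), ((ArithmeticFunction.log m : ℝ) : ℂ) *
        eC (α * ((k * m : ℕ) : ℝ) ^ c)‖ ≤ if k ≤ U then ℓ * (2 / (k * δ₁)) else 0 := by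
    intro k hk
    rw [Finset.mem_Ioc] at hk
    rw [arithTrunc_apply]
    split_ifs with hkU
    · rw [norm_mul, Complex.norm_real]
      have hB : ∀ a', N₀ / k ≤ a' → ‖∑ m ∈ Finset.Ioc a' (N₁ / k), eC (α * ((k * m : ℕ) : ℝ) ^ c)‖ ≤
          2 / (k * δ₁) := by
        intro a' ha'
        refine norm_sum_linear_phase_le hc hα hk.1 hδ₁ hδ hN (le_trans ?_ hup) ha'
        have : (k : ℝ) ≤ U := by exact_mod_cast hkU
        gcongr
      have h1 := norm_sum_monotone_mul_le (w := fun m => Real.log m)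
        (z := fun m => eC (α * ((k * m : ℕ) : ℝ) ^ c)) (a := N₀ / k) (b := N₁ / k)
        (Nat.div_le_div_right hN) (fun m _ _ => ?_) (Real.log_natCast_nonneg _) hB
      · have h2 : Real.log ((N₁ / k : ℕ) : ℝ) ≤ ℓ := by
          rcases Nat.eq_zero_or_pos (N₁ / k) with h0 | h0
          · rw [h0]; simp; linarith
          · have : Real.log ((N₁ / k : ℕ) : ℝ) ≤ Real.log N₁ :=
              Real.log_le_log (by exact_mod_cast h0) (by exact_mod_cast Nat.div_le_self _ _)
            linarith
        have h3 := abs_moebiusReal_le_one k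
        rw [Real.norm_eq_abs]
        calc _ ≤ 1 * (Real.log ((N₁ / k : ℕ) : ℝ) * (2 / (k * δ₁))) :=
              mul_le_mul h3 h1 (norm_nonneg _) zero_le_one
          _ ≤ _ := by rw [one_mul]; gcongr
      · rcases Nat.eq_zero_or_pos m with rfl | h0
        · simp
        · exact Real.log_le_log (by exact_mod_cast h0) (by push_cast; linarith)
    · simp
  refine (norm_sum_le _ _).trans ((Finset.sum_le_sum hterm).trans ?_)
  rw [← Finset.sum_filter]
  have hf : (Finset.Ioc 0 N₁).filter (fun k => k ≤ U) = Finset.Ioc 0 U := by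
    ext k; simp only [Finset.mem_filter, Finset.mem_Ioc]; omega
  rw [hf]
  have hs := sum_Ioc_one_div_le U
  have hlU : Real.log U ≤ Real.log N₁ := Real.log_le_log (by exact_mod_cast hU) (by exact_mod_cast hUN)
  calc _ = 2 * ℓ / δ₁ * ∑ k ∈ Finset.Ioc 0 U, (1 : ℝ) / k := by
        rw [Finset.mul_sum]
        refine Finset.sum_congr rfl fun k hk => ?_
        have : (0 : ℝ) < k := by exact_mod_cast (Finset.mem_Ioc.1 hk).1
        field_simp
    _ ≤ 2 * ℓ / δ₁ * ℓ := by gcongr; linarith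
    _ = _ := by ring

lemma norm_typeI_trunc_le (hc : 1 ≤ c) (hα : 0 < α) (hδ₁ : 0 < δ₁)
    (hδ : δ₁ ≤ α * (N₀ : ℝ) ^ (c - 1)) (hN : N₀ ≤ N₁) (hN₁ : 1 ≤ N₁)
    (hup : c * (α * (N₁ : ℝ) ^ (c - 1)) * (U * U : ℕ) ≤ 1 / 2) (hℓ : ℓ = 1 + Real.log N₁) :
    ‖∑ n ∈ Finset.Ioc N₀ N₁, ((((arithTrunc moebiusReal U *
      arithTrunc ArithmeticFunction.vonMangoldt U) * (ArithmeticFunction.zeta : ArithmeticFunction ℝ)) n : ℝ) : ℂ) *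
      eC (α * (n : ℝ) ^ c)‖ ≤ 2 * ℓ ^ 2 / δ₁ := by
  have hlogN : 0 ≤ Real.log N₁ := Real.log_natCast_nonneg _
  have hℓ1 : 1 ≤ ℓ := by linarith
  rw [sum_Ioc_convolution_mul _ _ (fun n => eC (α * (n : ℝ) ^ c))]
  have hterm : ∀ k ∈ Finset.Ioc 0 N₁, ‖(((arithTrunc moebiusReal U *
      arithTrunc ArithmeticFunction.vonMangoldt U) k : ℝ) : ℂ) *
      ∑ m ∈ Finset.Ioc (N₀ / k) (N₁ / k), (((ArithmeticFunction.zeta : ArithmeticFunction ℝ) m : ℝ) : ℂ) *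
        eC (α * ((k * m : ℕ) : ℝ) ^ c)‖ ≤ ℓ * (2 / (k * δ₁)) := by
    intro k hk
    rw [Finset.mem_Ioc] at hk
    have hk' : (0 : ℝ) < k := by exact_mod_cast hk.1
    have e : ∑ m ∈ Finset.Ioc (N₀ / k) (N₁ / k), (((ArithmeticFunction.zeta : ArithmeticFunction ℝ) m : ℝ) : ℂ) *
        eC (α * ((k * m : ℕ) : ℝ) ^ c) = ∑ m ∈ Finset.Ioc (N₀ / k) (N₁ / k), eC (α * ((k * m : ℕ) : ℝ) ^ c) := by
      refine Finset.sum_congr rfl fun m hm => ?_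
      have : m ≠ 0 := ((Nat.zero_le _).trans_lt (Finset.mem_Ioc.1 hm).1).ne'
      rw [ArithmeticFunction.natCoe_apply, ArithmeticFunction.zeta_apply_ne this]
      simp
    rw [e, norm_mul, Complex.norm_real, Real.norm_eq_abs]
    by_cases hkU : U * U < k
    · rw [arithTrunc_mul_eq_zero hkU, abs_zero, zero_mul]; positivity
    · have h1 := norm_sum_linear_phase_le hc hα hk.1 hδ₁ hδ hN (a' := N₀ / k) (le_trans ?_ hup) le_rfl
      · have h2 : |(arithTrunc moebiusReal U * arithTrunc ArithmeticFunction.vonMangoldt U) k| ≤ ℓ := by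
          refine abs_arithTrunc_mul_le.trans ?_
          have : Real.log k ≤ Real.log N₁ := Real.log_le_log hk' (by exact_mod_cast hk.2)
          linarith
        exact mul_le_mul h2 h1 (norm_nonneg _) (by linarith)
      · have : (k : ℝ) ≤ (U * U : ℕ) := by exact_mod_cast (by omega : k ≤ U * U)
        gcongr
  refine (norm_sum_le _ _).trans ((Finset.sum_le_sum hterm).trans ?_)
  have hs := sum_Ioc_one_div_le N₁
  calc _ = 2 * ℓ / δ₁ * ∑ k ∈ Finset.Ioc 0 N₁, (1 : ℝ) / k := by
        rw [Finset.mul_sum]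
        refine Finset.sum_congr rfl fun k hk => ?_
        have : (0 : ℝ) < k := by exact_mod_cast (Finset.mem_Ioc.1 hk).1
        field_simp
    _ ≤ 2 * ℓ / δ₁ * ℓ := by gcongr; linarith
    _ = _ := by ring

end VaughanBounds

/-- The part of the von Mangoldt function supported beyond `U`. -/
noncomputable def vonMangoldtTail (U : ℕ) : ArithmeticFunction ℝ :=
  ArithmeticFunction.vonMangoldt - arithTrunc ArithmeticFunction.vonMangoldt U

lemma vonMangoldtTail_apply (U n : ℕ) :
    vonMangoldtTail U n = if n ≤ U then 0 else ArithmeticFunction.vonMangoldt n := by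
  rw [vonMangoldtTail, sub_eq_add_neg, ArithmeticFunction.add_apply, ArithmeticFunction.neg_apply,
    arithTrunc_apply]
  split_ifs <;> simp

lemma abs_vonMangoldtTail_le {U n N : ℕ} (hn : n ≤ N) :
    |vonMangoldtTail U n| ≤ 1 + Real.log N := by
  have h0 : 0 ≤ Real.log N := Real.log_natCast_nonneg _
  rw [vonMangoldtTail_apply]
  split_ifs with h
  · rw [abs_zero]; positivity
  · rw [abs_of_nonneg ArithmeticFunction.vonMangoldt_nonneg]
    refine ArithmeticFunction.vonMangoldt_le_log.trans ?_
    have : Real.log n ≤ Real.log N :=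
      Real.log_le_log (by exact_mod_cast (by omega : 0 < n)) (by exact_mod_cast hn)
    linarith

lemma sum_Ioc_div_eq_sum_cutPhase {c α : ℝ} {N₀ N₁ K k : ℕ} (g : ℕ → ℝ) (hK : 0 < K) (hk : K < k) :
    ∑ m ∈ Finset.Ioc (N₀ / k) (N₁ / k), (g m : ℂ) * eC (α * ((k * m : ℕ) : ℝ) ^ c) =
      ∑ m ∈ Finset.Ioc 0 (N₁ / K), (g m : ℂ) * cutPhase c α N₀ N₁ m k := by
  have hk0 : 0 < k := by omega
  have hmem : ∀ m, m ∈ Finset.Ioc (N₀ / k) (N₁ / k) ↔ N₀ < k * m ∧ k * m ≤ N₁ := by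
    intro m
    rw [Finset.mem_Ioc, Nat.div_lt_iff_lt_mul hk0, Nat.le_div_iff_mul_le hk0, mul_comm]
  have hsub : Finset.Ioc (N₀ / k) (N₁ / k) ⊆ Finset.Ioc 0 (N₁ / K) := by
    refine Finset.Ioc_subset_Ioc (Nat.zero_le _) (Nat.div_le_div_left hk.le hK)
  rw [← Finset.sum_subset hsub]
  · refine Finset.sum_congr rfl fun m hm => ?_
    rw [cutPhase, if_pos ((hmem m).1 hm)]
  · intro m _ hm
    rw [cutPhase, if_neg (fun h => hm ((hmem m).2 h)), mul_zero]

section TypeTwo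

variable {c α R ℓ : ℝ} {N₀ N₁ U : ℕ}

set_option maxHeartbeats 2000000 in
lemma norm_typeII_dyadic_le (hc : 1 ≤ c) (hc3 : c ≤ 3) (hα : 0 < α) (hU : 2 ≤ U) (hN₀ : U ≤ N₀)
    (hN : N₀ ≤ N₁) (hR : 1 ≤ R) (hRN : (N₁ : ℝ) ^ (c - 1) ≤ R * (N₀ : ℝ) ^ (c - 1))
    (hlow : (U : ℝ) ≤ α * (N₁ : ℝ) ^ c) (hup : 18 * (U : ℝ) ^ 2 * (α * (N₁ : ℝ) ^ (c - 1)) ≤ 1)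
    (hℓ : ℓ = 1 + Real.log N₁) {K : ℕ} (hUK : U ≤ K) :
    ‖∑ k ∈ Finset.Ioc K (2 * K), (vaughanCoeff U k : ℂ) *
        ∑ m ∈ Finset.Ioc (N₀ / k) (N₁ / k), (vonMangoldtTail U m : ℂ) * eC (α * ((k * m : ℕ) : ℝ) ^ c)‖ ≤
      18 * R * N₁ * ℓ ^ 3 / √U := by
  have hN₁ : 1 ≤ N₁ := by omega
  have hlogN : 0 ≤ Real.log N₁ := Real.log_natCast_nonneg _
  have hℓ1 : 1 ≤ ℓ := by linarith
  have hUr : (2 : ℝ) ≤ U := by exact_mod_cast hU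
  have hU0 : (0 : ℝ) < U := by linarith
  have hK0 : 0 < K := by omega
  have hKr : (0 : ℝ) < K := by exact_mod_cast hK0
  have hUKr : (U : ℝ) ≤ K := by exact_mod_cast hUK
  have hN₁r : (0 : ℝ) < N₁ := by exact_mod_cast hN₁
  have hN₀r : (0 : ℝ) < N₀ := by exact_mod_cast (by omega : 0 < N₀)
  have hrhs : 0 ≤ 18 * R * N₁ * ℓ ^ 3 / √U := by positivity
  by_cases hKU : N₁ ≤ K * U
  · have : ∑ k ∈ Finset.Ioc K (2 * K), (vaughanCoeff U k : ℂ) *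
        ∑ m ∈ Finset.Ioc (N₀ / k) (N₁ / k), (vonMangoldtTail U m : ℂ) * eC (α * ((k * m : ℕ) : ℝ) ^ c) = 0 := by
      refine Finset.sum_eq_zero fun k hk => ?_
      have hk' := Finset.mem_Ioc.1 hk
      rw [Finset.sum_eq_zero, mul_zero]
      intro m hm
      have hm' := (Nat.le_div_iff_mul_le (by omega)).1 (Finset.mem_Ioc.1 hm).2
      have : m ≤ U := by
        by_contra hmU
        push Not at hmU
        have : U * K < m * k := Nat.mul_lt_mul'' hmU hk'.1
        linarith
      rw [vonMangoldtTail_apply, if_pos this]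
      simp
    rw [this, norm_zero]
    exact hrhs
  push Not at hKU
  have hKUr : (K : ℝ) * U ≤ N₁ := by exact_mod_cast hKU.le
  set Δ := α * (N₁ : ℝ) ^ (c - 1) with hΔ
  set δ₁ := α * (N₀ : ℝ) ^ (c - 1) with hδ₁
  have hΔ0 : 0 < Δ := by positivity
  have hδ0 : 0 < δ₁ := by positivity
  have hΔδ : Δ ≤ R * δ₁ := by
    rw [hΔ, hδ₁]
    calc α * (N₁ : ℝ) ^ (c - 1) ≤ α * (R * (N₀ : ℝ) ^ (c - 1)) := by gcongr
      _ = _ := by ring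
  have hlow' : (U : ℝ) ≤ Δ * N₁ := by
    rw [hΔ, mul_assoc, ← rpow_sub_one_mul_self hN₁r]; exact hlow
  set H := ⌊1 / (18 * Δ)⌋₊ with hH
  have h18 : 1 ≤ 1 / (18 * Δ) := by
    rw [le_div_iff₀ (by positivity)]
    have h1 : (1 : ℝ) ≤ (U : ℝ) ^ 2 := one_le_pow₀ (by linarith)
    calc 1 * (18 * Δ) = 18 * 1 * Δ := by ring
      _ ≤ 18 * (U : ℝ) ^ 2 * Δ := by gcongr
      _ ≤ 1 := hup
  have hH1 : 1 ≤ H := Nat.one_le_floor_iff _ |>.2 h18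
  have hH1r : (1 : ℝ) ≤ H := by exact_mod_cast hH1
  have hHle : (H : ℝ) * (18 * Δ) ≤ 1 := by
    rw [← le_div_iff₀ (by positivity)]
    exact Nat.floor_le (by positivity)
  have hHge : 1 ≤ (H : ℝ) * (36 * Δ) := by
    have h1 : 1 / (18 * Δ) < H + 1 := Nat.lt_floor_add_one _
    rw [div_lt_iff₀ (by positivity)] at h1
    have h2 := mul_le_mul_of_nonneg_right (show (H : ℝ) + 1 ≤ 2 * H by linarith) (by positivity : 0 ≤ 18 * Δ)
    linarith
  have hHN : (H : ℝ) ≤ N₁ := by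
    have : (H : ℝ) * Δ ≤ N₁ * Δ := by linarith
    exact le_of_mul_le_mul_right this hΔ0
  have hlogH : 1 + Real.log H ≤ ℓ := by
    have := Real.log_le_log (by linarith) hHN
    linarith
  have e : ∑ k ∈ Finset.Ioc K (2 * K), (vaughanCoeff U k : ℂ) *
        ∑ m ∈ Finset.Ioc (N₀ / k) (N₁ / k), (vonMangoldtTail U m : ℂ) * eC (α * ((k * m : ℕ) : ℝ) ^ c) =
      ∑ k ∈ Finset.Ioc K (2 * K), (vaughanCoeff U k : ℂ) *
        ∑ m ∈ Finset.Ioc 0 (N₁ / K), (vonMangoldtTail U m : ℂ) * cutPhase c α N₀ N₁ m k := by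
    refine Finset.sum_congr rfl fun k hk => ?_
    rw [sum_Ioc_div_eq_sum_cutPhase _ hK0 (Finset.mem_Ioc.1 hk).1]
  rw [e]
  have hmain := norm_sq_bilinear_dyadic_le (N₀ := N₀) (N₁ := N₁) (fun m => vonMangoldtTail U m)
    (fun k => vaughanCoeff U k) hc hα hK0 hH1 hδ0 le_rfl hN (by
      have : c ^ 2 ≤ 3 ^ 2 := pow_le_pow_left₀ (by linarith) hc3 2
      have : c ^ 2 ≤ 9 := by linarith
      have h2 : 0 ≤ Δ * H := by positivity
      calc c ^ 2 * (α * (N₁ : ℝ) ^ (c - 1)) * H = c ^ 2 * (Δ * H) := by rw [hΔ]; ring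
        _ ≤ 9 * (Δ * H) := by gcongr
        _ ≤ 1 / 2 := by linarith)
  have hA : ∑ m ∈ Finset.Ioc 0 (N₁ / K), vonMangoldtTail U m ^ 2 ≤ N₁ / K * ℓ ^ 2 := by
    calc _ ≤ ∑ m ∈ Finset.Ioc 0 (N₁ / K), ℓ ^ 2 := by
          refine Finset.sum_le_sum fun m hm => ?_
          rw [← sq_abs]
          have := abs_vonMangoldtTail_le (U := U) ((Finset.mem_Ioc.1 hm).2.trans (Nat.div_le_self N₁ K))
          rw [← hℓ] at this
          gcongr
      _ = (N₁ / K : ℕ) * ℓ ^ 2 := by simp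
      _ ≤ _ := by
        gcongr
        exact Nat.cast_div_le
  have hB : ∑ k ∈ Finset.Ioc K (2 * K), vaughanCoeff U k ^ 2 ≤ 2 * K * ℓ ^ 3 := by
    have h2K : 2 * K ≤ N₁ := by
      have := Nat.mul_le_mul_right K hU
      linarith
    calc _ ≤ ∑ k ∈ Finset.Ioc K (2 * K), (k.divisors.card : ℝ) ^ 2 := by
          refine Finset.sum_le_sum fun k hk => ?_
          rw [← sq_abs]
          have := abs_vaughanCoeff_le (U := U) (k := k) (by have := Finset.mem_Ioc.1 hk; omega)
          gcongr
      _ ≤ ∑ k ∈ Finset.Ioc 0 (2 * K), (k.divisors.card : ℝ) ^ 2 :=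
          Finset.sum_le_sum_of_subset_of_nonneg (Finset.Ioc_subset_Ioc_left (Nat.zero_le _))
            fun _ _ _ => by positivity
      _ ≤ (2 * K : ℕ) * (1 + Real.log (2 * K : ℕ)) ^ 3 := sum_card_divisors_sq_le _
      _ ≤ _ := by
        have h1 : Real.log (2 * K : ℕ) ≤ Real.log N₁ :=
          Real.log_le_log (by exact_mod_cast (by omega : 0 < 2 * K)) (by exact_mod_cast h2K)
        have h0 : 0 ≤ Real.log (2 * K : ℕ) := Real.log_natCast_nonneg _
        have h2 : 1 + Real.log (2 * K : ℕ) ≤ ℓ := by linarith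
        have h3 : ((2 * K : ℕ) : ℝ) = 2 * K := by push_cast; ring
        rw [h3] at h0 h2 ⊢
        gcongr
  have hA0 : 0 ≤ ∑ m ∈ Finset.Ioc 0 (N₁ / K), vonMangoldtTail U m ^ 2 := Finset.sum_nonneg fun _ _ => sq_nonneg _
  have hB0 : 0 ≤ ∑ k ∈ Finset.Ioc K (2 * K), vaughanCoeff U k ^ 2 := Finset.sum_nonneg fun _ _ => sq_nonneg _
  have hlH : 0 ≤ Real.log H := Real.log_natCast_nonneg _
  have hsq : (18 * R * N₁ * ℓ ^ 3 / √U) ^ 2 = 324 * R ^ 2 * N₁ ^ 2 * ℓ ^ 6 / U := by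
    rw [div_pow, Real.sq_sqrt hU0.le]; ring
  refine le_of_sq_le_sq ?_ hrhs
  rw [hsq]
  refine hmain.trans ?_
  have hlin : ((K : ℝ) / H + 2) * ((∑ m ∈ Finset.Ioc 0 (N₁ / K), vonMangoldtTail U m ^ 2) *
        ((∑ k ∈ Finset.Ioc K (2 * K), vaughanCoeff U k ^ 2) * (N₁ / K + 4 * (1 + Real.log H) / δ₁))) ≤
      ((K : ℝ) / H + 2) * ((N₁ / K * ℓ ^ 2) * ((2 * K * ℓ ^ 3) * (N₁ / K + 4 * ℓ / δ₁))) := by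
    gcongr
  refine hlin.trans ?_
  have e2 : ((K : ℝ) / H + 2) * ((N₁ / K * ℓ ^ 2) * ((2 * K * ℓ ^ 3) * (N₁ / K + 4 * ℓ / δ₁))) =
      2 * N₁ * ℓ ^ 5 * (N₁ / H + K / H * (4 * ℓ / δ₁) + 2 * (N₁ / K) + 2 * (4 * ℓ / δ₁)) := by
    field_simp
    ring
  rw [e2]
  set Y := R * ℓ * N₁ / U with hY
  have hRl : 1 ≤ R * ℓ := one_le_mul_of_one_le_of_one_le hR hℓ1
  have hYN : (N₁ : ℝ) / U ≤ Y := by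
    rw [hY]; gcongr; exact le_mul_of_one_le_left hN₁r.le hRl
  have hinvH : 1 / (H : ℝ) ≤ 36 * Δ := by
    rw [div_le_iff₀ (by linarith)]; linarith
  have hinvδ : 1 / δ₁ ≤ R / Δ := by
    rw [div_le_div_iff₀ hδ0 hΔ0]; linarith
  have hinvΔ : 1 / Δ ≤ N₁ / U := by
    rw [div_le_div_iff₀ hΔ0 hU0]; linarith
  have hKN : (K : ℝ) ≤ N₁ / U := by rw [le_div_iff₀ hU0]; exact hKUr
  have t1 : (N₁ : ℝ) / H ≤ Y := by
    refine le_trans ?_ hYN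
    calc (N₁ : ℝ) / H = N₁ * (1 / H) := by ring
      _ ≤ N₁ * (36 * Δ) := by gcongr
      _ ≤ N₁ * (1 / U) := by
        gcongr
        rw [le_div_iff₀ hU0]
        calc 36 * Δ * U = 18 * Δ * U * 2 := by ring
          _ ≤ 18 * Δ * U * U := by gcongr
          _ = 18 * (U : ℝ) ^ 2 * Δ := by ring
          _ ≤ 1 := hup
      _ = _ := by ring
  have t2 : (K : ℝ) / H * (4 * ℓ / δ₁) ≤ 144 * Y := by
    calc (K : ℝ) / H * (4 * ℓ / δ₁) = 4 * K * ℓ * ((1 / H) * (1 / δ₁)) := by ring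
      _ ≤ 4 * K * ℓ * ((36 * Δ) * (R / Δ)) := by gcongr
      _ = 144 * R * ℓ * K := by field_simp; ring
      _ ≤ 144 * R * ℓ * (N₁ / U) := by gcongr
      _ = _ := by rw [hY]; ring
  have t3 : (N₁ : ℝ) / K ≤ Y := by
    refine le_trans ?_ hYN
    gcongr
  have t4 : 4 * ℓ / δ₁ ≤ 4 * Y := by
    calc 4 * ℓ / δ₁ = 4 * ℓ * (1 / δ₁) := by ring
      _ ≤ 4 * ℓ * (R / Δ) := by gcongr
      _ = 4 * ℓ * R * (1 / Δ) := by ring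
      _ ≤ 4 * ℓ * R * (N₁ / U) := by gcongr
      _ = _ := by rw [hY]; ring
  have t5 : 0 ≤ Y := by positivity
  calc 2 * N₁ * ℓ ^ 5 * (N₁ / H + K / H * (4 * ℓ / δ₁) + 2 * (N₁ / K) + 2 * (4 * ℓ / δ₁))
      ≤ 2 * N₁ * ℓ ^ 5 * (162 * Y) := by gcongr; linarith
    _ = 324 * (R * 1) * N₁ ^ 2 * ℓ ^ 6 / U := by rw [hY]; ring
    _ ≤ 324 * (R * R) * N₁ ^ 2 * ℓ ^ 6 / U := by gcongr
    _ = _ := by ring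

lemma norm_typeII_le (hc : 1 ≤ c) (hc3 : c ≤ 3) (hα : 0 < α) (hU : 2 ≤ U) (hN₀ : U ≤ N₀)
    (hN : N₀ ≤ N₁) (hR : 1 ≤ R) (hRN : (N₁ : ℝ) ^ (c - 1) ≤ R * (N₀ : ℝ) ^ (c - 1))
    (hlow : (U : ℝ) ≤ α * (N₁ : ℝ) ^ c) (hup : 18 * (U : ℝ) ^ 2 * (α * (N₁ : ℝ) ^ (c - 1)) ≤ 1)
    (hℓ : ℓ = 1 + Real.log N₁) :
    ‖∑ n ∈ Finset.Ioc N₀ N₁, (((vaughanCoeff U * vonMangoldtTail U) n : ℝ) : ℂ) *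
      eC (α * (n : ℝ) ^ c)‖ ≤ 36 * R * N₁ * ℓ ^ 4 / √U := by
  have hN₁ : 1 ≤ N₁ := by omega
  have hlogN : 0 ≤ Real.log N₁ := Real.log_natCast_nonneg _
  have hℓ1 : 1 ≤ ℓ := by linarith
  rw [sum_Ioc_convolution_mul _ _ (fun n => eC (α * (n : ℝ) ^ c))]
  set g : ℕ → ℂ := fun k => (vaughanCoeff U k : ℂ) *
    ∑ m ∈ Finset.Ioc (N₀ / k) (N₁ / k), (vonMangoldtTail U m : ℂ) * eC (α * ((k * m : ℕ) : ℝ) ^ c) with hg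
  set J := Nat.log 2 N₁ + 1 with hJ
  have h2J : N₁ < 2 ^ J := Nat.lt_pow_succ_log_self (by norm_num) _
  have hle : N₁ ≤ 2 ^ J * U := h2J.le.trans (Nat.le_mul_of_pos_right _ (by omega))
  have hUle : U ≤ 2 ^ J * U := Nat.le_mul_of_pos_left U (by positivity)
  have e : ∑ k ∈ Finset.Ioc 0 N₁, g k = ∑ k ∈ Finset.Ioc U (2 ^ J * U), g k := by
    rw [Finset.sum_subset (Finset.Ioc_subset_Ioc_right hle)]
    · rw [← Finset.sum_Ioc_consecutive g (Nat.zero_le U) hUle, Finset.sum_eq_zero, zero_add]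
      intro k hk
      rw [hg]
      simp only
      rw [vaughanCoeff_eq_zero (Finset.mem_Ioc.1 hk).2]
      simp
    · intro k hk hk'
      have : N₁ < k := by
        by_contra h
        push Not at h
        exact hk' (Finset.mem_Ioc.2 ⟨(Finset.mem_Ioc.1 hk).1, h⟩)
      rw [hg]
      simp only
      rw [Nat.div_eq_of_lt this, Finset.Ioc_eq_empty (by simp), Finset.sum_empty, mul_zero]
  change ‖∑ k ∈ Finset.Ioc 0 N₁, g k‖ ≤ _
  rw [e]
  refine (norm_sum_Ioc_le_of_dyadic (fun j => norm_typeII_dyadic_le hc hc3 hα hU hN₀ hN hR hRN hlow hup hℓ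
    (Nat.le_mul_of_pos_left U (by positivity))) J).trans ?_
  have h1 := natLog_two_add_one_le hN₁
  rw [← hℓ] at h1
  calc (J : ℝ) * (18 * R * N₁ * ℓ ^ 3 / √U) ≤ (2 * ℓ) * (18 * R * N₁ * ℓ ^ 3 / √U) := by gcongr
    _ = _ := by ring

/-- Bound for the exponential sum over `Λ` with phase `α n ^ c`, for small `α`. -/
theorem norm_sum_vonMangoldt_rpow_le (hc : 1 ≤ c) (hc3 : c ≤ 3) (hα : 0 < α) (hU : 2 ≤ U) (hN₀ : U ≤ N₀)
    (hN : N₀ ≤ N₁) (hR : 1 ≤ R) (hRN : (N₁ : ℝ) ^ (c - 1) ≤ R * (N₀ : ℝ) ^ (c - 1))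
    (hlow : (U : ℝ) ≤ α * (N₁ : ℝ) ^ c) (hup : 18 * (U : ℝ) ^ 2 * (α * (N₁ : ℝ) ^ (c - 1)) ≤ 1)
    (hℓ : ℓ = 1 + Real.log N₁) :
    ‖∑ n ∈ Finset.Ioc N₀ N₁, (ArithmeticFunction.vonMangoldt n : ℂ) *
      eC (α * (n : ℝ) ^ c)‖ ≤ 40 * R * N₁ * ℓ ^ 4 / √U := by
  have hN₁ : 1 ≤ N₁ := by omega
  have hlogN : 0 ≤ Real.log N₁ := Real.log_natCast_nonneg _
  have hℓ1 : 1 ≤ ℓ := by linarith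
  have hUr : (2 : ℝ) ≤ U := by exact_mod_cast hU
  have hU0 : (0 : ℝ) < U := by linarith
  have hN₁r : (0 : ℝ) < N₁ := by exact_mod_cast hN₁
  have hN₀r : (0 : ℝ) < N₀ := by exact_mod_cast (by omega : 0 < N₀)
  set Δ := α * (N₁ : ℝ) ^ (c - 1) with hΔ
  set δ₁ := α * (N₀ : ℝ) ^ (c - 1) with hδ₁
  have hΔ0 : 0 < Δ := by positivity
  have hδ0 : 0 < δ₁ := by positivity
  have hΔδ : Δ ≤ R * δ₁ := by
    rw [hΔ, hδ₁]
    calc α * (N₁ : ℝ) ^ (c - 1) ≤ α * (R * (N₀ : ℝ) ^ (c - 1)) := by gcongr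
      _ = _ := by ring
  have hlow' : (U : ℝ) ≤ Δ * N₁ := by
    rw [hΔ, mul_assoc, ← rpow_sub_one_mul_self hN₁r]; exact hlow
  have hinvδ : 1 / δ₁ ≤ R / Δ := by
    rw [div_le_div_iff₀ hδ0 hΔ0]; linarith
  have hinvΔ : 1 / Δ ≤ N₁ / U := by
    rw [div_le_div_iff₀ hΔ0 hU0]; linarith
  have key : c * Δ * (U : ℝ) ^ 2 ≤ 1 / 2 := by
    have h2 : 0 ≤ Δ * (U : ℝ) ^ 2 := by positivity
    have h3 := mul_le_mul_of_nonneg_right hc3 h2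
    linarith
  have b1 := norm_typeI_log_le (N₁ := N₁) (U := U) hc hα hδ0 le_rfl hN (by omega) (by omega) (by
    refine le_trans ?_ key
    rw [← hΔ]
    gcongr
    exact le_self_pow₀ (by linarith) two_ne_zero) hℓ
  have b2 := norm_typeI_trunc_le (N₁ := N₁) (U := U) hc hα hδ0 le_rfl hN hN₁ (by
    refine le_trans (le_of_eq ?_) key
    rw [← hΔ]
    push_cast; ring) hℓ
  have b3 := norm_typeII_le hc hc3 hα hU hN₀ hN hR hRN hlow hup hℓ
  have hdec : ∀ n ∈ Finset.Ioc N₀ N₁, (ArithmeticFunction.vonMangoldt n : ℂ) * eC (α * (n : ℝ) ^ c) =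
      (((arithTrunc moebiusReal U * ArithmeticFunction.log) n : ℝ) : ℂ) * eC (α * (n : ℝ) ^ c) -
      ((((arithTrunc moebiusReal U *
      arithTrunc ArithmeticFunction.vonMangoldt U) * (ArithmeticFunction.zeta : ArithmeticFunction ℝ)) n : ℝ) : ℂ) *
      eC (α * (n : ℝ) ^ c) + (((vaughanCoeff U * vonMangoldtTail U) n : ℝ) : ℂ) * eC (α * (n : ℝ) ^ c) := by
    intro n hn
    have h := congrArg (fun f : ArithmeticFunction ℝ => f n) (vaughan_identity U)
    rw [ArithmeticFunction.add_apply, sub_eq_add_neg, ArithmeticFunction.add_apply, ArithmeticFunction.add_apply,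
      ArithmeticFunction.neg_apply, arithTrunc_apply, if_neg (by have := (Finset.mem_Ioc.1 hn).1; omega),
      zero_add] at h
    rw [h, vonMangoldtTail]
    push_cast
    ring
  rw [Finset.sum_congr rfl hdec, Finset.sum_add_distrib, Finset.sum_sub_distrib]
  refine (norm_add_le _ _).trans ((add_le_add ((norm_sub_le _ _).trans (add_le_add b1 b2)) b3).trans ?_)
  have hs : 0 < √(U : ℝ) := Real.sqrt_pos.2 hU0
  have h1 : 1 / δ₁ ≤ R * N₁ / √U := by
    calc 1 / δ₁ ≤ R / Δ := hinvδ
      _ = R * (1 / Δ) := by ring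
      _ ≤ R * (N₁ / U) := by gcongr
      _ ≤ R * (N₁ / √U) := by
        gcongr
        exact Real.sqrt_le_iff.2 ⟨by linarith, by nlinarith⟩
      _ = _ := by ring
  have h2 : ℓ ^ 2 ≤ ℓ ^ 4 := pow_le_pow_right₀ hℓ1 (by norm_num)
  calc 2 * ℓ ^ 2 / δ₁ + 2 * ℓ ^ 2 / δ₁ + 36 * R * N₁ * ℓ ^ 4 / √U
      = 4 * ℓ ^ 2 * (1 / δ₁) + 36 * R * N₁ * ℓ ^ 4 / √U := by ring
    _ ≤ 4 * ℓ ^ 4 * (R * N₁ / √U) + 36 * R * N₁ * ℓ ^ 4 / √U := by gcongr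
    _ = _ := by ring

end TypeTwo

/-- The oscillatory integral `∫₀¹ e(β tᶜ) dt`. -/
noncomputable def oscInt (c β : ℝ) : ℂ := ∫ t in (0 : ℝ)..1, eC (β * t ^ c)

lemma continuous_eC : Continuous eC := by
  unfold eC
  fun_prop

lemma hasDerivAt_eC_rpow (c β : ℝ) {t : ℝ} (ht : 0 < t) :
    HasDerivAt (fun t : ℝ => eC (β * t ^ c))
      (((2 * π * β * c * t ^ (c - 1) : ℝ) : ℂ) * Complex.I * eC (β * t ^ c)) t := by
  have h1 : HasDerivAt (fun t : ℝ => 2 * π * (β * t ^ c)) (2 * π * (β * (c * t ^ (c - 1)))) t :=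
    ((Real.hasDerivAt_rpow_const (Or.inl ht.ne')).const_mul β).const_mul (2 * π)
  have h2 := (h1.ofReal_comp.mul_const Complex.I).cexp
  unfold eC
  refine h2.congr_deriv ?_
  push_cast
  ring

lemma continuous_eC_rpow {c : ℝ} (hc : 0 ≤ c) : Continuous (fun p : ℝ × ℝ => eC (p.1 * p.2 ^ c)) :=
  continuous_eC.comp (continuous_fst.mul (continuous_snd.rpow_const fun _ => Or.inr hc))

lemma continuous_eC_mul_rpow {c : ℝ} (hc : 0 ≤ c) (β : ℝ) : Continuous (fun t : ℝ => eC (β * t ^ c)) :=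
  (continuous_eC_rpow hc).comp (by fun_prop : Continuous fun t : ℝ => (β, t))

lemma continuous_oscInt {c : ℝ} (hc : 0 ≤ c) : Continuous (oscInt c) := by
  unfold oscInt
  exact intervalIntegral.continuous_parametric_intervalIntegral_of_continuous'
    (f := fun β t => eC (β * t ^ c)) (continuous_eC_rpow hc) 0 1

lemma oscInt_neg (c β : ℝ) : oscInt c (-β) = (starRingEnd ℂ) (oscInt c β) := by
  unfold oscInt
  rw [intervalIntegral.integral_of_le zero_le_one, intervalIntegral.integral_of_le zero_le_one, ← integral_conj]
  refine integral_congr_ae (ae_of_all _ fun t => ?_)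
  simp only
  rw [neg_mul, eC_neg]

lemma norm_oscInt_le_one (c β : ℝ) : ‖oscInt c β‖ ≤ 1 := by
  have := intervalIntegral.norm_integral_le_of_norm_le_const (a := 0) (b := 1) (C := 1)
    (f := fun t : ℝ => eC (β * t ^ c)) (fun t _ => (norm_eC _).le)
  simpa [oscInt] using this

lemma norm_integral_eC_rpow_le {c β δ : ℝ} (hc : 1 < c) (hβ : 0 < β) (hδ : 0 < δ) (hδ1 : δ ≤ 1) :
    ‖∫ t in δ..1, eC (β * t ^ c)‖ ≤ 2 * δ ^ (1 - c) / (2 * π * β * c) := by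
  set ω := 2 * π * β * c with hω
  have hω0 : 0 < ω := by positivity
  have hpos : ∀ t ∈ Set.uIcc δ 1, 0 < t := by
    intro t ht
    rw [Set.uIcc_of_le hδ1] at ht
    exact hδ.trans_le ht.1
  set u : ℝ → ℂ := fun t => ((t ^ (1 - c) / ω : ℝ) : ℂ) * (-Complex.I) with hu
  set u' : ℝ → ℂ := fun t => (((1 - c) * t ^ (-c) / ω : ℝ) : ℂ) * (-Complex.I) with hu'
  set v : ℝ → ℂ := fun t => eC (β * t ^ c) with hv
  set v' : ℝ → ℂ := fun t => ((ω * t ^ (c - 1) : ℝ) : ℂ) * Complex.I * eC (β * t ^ c) with hv'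
  have du : ∀ t ∈ Set.uIcc δ 1, HasDerivAt u (u' t) t := by
    intro t ht
    have h1 : HasDerivAt (fun t : ℝ => t ^ (1 - c) / ω) ((1 - c) * t ^ (1 - c - 1) / ω) t :=
      (Real.hasDerivAt_rpow_const (Or.inl (hpos t ht).ne')).div_const ω
    have h2 := h1.ofReal_comp.mul_const (-Complex.I)
    rw [show 1 - c - 1 = -c by ring] at h2
    exact h2
  have dv : ∀ t ∈ Set.uIcc δ 1, HasDerivAt v (v' t) t := fun t ht => hasDerivAt_eC_rpow c β (hpos t ht)
  have cont : ∀ s : ℝ, ContinuousOn (fun t : ℝ => t ^ s) (Set.uIcc δ 1) := fun s =>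
    continuousOn_id.rpow_const fun t ht => Or.inl (hpos t ht).ne'
  have iu' : IntervalIntegrable u' volume δ 1 := by
    refine ContinuousOn.intervalIntegrable ?_
    exact (Complex.continuous_ofReal.comp_continuousOn (((cont (-c)).const_mul (1 - c) |>.div_const ω))).mul
      continuousOn_const
  have iv' : IntervalIntegrable v' volume δ 1 := by
    refine ContinuousOn.intervalIntegrable ?_
    exact ((Complex.continuous_ofReal.comp_continuousOn ((cont (c - 1)).const_mul ω)).mul
      continuousOn_const).mul (continuous_eC_mul_rpow (by linarith) β).continuousOn
  have key := intervalIntegral.integral_mul_deriv_eq_deriv_mul du dv iu' iv'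
  have e : ∫ t in δ..1, v t = ∫ t in δ..1, u t * v' t := by
    refine intervalIntegral.integral_congr fun t ht => ?_
    have h0 : t ^ (1 - c) / ω * (ω * t ^ (c - 1)) = 1 := by
      have : t ^ (1 - c) * t ^ (c - 1) = 1 := by
        rw [← Real.rpow_add (hpos t ht)]; simp
      field_simp
      exact this
    have h1 : ((t ^ (1 - c) / ω : ℝ) : ℂ) * ((ω * t ^ (c - 1) : ℝ) : ℂ) = 1 := by
      rw [← Complex.ofReal_mul, h0, Complex.ofReal_one]
    simp only [hu, hv, hv']
    linear_combination (-(eC (β * t ^ c))) * h1 +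
      (((t ^ (1 - c) / ω : ℝ) : ℂ) * ((ω * t ^ (c - 1) : ℝ) : ℂ) * eC (β * t ^ c)) * Complex.I_sq
  change ‖∫ t in δ..1, v t‖ ≤ _
  rw [e, key]
  have nu : ∀ t, 0 < t → ‖u t‖ = t ^ (1 - c) / ω := by
    intro t ht
    simp only [hu, norm_mul, norm_neg, Complex.norm_I, mul_one, Complex.norm_real, Real.norm_eq_abs]
    exact abs_of_nonneg (by positivity)
  have nv : ∀ t, ‖v t‖ = 1 := fun t => norm_eC _
  have dint : ∫ t in δ..1, (c - 1) * t ^ (-c) / ω = δ ^ (1 - c) / ω - 1 / ω := by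
    have hd : ∀ t ∈ Set.uIcc δ 1, HasDerivAt (fun t : ℝ => -(t ^ (1 - c) / ω)) ((c - 1) * t ^ (-c) / ω) t := by
      intro t ht
      have h1 : HasDerivAt (fun t : ℝ => t ^ (1 - c) / ω) ((1 - c) * t ^ (1 - c - 1) / ω) t :=
        (Real.hasDerivAt_rpow_const (Or.inl (hpos t ht).ne')).div_const ω
      refine h1.neg.congr_deriv ?_
      rw [show 1 - c - 1 = -c by ring]
      ring
    rw [intervalIntegral.integral_eq_sub_of_hasDerivAt hd]
    · rw [Real.one_rpow]; ring
    · exact (((cont (-c)).const_mul (c - 1)).div_const ω).intervalIntegrable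
  have nint : ‖∫ t in δ..1, u' t * v t‖ ≤ δ ^ (1 - c) / ω - 1 / ω := by
    rw [← dint]
    refine intervalIntegral.norm_integral_le_of_norm_le hδ1 (ae_of_all _ fun t ht => ?_) ?_
    · have ht0 : 0 < t := hδ.trans ht.1
      rw [norm_mul, nv, mul_one]
      simp only [hu', norm_mul, norm_neg, Complex.norm_I, mul_one, Complex.norm_real, Real.norm_eq_abs]
      rw [abs_div, abs_mul, abs_of_pos hω0, abs_of_neg (by linarith : 1 - c < 0), abs_of_pos (by positivity : 0 < t ^ (-c))]
      apply le_of_eq; ring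
    · exact (((cont (-c)).const_mul (c - 1)).div_const ω).intervalIntegrable
  calc _ ≤ ‖u 1 * v 1‖ + ‖u δ * v δ‖ + ‖∫ t in δ..1, u' t * v t‖ :=
        (norm_sub_le _ _).trans (add_le_add_left (norm_sub_le _ _) _)
    _ ≤ 1 / ω + δ ^ (1 - c) / ω + (δ ^ (1 - c) / ω - 1 / ω) := by
        rw [norm_mul (u 1), norm_mul (u δ), nv, nv, nu 1 one_pos, nu δ hδ, Real.one_rpow, mul_one, mul_one]
        linarith
    _ = _ := by ring

lemma norm_oscInt_le_rpow {c β : ℝ} (hc : 1 < c) (hβ : 0 < β) : ‖oscInt c β‖ ≤ 2 * β ^ (-(1 / c)) := by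
  rcases le_total β 1 with h | h
  · refine (norm_oscInt_le_one c β).trans ?_
    have : 1 ≤ β ^ (-(1 / c)) := Real.one_le_rpow_of_pos_of_le_one_of_nonpos hβ h
      (by have : 0 < 1 / c := by positivity
          linarith)
    linarith
  · set δ := β ^ (-(1 / c)) with hδ
    have hδ0 : 0 < δ := by positivity
    have hδ1 : δ ≤ 1 := Real.rpow_le_one_of_one_le_of_nonpos h
      (by have : 0 < 1 / c := by positivity
          linarith)
    have hδc : δ ^ (1 - c) = δ * β := by
      rw [hδ, ← Real.rpow_mul hβ.le, show -(1 / c) * (1 - c) = -(1 / c) + 1 by field_simp; ring,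
        Real.rpow_add hβ, Real.rpow_one]
    have h1 := norm_integral_eC_rpow_le hc hβ hδ0 hδ1
    have h2 : ‖∫ t in (0 : ℝ)..δ, eC (β * t ^ c)‖ ≤ δ := by
      have := intervalIntegral.norm_integral_le_of_norm_le_const (a := 0) (b := δ) (C := 1)
        (f := fun t : ℝ => eC (β * t ^ c)) (fun t _ => (norm_eC _).le)
      rwa [sub_zero, abs_of_pos hδ0, one_mul] at this
    have hi : ∀ a b : ℝ, IntervalIntegrable (fun t : ℝ => eC (β * t ^ c)) volume a b := fun a b =>
      (continuous_eC_mul_rpow (by linarith) β).intervalIntegrable a b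
    unfold oscInt
    rw [← intervalIntegral.integral_add_adjacent_intervals (hi 0 δ) (hi δ 1)]
    refine (norm_add_le _ _).trans ?_
    have h3 : 2 * δ ^ (1 - c) / (2 * π * β * c) ≤ δ := by
      rw [hδc, div_le_iff₀ (by positivity)]
      have h4 : 1 ≤ π * c := by nlinarith [Real.pi_gt_three]
      have h5 : 0 ≤ δ * β := by positivity
      nlinarith
    linarith

lemma norm_oscInt_le {c : ℝ} (hc : 1 < c) (β : ℝ) : ‖oscInt c β‖ ≤ 4 * (1 + |β|) ^ (-(1 / c)) := by
  have hs : 0 < 1 / c := by positivity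
  have hs1 : 1 / c ≤ 1 := by rw [div_le_one (by linarith)]; exact hc.le
  have habs : ‖oscInt c β‖ = ‖oscInt c |β|‖ := by
    rcases le_total 0 β with h | h
    · rw [abs_of_nonneg h]
    · rw [abs_of_nonpos h, oscInt_neg, RCLike.norm_conj]
  have h2 : (1 / 2 : ℝ) ≤ 2 ^ (-(1 / c)) := by
    calc (1 / 2 : ℝ) = 2 ^ (-1 : ℝ) := by rw [Real.rpow_neg_one]; norm_num
      _ ≤ _ := Real.rpow_le_rpow_of_exponent_le (by norm_num) (by linarith)
  have h0 : 0 ≤ |β| := abs_nonneg _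
  rcases le_total |β| 1 with h | h
  · have h3 : (2 : ℝ) ^ (-(1 / c)) ≤ (1 + |β|) ^ (-(1 / c)) :=
      Real.rpow_le_rpow_of_nonpos (by linarith) (by linarith) (by linarith)
    linarith [norm_oscInt_le_one c β]
  · have h3 : (2 * |β|) ^ (-(1 / c)) ≤ (1 + |β|) ^ (-(1 / c)) :=
      Real.rpow_le_rpow_of_nonpos (by linarith) (by linarith) (by linarith)
    rw [Real.mul_rpow (by norm_num) h0] at h3
    have h4 := norm_oscInt_le_rpow hc (show 0 < |β| by linarith)
    rw [habs]
    have h5 : 0 ≤ |β| ^ (-(1 / c)) := by positivity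
    have h6 := mul_le_mul_of_nonneg_right h2 h5
    linarith

lemma integral_eC_rpow_eq_oscInt {c P : ℝ} (hP : 0 < P) (α : ℝ) :
    ∫ t in (0 : ℝ)..P, eC (α * t ^ c) = (P : ℂ) * oscInt c (α * P ^ c) := by
  have h := intervalIntegral.integral_comp_mul_left (a := 0) (b := 1) (fun t : ℝ => eC (α * t ^ c)) hP.ne'
  rw [mul_zero, mul_one] at h
  have e : oscInt c (α * P ^ c) = ∫ t in (0 : ℝ)..1, eC (α * (P * t) ^ c) := by
    unfold oscInt
    refine intervalIntegral.integral_congr fun t ht => ?_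
    rw [Set.uIcc_of_le zero_le_one] at ht
    rw [Real.mul_rpow hP.le ht.1]
    ring_nf
  rw [e, h, Complex.real_smul, ← mul_assoc, ← Complex.ofReal_mul, mul_inv_cancel₀ hP.ne', Complex.ofReal_one, one_mul]

lemma norm_oscInt_pow_le {c : ℝ} (hc : 1 < c) (k : ℕ) (β : ℝ) :
    ‖oscInt c β ^ k‖ ≤ 4 ^ k * (1 + ‖β‖) ^ (-(k / c)) := by
  rw [norm_pow]
  calc _ ≤ (4 * (1 + |β|) ^ (-(1 / c))) ^ k := pow_le_pow_left₀ (norm_nonneg _) (norm_oscInt_le hc β) k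
    _ = _ := by
      rw [mul_pow, ← Real.rpow_natCast ((1 + |β|) ^ (-(1 / c))), ← Real.rpow_mul (by positivity), Real.norm_eq_abs]
      congr 2
      ring

lemma integrable_oscInt_pow {c : ℝ} (hc : 1 < c) {k : ℕ} (hk : c < k) :
    Integrable (fun β => oscInt c β ^ k) := by
  have h1 : Integrable (fun β : ℝ => 4 ^ k * (1 + ‖β‖) ^ (-((k : ℝ) / c))) := by
    refine (integrable_one_add_norm ?_).const_mul _
    rw [Module.finrank_self, Nat.cast_one, one_lt_div (by linarith)]
    exact hk
  exact h1.mono' ((continuous_oscInt (by linarith)).pow k).aestronglyMeasurable (ae_of_all _ (norm_oscInt_pow_le hc k))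

/-- The tail of the singular integral decays like a power. -/
lemma exists_norm_integral_oscInt_sub_le {c : ℝ} (hc : 1 < c) {k : ℕ} {η : ℝ} (hη : 0 ≤ η) (hk : c * (1 + η) < k)
    (y : ℝ) : ∃ C > 0, ∀ T : ℝ, 0 < T →
    ‖(∫ β in (-T)..T, oscInt c β ^ k * eC (y * β)) - ∫ β, oscInt c β ^ k * eC (y * β)‖ ≤ C * T ^ (-η) := by
  have hc0 : 0 < c := by linarith
  have hr : 1 < (k : ℝ) / c - η := by
    rw [lt_sub_iff_add_lt, lt_div_iff₀ hc0]; linarith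
  have hintg : Integrable (fun β : ℝ => (1 + ‖β‖) ^ (-((k : ℝ) / c - η))) := by
    refine integrable_one_add_norm ?_
    rw [Module.finrank_self, Nat.cast_one]; exact hr
  set A := ∫ β : ℝ, (1 + ‖β‖) ^ (-((k : ℝ) / c - η)) with hA
  have hA0 : 0 ≤ A := integral_nonneg fun β => by positivity
  refine ⟨4 ^ k * A + 1, by positivity, fun T hT => ?_⟩
  have hF : Integrable (fun β => oscInt c β ^ k * eC (y * β)) := by
    refine (integrable_oscInt_pow hc (k := k) (by nlinarith)).mul_bdd (c := 1) ?_ (ae_of_all _ fun β => (norm_eC _).le)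
    exact (continuous_eC.comp (by fun_prop)).aestronglyMeasurable
  have e : (∫ β in (-T)..T, oscInt c β ^ k * eC (y * β)) - ∫ β, oscInt c β ^ k * eC (y * β) =
      -∫ β in (Set.Ioc (-T) T)ᶜ, oscInt c β ^ k * eC (y * β) := by
    rw [intervalIntegral.integral_of_le (by linarith), ← integral_add_compl measurableSet_Ioc hF]
    ring
  rw [e, norm_neg]
  have hb : ∀ β ∈ (Set.Ioc (-T) T)ᶜ, ‖oscInt c β ^ k * eC (y * β)‖ ≤
      4 ^ k * T ^ (-η) * (1 + ‖β‖) ^ (-((k : ℝ) / c - η)) := by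
    intro β hβ
    have hT' : T ≤ 1 + ‖β‖ := by
      rw [Set.mem_compl_iff, Set.mem_Ioc, not_and_or, not_lt, not_le] at hβ
      rw [Real.norm_eq_abs]
      rcases hβ with h | h
      · linarith [neg_le_abs β]
      · linarith [le_abs_self β]
    rw [norm_mul, norm_eC, mul_one]
    refine (norm_oscInt_pow_le hc k β).trans ?_
    have h1 : (1 + ‖β‖) ^ (-((k : ℝ) / c)) = (1 + ‖β‖) ^ (-η) * (1 + ‖β‖) ^ (-((k : ℝ) / c - η)) := by
      rw [← Real.rpow_add (by positivity)]; ring_nf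
    have h2 : (1 + ‖β‖) ^ (-η) ≤ T ^ (-η) := Real.rpow_le_rpow_of_nonpos hT hT' (by linarith)
    rw [h1]
    calc _ ≤ 4 ^ k * (T ^ (-η) * (1 + ‖β‖) ^ (-((k : ℝ) / c - η))) := by gcongr
      _ = _ := by ring
  calc _ ≤ ∫ β in (Set.Ioc (-T) T)ᶜ, 4 ^ k * T ^ (-η) * (1 + ‖β‖) ^ (-((k : ℝ) / c - η)) := by
        refine norm_integral_le_of_norm_le (hintg.const_mul _).integrableOn ?_
        exact (ae_restrict_mem measurableSet_Ioc.compl).mono hb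
    _ ≤ ∫ β, 4 ^ k * T ^ (-η) * (1 + ‖β‖) ^ (-((k : ℝ) / c - η)) :=
        setIntegral_le_integral (hintg.const_mul _) (ae_of_all _ fun β => by positivity)
    _ = 4 ^ k * T ^ (-η) * A := by rw [integral_const_mul]
    _ ≤ _ := by
      have : 0 < T ^ (-η) := by positivity
      nlinarith

/-- `f` is supported on the positive half-line and equals `u ^ (a - 1) / Γ(a)` on `(0, 1)`. -/
structure IsGammaKernel (a : ℝ) (f : ℝ → ENNReal) : Prop where
  measurable : Measurable f
  eq_zero : ∀ u ≤ 0, f u = 0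
  eq_rpow : ∀ u, 0 < u → u < 1 → f u = ENNReal.ofReal (u ^ (a - 1) / Real.Gamma a)

lemma lintegral_eq_mul_lintegral_comp_mul {F : ℝ → ENNReal} (hF : Measurable F) {x : ℝ} (hx : 0 < x) :
    ∫⁻ y, F y = ENNReal.ofReal x * ∫⁻ z, F (x * z) := by
  have h1 : ∫⁻ z, F (x * z) = ENNReal.ofReal |x⁻¹| * ∫⁻ y, F y := by
    rw [← lintegral_map hF (measurable_const_mul x), Real.map_volume_mul_left hx.ne', lintegral_smul_measure,
      smul_eq_mul]
  rw [h1, ← mul_assoc, ← ENNReal.ofReal_mul hx.le, abs_of_pos (inv_pos.2 hx), mul_inv_cancel₀ hx.ne',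
    ENNReal.ofReal_one, one_mul]

lemma IsGammaKernel.lconvolution {a b : ℝ} {f g : ℝ → ENNReal} (ha : 0 < a) (hb : 0 < b)
    (hf : IsGammaKernel a f) (hg : IsGammaKernel b g) : IsGammaKernel (a + b) (lconvolution f g volume) where
  measurable := measurable_lconvolution _ hf.measurable hg.measurable
  eq_zero u hu := by
    rw [lconvolution_def, lintegral_eq_zero_iff' (by
      exact (hf.measurable.mul (hg.measurable.comp (by fun_prop))).aemeasurable)]
    refine ae_of_all _ fun y => ?_
    simp only [Pi.zero_apply]
    rcases le_or_gt y 0 with h | h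
    · rw [hf.eq_zero y h, zero_mul]
    · rw [hg.eq_zero _ (by linarith), mul_zero]
  eq_rpow x hx hx1 := by
    have hGa := Real.Gamma_pos_of_pos ha
    have hGb := Real.Gamma_pos_of_pos hb
    have hGab := Real.Gamma_pos_of_pos (add_pos ha hb)
    have hm : Measurable fun y => f y * g (-y + x) := hf.measurable.mul (hg.measurable.comp (by fun_prop))
    rw [lconvolution_def, lintegral_eq_mul_lintegral_comp_mul hm hx]
    have e : ∀ z, f (x * z) * g (-(x * z) + x) =
        ENNReal.ofReal (x ^ (a + b - 2) / Real.Gamma (a + b)) * ProbabilityTheory.betaPDF a b z := by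
      intro z
      rcases le_or_gt z 0 with h | h
      · rw [ProbabilityTheory.betaPDF_eq_zero_of_nonpos h, mul_zero, hf.eq_zero _ (by nlinarith), zero_mul]
      rcases le_or_gt 1 z with h1 | h1
      · rw [ProbabilityTheory.betaPDF_eq_zero_of_one_le h1, mul_zero, hg.eq_zero _ (by nlinarith), mul_zero]
      have hz1 : 0 < 1 - z := by linarith
      rw [ProbabilityTheory.betaPDF_of_pos_lt_one h h1, show -(x * z) + x = x * (1 - z) by ring,
        hf.eq_rpow _ (by positivity) (by nlinarith), hg.eq_rpow _ (by positivity) (by nlinarith),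
        ← ENNReal.ofReal_mul (by positivity), ← ENNReal.ofReal_mul (by positivity)]
      congr 1
      rw [ProbabilityTheory.beta, Real.mul_rpow hx.le h.le, Real.mul_rpow hx.le hz1.le,
        show a + b - 2 = (a - 1) + (b - 1) by ring, Real.rpow_add hx]
      field_simp
    simp_rw [e]
    rw [lintegral_const_mul' _ _ ENNReal.ofReal_ne_top, ProbabilityTheory.lintegral_betaPDF_eq_one ha hb, mul_one,
      ← ENNReal.ofReal_mul hx.le]
    congr 1
    rw [show a + b - 1 = (a + b - 2) + 1 by ring, Real.rpow_add_one hx.ne']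
    ring

/-- The density `u ^ (a - 1) / Γ(a)` on `(0, 1)`. -/
noncomputable def truncGammaKernel (a : ℝ) (u : ℝ) : ENNReal :=
  if 0 < u ∧ u < 1 then ENNReal.ofReal (u ^ (a - 1) / Real.Gamma a) else 0

lemma isGammaKernel_truncGammaKernel (a : ℝ) : IsGammaKernel a (truncGammaKernel a) where
  measurable := by
    unfold truncGammaKernel
    exact Measurable.ite measurableSet_Ioo (by fun_prop) measurable_const
  eq_zero u hu := if_neg fun h => by linarith [h.1]
  eq_rpow u h0 h1 := if_pos ⟨h0, h1⟩

lemma lintegral_truncGammaKernel_ne_top {a : ℝ} (ha : 0 < a) : ∫⁻ u, truncGammaKernel a u ≠ ⊤ := by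
  have hGa := Real.Gamma_pos_of_pos ha
  have hB := ProbabilityTheory.beta_pos ha one_pos
  have e : ∀ u, truncGammaKernel a u =
      ENNReal.ofReal (ProbabilityTheory.beta a 1 / Real.Gamma a) * ProbabilityTheory.betaPDF a 1 u := by
    intro u
    rw [truncGammaKernel, ProbabilityTheory.betaPDF_eq]
    split_ifs with h
    · rw [← ENNReal.ofReal_mul (by positivity)]
      congr 1
      rw [sub_self, Real.rpow_zero]
      field_simp
    · simp
  simp_rw [e]
  rw [lintegral_const_mul' _ _ ENNReal.ofReal_ne_top, ProbabilityTheory.lintegral_betaPDF_eq_one ha one_pos, mul_one]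
  exact ENNReal.ofReal_ne_top

instance isFiniteMeasure_truncGammaKernel {a : ℝ} [ha : Fact (0 < a)] :
    IsFiniteMeasure (volume.withDensity (truncGammaKernel a)) :=
  isFiniteMeasure_withDensity (lintegral_truncGammaKernel_ne_top ha.out)

lemma charFun_truncGammaKernel {c : ℝ} (hc : 0 < c) (β : ℝ) :
    charFun (volume.withDensity (truncGammaKernel (1 / c))) (2 * π * β) =
      oscInt c β / (Real.Gamma (1 + 1 / c) : ℂ) := by
  have ha : 0 < 1 / c := by positivity
  have hGa := Real.Gamma_pos_of_pos ha
  have hG1 : Real.Gamma (1 + 1 / c) = 1 / c * Real.Gamma (1 / c) := by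
    rw [add_comm, Real.Gamma_add_one ha.ne']
  rw [charFun_apply_real, integral_withDensity_eq_integral_toReal_smul (isGammaKernel_truncGammaKernel _).measurable
    (ae_of_all _ fun u => by unfold truncGammaKernel; split_ifs <;> simp)]
  have e1 : oscInt c β = ∫ y in Set.Ioi (0 : ℝ), (if y < 1 then eC (β * y ^ c) else 0) := by
    rw [oscInt, intervalIntegral.integral_of_le zero_le_one, integral_Ioc_eq_integral_Ioo]
    rw [← integral_indicator measurableSet_Ioo, ← integral_indicator measurableSet_Ioi]
    refine integral_congr_ae (ae_of_all _ fun y => ?_)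
    simp only [Set.indicator_apply, Set.mem_Ioo, Set.mem_Ioi]
    split_ifs <;> tauto
  rw [e1, ← integral_comp_rpow_Ioi _ ha.ne', div_eq_inv_mul (∫ _ in _, _) (Real.Gamma (1 + 1 / c) : ℂ), ← integral_const_mul, ← integral_indicator measurableSet_Ioi]
  refine integral_congr_ae (ae_of_all _ fun u => ?_)
  simp only [Set.indicator_apply, Set.mem_Ioi, truncGammaKernel]
  by_cases h0 : 0 < u
  · have h1 : u ^ (1 / c) < 1 ↔ u < 1 := by
      rw [Real.rpow_lt_one_iff_of_pos h0]
      constructor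
      · rintro (h | h)
        · linarith [h.2]
        · exact h.1
      · intro h; exact Or.inr ⟨h, ha⟩
    have h2 : (u ^ (1 / c)) ^ c = u := by
      rw [← Real.rpow_mul h0.le, one_div, inv_mul_cancel₀ hc.ne', Real.rpow_one]
    rw [if_pos h0]
    simp only [h1, h2, h0, true_and]
    split_ifs with h
    · rw [ENNReal.toReal_ofReal (by positivity), eC, hG1, abs_of_pos ha, Complex.real_smul, Complex.real_smul]
      have : ((2 * π * β : ℝ) : ℂ) * (u : ℂ) * Complex.I = ((2 * π * (β * u) : ℝ) : ℂ) * Complex.I := by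
        push_cast; ring
      rw [this, ← Complex.ofReal_inv, ← mul_assoc _ _ (Complex.exp _), ← Complex.ofReal_mul]
      congr 2
      field_simp
    · simp
  · simp [h0]

lemma continuous_integral_oscInt_pow {c : ℝ} (hc : 1 < c) {k : ℕ} (hk : c < k) :
    Continuous fun x : ℝ => ∫ β, oscInt c β ^ k * eC (-x * β) := by
  refine continuous_of_dominated (bound := fun β => ‖oscInt c β ^ k‖) (fun x => ?_) (fun x => ae_of_all _ fun β => ?_)
    (integrable_oscInt_pow hc hk).norm (ae_of_all _ fun β => ?_)
  · exact (((continuous_oscInt (by linarith)).pow k).mul (continuous_eC.comp (by fun_prop))).aestronglyMeasurable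
  · rw [norm_mul, norm_eC, mul_one]
  · exact continuous_const.mul (continuous_eC.comp (by fun_prop))

/-- Fourier inversion for the five-fold convolution of the law of `tᶜ`. -/
lemma integral_oscInt_pow_five_of_lt {c : ℝ} (hc : 1 < c) (hc5 : c < 5) {x : ℝ} (hx : 0 < x) (hx1 : x < 1) :
    ∫ β, oscInt c β ^ 5 * eC (-x * β) =
      ((Real.Gamma (1 + 1 / c) ^ 5 / Real.Gamma (5 / c) * x ^ (5 / c - 1) : ℝ) : ℂ) := by
  have hc0 : 0 < c := by linarith
  have ha : 0 < 1 / c := by positivity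
  have : Fact (0 < 1 / c) := ⟨ha⟩
  have hG : 0 < Real.Gamma (1 + 1 / c) := Real.Gamma_pos_of_pos (by positivity)
  set g := truncGammaKernel (1 / c) with hg
  have kg : IsGammaKernel (1 / c) g := isGammaKernel_truncGammaKernel _
  set g2 := lconvolution g g volume with hg2
  set g3 := lconvolution g g2 volume with hg3
  set g4 := lconvolution g g3 volume with hg4
  set g5 := lconvolution g g4 volume with hg5
  have k2 : IsGammaKernel (1 / c + 1 / c) g2 := kg.lconvolution ha ha kg
  have k3 : IsGammaKernel (1 / c + (1 / c + 1 / c)) g3 := kg.lconvolution ha (by positivity) k2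
  have k4 : IsGammaKernel (1 / c + (1 / c + (1 / c + 1 / c))) g4 := kg.lconvolution ha (by positivity) k3
  have k5 : IsGammaKernel (1 / c + (1 / c + (1 / c + (1 / c + 1 / c)))) g5 := kg.lconvolution ha (by positivity) k4
  rw [show 1 / c + (1 / c + (1 / c + (1 / c + 1 / c))) = 5 / c by ring] at k5
  set ν := volume.withDensity g with hν
  have m2 : ν.conv ν = volume.withDensity g2 := MeasureTheory.conv_withDensity_eq_lconvolution kg.measurable kg.measurable
  have m3 : ν.conv (ν.conv ν) = volume.withDensity g3 := by
    rw [m2]; exact MeasureTheory.conv_withDensity_eq_lconvolution kg.measurable k2.measurable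
  have m4 : ν.conv (ν.conv (ν.conv ν)) = volume.withDensity g4 := by
    rw [m3]; exact MeasureTheory.conv_withDensity_eq_lconvolution kg.measurable k3.measurable
  have m5 : ν.conv (ν.conv (ν.conv (ν.conv ν))) = volume.withDensity g5 := by
    rw [m4]; exact MeasureTheory.conv_withDensity_eq_lconvolution kg.measurable k4.measurable
  have hfin : ∫⁻ u, g5 u ≠ ⊤ := by
    have : volume.withDensity g5 Set.univ ≠ ⊤ := by rw [← m5]; exact measure_ne_top _ _
    rwa [withDensity_apply _ MeasurableSet.univ, Measure.restrict_univ] at this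
  have hchar : ∀ β, charFun (volume.withDensity g5) (2 * π * β) =
      (oscInt c β / (Real.Gamma (1 + 1 / c) : ℂ)) ^ 5 := by
    intro β
    rw [← m5, charFun_conv, charFun_conv, charFun_conv, charFun_conv,
      charFun_truncGammaKernel hc0]
    ring
  set G : ℝ → ℂ := fun u => ((g5 u).toReal : ℂ) with hGdef
  have hGint : Integrable G := (integrable_toReal_of_lintegral_ne_top k5.measurable.aemeasurable hfin).ofReal
  have hFG : ∀ β, FourierTransform.fourier G β = (oscInt c (-β) / (Real.Gamma (1 + 1 / c) : ℂ)) ^ 5 := by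
    intro β
    rw [← hchar, charFun_apply_real, integral_withDensity_eq_integral_toReal_smul k5.measurable
      (ae_lt_top k5.measurable hfin), Real.fourier_real_eq_integral_exp_smul]
    refine integral_congr_ae (ae_of_all _ fun u => ?_)
    simp only [hGdef, smul_eq_mul, Complex.real_smul]
    rw [mul_comm]
    congr 2
    push_cast; ring
  have hFint : Integrable (FourierTransform.fourier G) := by
    have h1 : FourierTransform.fourier G = fun β => ((Real.Gamma (1 + 1 / c) : ℂ) ^ 5)⁻¹ * (oscInt c (-β)) ^ 5 := by
      funext β
      rw [hFG, div_pow, div_eq_inv_mul]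
    rw [h1]
    exact ((integrable_oscInt_pow hc (k := 5) (by exact_mod_cast hc5)).comp_neg).const_mul _
  have hloc : ∀ u, 0 < u → u < 1 → G u = ((u ^ (5 / c - 1) / Real.Gamma (5 / c) : ℝ) : ℂ) := by
    intro u h0 h1
    have : 0 < Real.Gamma (5 / c) := Real.Gamma_pos_of_pos (by positivity)
    simp only [hGdef]
    rw [k5.eq_rpow u h0 h1, ENNReal.toReal_ofReal (by positivity)]
  have hcont : ContinuousAt G x := by
    have h1 : ContinuousAt (fun u : ℝ => ((u ^ (5 / c - 1) / Real.Gamma (5 / c) : ℝ) : ℂ)) x :=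
      Complex.continuous_ofReal.continuousAt.comp
        ((Real.continuousAt_rpow_const x _ (Or.inl hx.ne')).div_const _)
    refine h1.congr ?_
    filter_upwards [Ioo_mem_nhds hx hx1] with u hu
    exact (hloc u hu.1 hu.2).symm
  have inv := hGint.fourierInv_fourier_eq hFint hcont
  rw [hloc x hx hx1, Real.fourierInv_eq'] at inv
  have e2 : ∫ β, oscInt c β ^ 5 * eC (-x * β) = (Real.Gamma (1 + 1 / c) : ℂ) ^ 5 *
      ((x ^ (5 / c - 1) / Real.Gamma (5 / c) : ℝ) : ℂ) := by
    rw [← inv, ← integral_const_mul, ← integral_neg_eq_self]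
    refine integral_congr_ae (ae_of_all _ fun β => ?_)
    have hGc : (Real.Gamma (1 + 1 / c) : ℂ) ≠ 0 := by exact_mod_cast hG.ne'
    simp only [hFG, smul_eq_mul, eC]
    have : ((2 * π * (-x * -β) : ℝ) : ℂ) * Complex.I = ((2 * π * inner ℝ β x : ℝ) : ℂ) * Complex.I := by
      congr 2
      simp only [inner, RCLike.re_to_real, star_trivial]
      ring
    rw [this]
    generalize (Real.Gamma (1 + 1 / c) : ℂ) = y at hGc ⊢
    field_simp
  rw [e2]
  push_cast
  ring

theorem integral_oscInt_pow_five {c : ℝ} (hc : 1 < c) (hc5 : c < 5) :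
    ∫ β, oscInt c β ^ 5 * eC (-1 * β) = ((Real.Gamma (1 + 1 / c) ^ 5 / Real.Gamma (5 / c) : ℝ) : ℂ) := by
  have h1 : Filter.Tendsto (fun x : ℝ => ∫ β, oscInt c β ^ 5 * eC (-x * β)) (nhdsWithin 1 (Set.Iio 1))
      (nhds (∫ β, oscInt c β ^ 5 * eC (-1 * β))) :=
    ((continuous_integral_oscInt_pow hc (k := 5) (by exact_mod_cast hc5)).tendsto 1).mono_left nhdsWithin_le_nhds
  have h2 : Filter.Tendsto (fun x : ℝ => ((Real.Gamma (1 + 1 / c) ^ 5 / Real.Gamma (5 / c) * x ^ (5 / c - 1) : ℝ) : ℂ))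
      (nhdsWithin 1 (Set.Iio 1)) (nhds ((Real.Gamma (1 + 1 / c) ^ 5 / Real.Gamma (5 / c) * 1 ^ (5 / c - 1) : ℝ) : ℂ)) := by
    refine (Filter.Tendsto.mono_left ?_ nhdsWithin_le_nhds)
    exact (Complex.continuous_ofReal.tendsto _).comp
      ((Real.continuousAt_rpow_const 1 _ (Or.inl one_ne_zero)).tendsto.const_mul _)
  rw [Real.one_rpow, mul_one] at h2
  refine tendsto_nhds_unique h1 (h2.congr' ?_)
  filter_upwards [Ioo_mem_nhdsLT (zero_lt_one' ℝ)] with x hx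
  exact (integral_oscInt_pow_five_of_lt hc hc5 hx.1 hx.2).symm

lemma norm_eC_sub_le (x y : ℝ) : ‖eC x - eC y‖ ≤ 2 * π * |x - y| := by
  have h1 : eC x - eC y = eC y * (eC (x - y) - 1) := by
    rw [mul_sub, ← eC_add, mul_one]; congr 2; ring
  rw [h1, norm_mul, norm_eC, one_mul]
  have := Real.norm_exp_I_mul_ofReal_sub_one_le (x := 2 * π * (x - y))
  rw [eC, mul_comm]
  refine this.trans_eq ?_
  rw [Real.norm_eq_abs, abs_mul, abs_of_pos (by positivity)]

/-- The smooth analogue of `SS`: the sum of `(log p) e(α p^c)` over primes `p ≤ P`. -/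
noncomputable def primeSum (c P α : ℝ) : ℂ :=
  ∑ p ∈ (Finset.range (⌊P⌋₊ + 1)).filter Nat.Prime, (Real.log p : ℂ) * eC (α * (p : ℝ) ^ c)

lemma theta_eq_sum_filter_range (P : ℝ) :
    Chebyshev.theta P = ∑ p ∈ (Finset.range (⌊P⌋₊ + 1)).filter Nat.Prime, Real.log p := by
  rw [Chebyshev.theta_eq_sum_Icc]
  refine Finset.sum_congr ?_ fun _ _ => rfl
  ext p
  simp only [Finset.mem_filter, Finset.mem_Icc, Finset.mem_range]
  constructor
  · rintro ⟨⟨_, h⟩, hp⟩; exact ⟨by omega, hp⟩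
  · rintro ⟨h, hp⟩; exact ⟨⟨by omega, by omega⟩, hp⟩

lemma norm_SS_sub_primeSum_le (c P α : ℝ) :
    ‖SS c P α - primeSum c P α‖ ≤ 2 * π * |α| * Chebyshev.theta P := by
  rw [SS, primeSum, ← Finset.sum_sub_distrib, theta_eq_sum_filter_range, Finset.mul_sum]
  refine norm_sum_le_of_le _ fun p _ => ?_
  rw [← mul_sub, norm_mul, Complex.norm_real, Real.norm_of_nonneg (Real.log_natCast_nonneg p)]
  have h1 := norm_eC_sub_le ((⌊(p : ℝ) ^ c⌋ : ℝ) * α) (α * (p : ℝ) ^ c)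
  have h2 : |(⌊(p : ℝ) ^ c⌋ : ℝ) * α - α * (p : ℝ) ^ c| ≤ |α| := by
    rw [mul_comm, ← mul_sub, abs_mul, abs_sub_comm]
    refine mul_le_of_le_one_right (abs_nonneg _) ?_
    rw [Int.self_sub_floor, abs_of_nonneg (Int.fract_nonneg _)]
    exact (Int.fract_lt_one _).le
  calc _ ≤ Real.log p * (2 * π * |α|) := by
        gcongr
        exact h1.trans (by gcongr)
    _ = _ := by ring

lemma hasDerivAt_eC_rpow_of_one_le {c : ℝ} (hc : 1 ≤ c) (β t : ℝ) :
    HasDerivAt (fun t : ℝ => eC (β * t ^ c))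
      (((2 * π * β * c * t ^ (c - 1) : ℝ) : ℂ) * Complex.I * eC (β * t ^ c)) t := by
  have h1 : HasDerivAt (fun t : ℝ => 2 * π * (β * t ^ c)) (2 * π * (β * (c * t ^ (c - 1)))) t :=
    ((Real.hasDerivAt_rpow_const (Or.inr hc)).const_mul β).const_mul (2 * π)
  have h2 := (h1.ofReal_comp.mul_const Complex.I).cexp
  refine h2.congr_deriv ?_
  simp only [eC]
  push_cast
  ring

/-- Partial summation of the prime exponential sum against `θ(t) - t`. -/
lemma norm_primeSum_sub_integral_le {c P M : ℝ} (hc : 1 < c) (hP : 0 < P)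
    (hM : ∀ t, 0 < t → t ≤ P → |Chebyshev.theta t - t| ≤ M) (α : ℝ) :
    ‖primeSum c P α - ∫ t in (0 : ℝ)..P, eC (α * t ^ c)‖ ≤ (1 + 2 * π * |α| * P ^ c) * M := by
  set f : ℝ → ℂ := fun t => eC (α * t ^ c) with hf
  set f' : ℝ → ℂ := fun t => ((2 * π * α * c * t ^ (c - 1) : ℝ) : ℂ) * Complex.I * eC (α * t ^ c) with hf'
  have hder : ∀ t, HasDerivAt f (f' t) t := hasDerivAt_eC_rpow_of_one_le hc.le α
  have hderiv : deriv f = f' := funext fun t => (hder t).deriv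
  have hcont' : Continuous f' :=
    ((Complex.continuous_ofReal.comp (continuous_const.mul (continuous_id.rpow_const fun _ => Or.inr
      (by linarith : (0 : ℝ) ≤ c - 1)))).mul continuous_const).mul (continuous_eC_mul_rpow (by linarith) α)
  set a : ℕ → ℂ := fun k => if k.Prime then (Real.log k : ℂ) else 0 with ha
  have hθ : ∀ t : ℝ, ∑ k ∈ Finset.Icc 0 ⌊t⌋₊, a k = ((Chebyshev.theta t : ℝ) : ℂ) := by
    intro t
    rw [Chebyshev.theta_eq_sum_Icc, ha, ← Finset.sum_filter, Complex.ofReal_sum]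
  have hA := sum_mul_eq_sub_integral_mul (f := f) a hP.le (fun t _ => (hder t).differentiableAt)
    (by rw [hderiv]; exact hcont'.integrableOn_Icc)
  simp only [hθ, hderiv] at hA
  have hsum : primeSum c P α = ∑ k ∈ Finset.Icc 0 ⌊P⌋₊, f k * a k := by
    rw [primeSum, Finset.sum_filter]
    refine Finset.sum_congr (by ext; simp only [Finset.mem_range, Finset.mem_Icc]; omega) fun k _ => ?_
    simp only [ha, hf]
    split_ifs
    · rw [mul_comm]
    · rw [mul_zero]
  have hintg : ∫ t in (0 : ℝ)..P, f t = f P * P - ∫ t in Set.Ioc 0 P, f' t * (t : ℂ) := by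
    have h := intervalIntegral.integral_mul_deriv_eq_deriv_mul (a := 0) (b := P) (u := f) (u' := f')
      (v := fun t : ℝ => (t : ℂ)) (v' := fun _ => (1 : ℂ)) (fun t _ => hder t)
      (fun t _ => (hasDerivAt_id t).ofReal_comp) (hcont'.intervalIntegrable _ _)
      (continuous_const.intervalIntegrable _ _)
    rw [intervalIntegral.integral_of_le hP.le, intervalIntegral.integral_of_le hP.le] at h
    rw [intervalIntegral.integral_of_le hP.le]
    simpa using h
  have hmeas : IntegrableOn (fun t => f' t * ((Chebyshev.theta t : ℝ) : ℂ)) (Set.Ioc 0 P) := by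
    have h1 : IntegrableOn (fun t => ((Chebyshev.theta t : ℝ) : ℂ)) (Set.Ioc 0 P) :=
      ((Chebyshev.theta_mono.monotoneOn _).integrableOn_isCompact isCompact_Icc).mono_set Set.Ioc_subset_Icc_self
        |>.ofReal
    exact h1.continuousOn_mul_of_subset hcont'.continuousOn isCompact_Icc measurableSet_Ioc Set.Ioc_subset_Icc_self
  have hmeas2 : IntegrableOn (fun t : ℝ => f' t * (t : ℂ)) (Set.Ioc 0 P) :=
    ((hcont'.mul Complex.continuous_ofReal).integrableOn_Icc).mono_set Set.Ioc_subset_Icc_self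
  have hM0 : 0 ≤ M := (abs_nonneg _).trans (hM P hP le_rfl)
  have hbd : ‖∫ t in Set.Ioc 0 P, f' t * (((Chebyshev.theta t - t : ℝ)) : ℂ)‖ ≤
      2 * π * |α| * P ^ c * M := by
    rw [← intervalIntegral.integral_of_le hP.le]
    have h1 : ∀ t ∈ Set.Ioc 0 P, ‖f' t * (((Chebyshev.theta t - t : ℝ)) : ℂ)‖ ≤
        2 * π * |α| * M * (c * t ^ (c - 1)) := by
      intro t ht
      have ht0 : 0 < t := ht.1
      rw [norm_mul, hf', norm_mul, norm_mul, norm_eC, Complex.norm_I, Complex.norm_real, Complex.norm_real,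
        Real.norm_eq_abs, Real.norm_eq_abs, mul_one, mul_one]
      have e1 : |2 * π * α * c * t ^ (c - 1)| = 2 * π * |α| * (c * t ^ (c - 1)) := by
        have : 0 ≤ c * t ^ (c - 1) := by positivity
        rw [mul_assoc (2 * π * α), abs_mul, abs_mul, abs_of_pos (by positivity : 0 < 2 * π), abs_of_nonneg this]
      rw [e1]
      calc _ ≤ 2 * π * |α| * (c * t ^ (c - 1)) * M := by gcongr; exact hM t ht0 ht.2
        _ = _ := by ring
    have h2 : Continuous fun t : ℝ => c * t ^ (c - 1) :=
      continuous_const.mul (continuous_id.rpow_const fun _ => Or.inr (by linarith : (0 : ℝ) ≤ c - 1))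
    have h3 : ∫ t in (0 : ℝ)..P, c * t ^ (c - 1) = P ^ c := by
      rw [intervalIntegral.integral_eq_sub_of_hasDerivAt (f := fun t => t ^ c)
        (fun t _ => Real.hasDerivAt_rpow_const (Or.inr hc.le)) (h2.intervalIntegrable _ _),
        Real.zero_rpow (by linarith), sub_zero]
    calc _ ≤ ∫ t in (0 : ℝ)..P, 2 * π * |α| * M * (c * t ^ (c - 1)) :=
          intervalIntegral.norm_integral_le_of_norm_le hP.le (ae_of_all _ h1)
            ((h2.const_mul _).intervalIntegrable _ _)
      _ = _ := by rw [intervalIntegral.integral_const_mul, h3]; ring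
  have key : primeSum c P α - ∫ t in (0 : ℝ)..P, f t = f P * (((Chebyshev.theta P - P : ℝ)) : ℂ) -
      ∫ t in Set.Ioc 0 P, f' t * (((Chebyshev.theta t - t : ℝ)) : ℂ) := by
    have e : ∫ t in Set.Ioc 0 P, f' t * (((Chebyshev.theta t - t : ℝ)) : ℂ) =
        (∫ t in Set.Ioc 0 P, f' t * ((Chebyshev.theta t : ℝ) : ℂ)) - ∫ t in Set.Ioc 0 P, f' t * (t : ℂ) := by
      rw [← integral_sub hmeas hmeas2]
      refine integral_congr_ae (ae_of_all _ fun t => ?_)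
      simp only
      push_cast; ring
    rw [e, hsum, hA, hintg]
    push_cast; ring
  rw [key]
  calc _ ≤ ‖f P * (((Chebyshev.theta P - P : ℝ)) : ℂ)‖ + _ := norm_sub_le _ _
    _ ≤ M + 2 * π * |α| * P ^ c * M := by
        refine add_le_add ?_ hbd
        rw [norm_mul, hf, norm_eC, one_mul, Complex.norm_real]
        exact hM P hP le_rfl
    _ = _ := by ring

lemma norm_primeSum_sub_sum_vonMangoldt_le (c P α : ℝ) :
    ‖primeSum c P α - ∑ n ∈ Finset.Ioc 0 ⌊P⌋₊, (ArithmeticFunction.vonMangoldt n : ℂ) * eC (α * (n : ℝ) ^ c)‖ ≤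
      Chebyshev.psi P - Chebyshev.theta P := by
  have h1 : primeSum c P α = ∑ n ∈ (Finset.Ioc 0 ⌊P⌋₊).filter Nat.Prime,
      (ArithmeticFunction.vonMangoldt n : ℂ) * eC (α * (n : ℝ) ^ c) := by
    rw [primeSum]
    refine Finset.sum_congr ?_ fun p hp => ?_
    · ext p
      simp only [Finset.mem_filter, Finset.mem_Ioc, Finset.mem_range]
      constructor
      · rintro ⟨h, hp⟩; exact ⟨⟨hp.pos, by omega⟩, hp⟩
      · rintro ⟨h, hp⟩; exact ⟨by omega, hp⟩
    · rw [ArithmeticFunction.vonMangoldt_apply_prime (Finset.mem_filter.1 hp).2]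
  rw [h1, ← Finset.sum_filter_add_sum_filter_not (Finset.Ioc 0 ⌊P⌋₊) Nat.Prime, ← sub_sub, sub_self, zero_sub,
    norm_neg, Chebyshev.psi_sub_theta_eq_sum_not_prime]
  refine norm_sum_le_of_le _ fun n _ => ?_
  rw [norm_mul, norm_eC, mul_one, Complex.norm_real, Real.norm_of_nonneg ArithmeticFunction.vonMangoldt_nonneg]

lemma norm_sum_vonMangoldt_Ioc_le {c P α : ℝ} (N : ℕ) (hN : (N : ℝ) ≤ P) :
    ‖∑ n ∈ Finset.Ioc 0 N, (ArithmeticFunction.vonMangoldt n : ℂ) * eC (α * (n : ℝ) ^ c)‖ ≤ 6 * P := by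
  have h1 : ‖∑ n ∈ Finset.Ioc 0 N, (ArithmeticFunction.vonMangoldt n : ℂ) * eC (α * (n : ℝ) ^ c)‖ ≤
      Chebyshev.psi N := by
    rw [Chebyshev.psi, Nat.floor_natCast]
    refine norm_sum_le_of_le _ fun n _ => ?_
    rw [norm_mul, norm_eC, mul_one, Complex.norm_real, Real.norm_of_nonneg ArithmeticFunction.vonMangoldt_nonneg]
  have h2 := Chebyshev.psi_le_const_mul_self (x := (N : ℝ)) (by positivity)
  have h3 : Real.log 4 ≤ 2 := by
    rw [show (4 : ℝ) = 2 ^ 2 by norm_num, Real.log_pow]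
    have := Real.log_two_lt_d9
    push_cast; linarith
  have h4 : (Real.log 4 + 4) * (N : ℝ) ≤ 6 * N := by gcongr; linarith
  linarith

lemma norm_primeSum_le_of_large {c P α V L : ℝ} (hc : 1 < c) (hc3 : c ≤ 3) (hα : 0 < α) (hV : 16 ≤ V) (hL : 1 ≤ L)
    (hVL : V * L ≤ P) (hlow : V ≤ α * P ^ c) (hup : V ^ 2 * (α * P ^ (c - 1)) ≤ 1) :
    ‖primeSum c P α‖ ≤ 640 * L ^ 2 * P * (1 + Real.log P) ^ 4 / √V + 6 * (P / L) + 2 * √P * Real.log P := by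
  have hL0 : 0 < L := by linarith
  have hVP : V ≤ P / L := by rwa [le_div_iff₀ hL0]
  have hPL : P / L ≤ P := div_le_self (by nlinarith) hL
  have hP0 : 0 < P := by linarith
  have hP1 : 1 ≤ P := by linarith
  set N₀ := ⌊P / L⌋₊ with hN₀
  set N₁ := ⌊P⌋₊ with hN₁
  set U := ⌊V / 8⌋₊ with hU
  have hN₁P : (N₁ : ℝ) ≤ P := Nat.floor_le hP0.le
  have hN₁P' : P / 2 ≤ N₁ := by have := Nat.lt_floor_add_one P; linarith
  have hN₀P : (N₀ : ℝ) ≤ P / L := Nat.floor_le (by positivity)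
  have hN₀P' : P / L / 2 ≤ N₀ := by have := Nat.lt_floor_add_one (P / L); linarith
  have hUV : (U : ℝ) ≤ V / 8 := Nat.floor_le (by linarith)
  have hUV' : V / 16 ≤ U := by have := Nat.lt_floor_add_one (V / 8); linarith
  have hU2 : 2 ≤ U := Nat.le_floor (by push_cast; linarith)
  have hUN₀ : U ≤ N₀ := Nat.floor_le_floor (by linarith)
  have hN₀N₁ : N₀ ≤ N₁ := Nat.floor_le_floor hPL
  have hN₀0 : (0 : ℝ) < N₀ := by linarith
  have hN₁0 : (0 : ℝ) < N₁ := by linarith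
  have hc1 : 0 ≤ c - 1 := by linarith
  have hRN : (N₁ : ℝ) ^ (c - 1) ≤ (4 * L ^ 2) * (N₀ : ℝ) ^ (c - 1) := by
    have h1 : (N₁ : ℝ) ≤ (2 * L) * N₀ := by
      calc (N₁ : ℝ) ≤ P := hN₁P
        _ = (2 * L) * (P / L / 2) := by field_simp
        _ ≤ _ := by gcongr
    calc (N₁ : ℝ) ^ (c - 1) ≤ ((2 * L) * N₀) ^ (c - 1) := by gcongr
      _ = (2 * L) ^ (c - 1) * (N₀ : ℝ) ^ (c - 1) := Real.mul_rpow (by positivity) hN₀0.le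
      _ ≤ (2 * L) ^ (2 : ℝ) * (N₀ : ℝ) ^ (c - 1) := by
          gcongr
          · linarith
          · linarith
      _ = _ := by rw [Real.rpow_two]; ring
  have hlow' : (U : ℝ) ≤ α * (N₁ : ℝ) ^ c := by
    have h1 : P ^ c / 8 ≤ (N₁ : ℝ) ^ c := by
      calc P ^ c / 8 ≤ P ^ c / 2 ^ c := by
            gcongr
            calc (2 : ℝ) ^ c ≤ 2 ^ (3 : ℝ) := by gcongr; norm_num
              _ = 8 := by norm_num
        _ = (P / 2) ^ c := (Real.div_rpow hP0.le (by norm_num) c).symm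
        _ ≤ _ := by gcongr
    calc (U : ℝ) ≤ V / 8 := hUV
      _ ≤ α * P ^ c / 8 := by gcongr
      _ = α * (P ^ c / 8) := by ring
      _ ≤ _ := by gcongr
  have hup' : 18 * (U : ℝ) ^ 2 * (α * (N₁ : ℝ) ^ (c - 1)) ≤ 1 := by
    refine le_trans ?_ hup
    have h1 : 18 * (U : ℝ) ^ 2 ≤ V ^ 2 := by
      calc 18 * (U : ℝ) ^ 2 ≤ 18 * (V / 8) ^ 2 := by gcongr
        _ = 18 / 64 * V ^ 2 := by ring
        _ ≤ 1 * V ^ 2 := by gcongr; norm_num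
        _ = _ := one_mul _
    gcongr
  have hmain := norm_sum_vonMangoldt_rpow_le (c := c) (α := α) (R := 4 * L ^ 2) (ℓ := 1 + Real.log N₁) hc.le hc3 hα hU2
    hUN₀ hN₀N₁ (by nlinarith) hRN hlow' hup' rfl
  have hlogN : 0 ≤ Real.log N₁ := Real.log_natCast_nonneg _
  have hlog : Real.log N₁ ≤ Real.log P := Real.log_le_log hN₁0 hN₁P
  have hsqrt : √V / 4 ≤ √(U : ℝ) := by
    have : √V / 4 = √(V / 16) := by
      rw [Real.sqrt_div (by linarith), show (16 : ℝ) = 4 ^ 2 by norm_num, Real.sqrt_sq (by norm_num)]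
    rw [this]
    exact Real.sqrt_le_sqrt hUV'
  have hV0 : 0 < √V := Real.sqrt_pos.2 (by linarith)
  have hmain' : 40 * (4 * L ^ 2) * (N₁ : ℝ) * (1 + Real.log N₁) ^ 4 / √(U : ℝ) ≤
      640 * L ^ 2 * P * (1 + Real.log P) ^ 4 / √V := by
    calc _ ≤ 40 * (4 * L ^ 2) * P * (1 + Real.log P) ^ 4 / (√V / 4) := by gcongr
      _ = _ := by field_simp; ring
  have hsplit : ∑ n ∈ Finset.Ioc 0 N₁, (ArithmeticFunction.vonMangoldt n : ℂ) * eC (α * (n : ℝ) ^ c) =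
      ∑ n ∈ Finset.Ioc 0 N₀, (ArithmeticFunction.vonMangoldt n : ℂ) * eC (α * (n : ℝ) ^ c) +
      ∑ n ∈ Finset.Ioc N₀ N₁, (ArithmeticFunction.vonMangoldt n : ℂ) * eC (α * (n : ℝ) ^ c) :=
    (Finset.sum_Ioc_consecutive _ (Nat.zero_le _) hN₀N₁).symm
  have ha := norm_primeSum_sub_sum_vonMangoldt_le c P α
  have hb := norm_sum_vonMangoldt_Ioc_le (c := c) (α := α) N₀ hN₀P
  have hd := Chebyshev.psi_sub_theta_le hP1
  rw [← hN₁, hsplit] at ha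
  have htri := norm_le_norm_add_norm_sub' (primeSum c P α)
    (∑ n ∈ Finset.Ioc 0 N₀, (ArithmeticFunction.vonMangoldt n : ℂ) * eC (α * (n : ℝ) ^ c) +
      ∑ n ∈ Finset.Ioc N₀ N₁, (ArithmeticFunction.vonMangoldt n : ℂ) * eC (α * (n : ℝ) ^ c))
  have htri2 := norm_add_le (∑ n ∈ Finset.Ioc 0 N₀, (ArithmeticFunction.vonMangoldt n : ℂ) * eC (α * (n : ℝ) ^ c))
    (∑ n ∈ Finset.Ioc N₀ N₁, (ArithmeticFunction.vonMangoldt n : ℂ) * eC (α * (n : ℝ) ^ c))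
  linarith

/-- The uniform error in the prime number theorem on an initial interval. -/
lemma abs_theta_sub_le_uniform {a C P : ℝ} (ha : 0 < a) (hC : 0 < C)
    (hθ : ∀ x, 1 ≤ x → |Chebyshev.theta x - x| ≤ C * x * Real.exp (-(a * √(Real.log x)))) (hP : 1 ≤ P) {t : ℝ}
    (ht : 0 < t) (htP : t ≤ P) :
    |Chebyshev.theta t - t| ≤ √P + C * P * Real.exp (-(a / 2 * √(Real.log P))) := by
  have hP0 : 0 < P := by linarith
  have hnn : 0 ≤ C * P * Real.exp (-(a / 2 * √(Real.log P))) := by positivity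
  have hs1 : 1 ≤ √P := Real.one_le_sqrt.2 hP
  rcases le_or_gt t √P with h | h
  · have h1 : Chebyshev.theta t ≤ Real.log 4 * t := Chebyshev.theta_le_log4_mul_x ht.le
    have h2 := Chebyshev.theta_nonneg t
    have h3 : Real.log 4 ≤ 2 := by
      rw [show (4 : ℝ) = 2 ^ 2 by norm_num, Real.log_pow]
      have := Real.log_two_lt_d9
      push_cast; linarith
    have h4 : Real.log 4 * t ≤ 2 * t := by gcongr
    have : |Chebyshev.theta t - t| ≤ t := by rw [abs_le]; constructor <;> linarith
    linarith
  · have h1 : Real.log P / 2 ≤ Real.log t := by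
      rw [← Real.log_sqrt hP0.le]
      exact Real.log_le_log (by linarith) h.le
    have hlP : 0 ≤ Real.log P := Real.log_nonneg hP
    have h2 : √(Real.log P) / 2 ≤ √(Real.log t) := by
      calc √(Real.log P) / 2 = √(Real.log P / 4) := by
            rw [Real.sqrt_div hlP, show (4 : ℝ) = 2 ^ 2 by norm_num, Real.sqrt_sq (by norm_num)]
        _ ≤ _ := Real.sqrt_le_sqrt (by linarith)
    have h3 : C * t * Real.exp (-(a * √(Real.log t))) ≤ C * P * Real.exp (-(a / 2 * √(Real.log P))) := by
      have h5 : a / 2 * √(Real.log P) ≤ a * √(Real.log t) := by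
        calc a / 2 * √(Real.log P) = a * (√(Real.log P) / 2) := by ring
          _ ≤ _ := by gcongr
      exact mul_le_mul (by gcongr) (Real.exp_le_exp.2 (neg_le_neg h5)) (by positivity) (by positivity)
    have h4 := hθ t (by linarith)
    linarith

lemma eventually_pow_le_mul_pow {δ : ℝ} (hδ : 0 < δ) {m n : ℕ} (hmn : m < n) :
    ∀ᶠ w : ℝ in Filter.atTop, w ^ m ≤ δ * w ^ n := by
  have h := (Asymptotics.isLittleO_pow_pow_atTop_of_lt (𝕜 := ℝ) hmn).bound hδ
  filter_upwards [h, Filter.eventually_ge_atTop 0] with w hw hw0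
  rwa [Real.norm_of_nonneg (by positivity), Real.norm_of_nonneg (by positivity)] at hw

lemma eventually_one_add_pow_le_exp (m n : ℕ) :
    ∀ᶠ w : ℝ in Filter.atTop, (1 + w ^ m) ^ n ≤ Real.exp w := by
  have h := (isLittleO_pow_exp_atTop (n := (m + 1) * n)).bound (one_pos)
  filter_upwards [h, Filter.eventually_ge_atTop 2] with w hw hw0
  rw [Real.norm_of_nonneg (by positivity), Real.norm_of_nonneg (by positivity), one_mul] at hw
  refine le_trans ?_ hw
  rw [pow_mul]
  have : 1 ≤ w ^ m := one_le_pow₀ (by linarith)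
  have : w ^ m * 2 ≤ w ^ m * w := by gcongr
  gcongr
  rw [pow_succ]
  linarith

lemma primeSum_neg (c P α : ℝ) : primeSum c P (-α) = (starRingEnd ℂ) (primeSum c P α) := by
  rw [primeSum, primeSum, map_sum]
  refine Finset.sum_congr rfl fun p _ => ?_
  rw [map_mul, Complex.conj_ofReal, neg_mul, eC_neg]

/-- Sup-norm approximation of `SS` by its integral model on the major arc, with `P = exp(w³⁰)`. -/
lemma exists_eventually_norm_SS_sub_le {c ε : ℝ} (hc : 1 < c) (hc3 : c ≤ 3) (hε : 0 < ε) :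
    ∃ K > 0, ∀ᶠ w : ℝ in Filter.atTop, ∀ P α : ℝ, P = Real.exp (w ^ 30) → |α| ≤ P ^ (1 - c - ε) →
      ‖SS c P α - P * oscInt c (α * P ^ c)‖ ≤ K * (P * Real.exp (-w ^ 9)) := by
  obtain ⟨a, ha, C, hC, hθ⟩ := exists_abs_theta_sub_le
  have hc0 : 0 < c := by linarith
  refine ⟨14 + 8 * (1 + C) + 650, by positivity, ?_⟩
  filter_upwards [Filter.eventually_ge_atTop 4, eventually_pow_le_mul_pow (half_pos hε) (show 12 < 30 by norm_num),
    eventually_pow_le_mul_pow hε (show 9 < 30 by norm_num),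
    eventually_pow_le_mul_pow (show 0 < a / 4 by positivity) (show 12 < 15 by norm_num),
    eventually_pow_le_mul_pow (show 0 < 1 / c by positivity) (show 9 < 12 by norm_num),
    eventually_one_add_pow_le_exp 30 4, eventually_pow_le_mul_pow (show (0 : ℝ) < 1 / 8 by norm_num)
      (show 12 < 30 by norm_num), eventually_pow_le_mul_pow (show (0 : ℝ) < 1 / 8 by norm_num)
      (show 10 < 12 by norm_num)] with w hw h1 h2 h3 h4 h5 h6 h7 P α hP hα
  have hw1 : 1 ≤ w := by linarith
  have hP0 : 0 < P := by rw [hP]; positivity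
  have hlogP : Real.log P = w ^ 30 := by rw [hP, Real.log_exp]
  have hP1 : 1 ≤ P := by rw [hP]; exact Real.one_le_exp (by positivity)
  have hPpow : ∀ s : ℝ, P ^ s = Real.exp (w ^ 30 * s) := fun s => by rw [hP, Real.exp_mul]
  set E := Real.exp (-w ^ 9) with hE
  have hE0 : 0 < E := Real.exp_pos _
  have w9 : w ^ 9 ≤ w ^ 10 := pow_le_pow_right₀ hw1 (by norm_num)
  have w1 : w ≤ w ^ 10 := le_self_pow₀ hw1 (by norm_num)
  have w12 : w ^ 9 ≤ w ^ 12 := pow_le_pow_right₀ hw1 (by norm_num)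
  have w10_12 : w ^ 10 ≤ w ^ 12 := pow_le_pow_right₀ hw1 (by norm_num)
  have w12' : 16 ≤ w ^ 12 := by
    calc (16 : ℝ) = 4 ^ 2 := by norm_num
      _ ≤ w ^ 2 := by gcongr
      _ ≤ w ^ 12 := pow_le_pow_right₀ hw1 (by norm_num)
  -- the contribution of the integer parts
  have hαE : |α| ≤ E := by
    refine hα.trans ?_
    rw [hPpow, hE]
    refine Real.exp_le_exp.2 ?_
    have : 0 ≤ w ^ 30 * (c - 1) := mul_nonneg (by positivity) (by linarith)
    linarith
  have hfloor : ‖SS c P α - primeSum c P α‖ ≤ 14 * (P * E) := by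
    refine (norm_SS_sub_primeSum_le c P α).trans ?_
    have i1 : Chebyshev.theta P ≤ 2 * P := by
      refine (Chebyshev.theta_le_log4_mul_x hP0.le).trans ?_
      gcongr
      rw [show (4 : ℝ) = 2 ^ 2 by norm_num, Real.log_pow]
      have := Real.log_two_lt_d9
      push_cast; linarith
    have hpi := Real.pi_lt_d2
    calc 2 * π * |α| * Chebyshev.theta P ≤ 2 * 3.5 * E * (2 * P) := by
          gcongr
          linarith
      _ = _ := by ring
  have hmodel : ∫ t in (0 : ℝ)..P, eC (α * t ^ c) = P * oscInt c (α * P ^ c) := integral_eC_rpow_eq_oscInt hP0 α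
  have hsqrtP : √P = Real.exp (w ^ 30 / 2) := by rw [hP, ← Real.exp_half]
  have hmain : ‖primeSum c P α - P * oscInt c (α * P ^ c)‖ ≤ (8 * (1 + C) + 650) * (P * E) := by
    rcases le_or_gt (|α| * P ^ c) (Real.exp (w ^ 12)) with hs | hl
    · -- small `α`
      have hM := norm_primeSum_sub_integral_le hc hP0
        (fun t ht htP => abs_theta_sub_le_uniform ha hC hθ hP1 ht htP) α
      rw [hmodel] at hM
      refine hM.trans ?_
      have hsl : √(Real.log P) = w ^ 15 := by
        rw [hlogP, show w ^ 30 = (w ^ 15) ^ 2 by ring, Real.sqrt_sq (by positivity)]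
      rw [hsl]
      have j1 : 1 + 2 * π * |α| * P ^ c ≤ 8 * Real.exp (w ^ 12) := by
        have hpi := Real.pi_lt_d2
        have : 1 ≤ Real.exp (w ^ 12) := Real.one_le_exp (by positivity)
        have : 2 * π * (|α| * P ^ c) ≤ 7 * Real.exp (w ^ 12) := by gcongr; linarith
        linarith
      have j2 : Real.exp (w ^ 12) * √P ≤ P * E := by
        rw [hsqrtP, hP, hE, ← Real.exp_add, ← Real.exp_add]
        refine Real.exp_le_exp.2 ?_
        linarith
      have j3 : Real.exp (w ^ 12) * Real.exp (-(a / 2 * w ^ 15)) ≤ E := by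
        rw [hE, ← Real.exp_add]
        refine Real.exp_le_exp.2 ?_
        linarith
      calc _ ≤ 8 * Real.exp (w ^ 12) * (√P + C * P * Real.exp (-(a / 2 * w ^ 15))) := by gcongr
        _ = 8 * (Real.exp (w ^ 12) * √P) +
            8 * C * P * (Real.exp (w ^ 12) * Real.exp (-(a / 2 * w ^ 15))) := by ring
        _ ≤ 8 * (P * E) + 8 * C * P * E := by gcongr
        _ ≤ _ := by
          have : 0 < P * E := by positivity
          linarith
    · -- large `α`
      have hα0 : 0 < |α| := by
        rcases (abs_nonneg α).lt_or_eq with h | h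
        · exact h
        · rw [← h, zero_mul] at hl; exact absurd hl (not_lt.2 (Real.exp_pos _).le)
      have hnorm : ‖primeSum c P α‖ = ‖primeSum c P |α|‖ := by
        rcases le_total 0 α with h | h
        · rw [abs_of_nonneg h]
        · rw [abs_of_nonpos h, primeSum_neg, RCLike.norm_conj]
      have hnorm2 : ‖oscInt c (α * P ^ c)‖ = ‖oscInt c (|α| * P ^ c)‖ := by
        rcases le_total 0 α with h | h
        · rw [abs_of_nonneg h]
        · rw [abs_of_nonpos h, neg_mul, oscInt_neg, RCLike.norm_conj]
      have hL := norm_primeSum_le_of_large (c := c) (P := P) (α := |α|) (V := Real.exp (w ^ 12))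
        (L := Real.exp (w ^ 10)) hc hc3 hα0 (by have := Real.add_one_le_exp (w ^ 12); linarith)
        (Real.one_le_exp (by positivity))
        (by rw [hP, ← Real.exp_add]; exact Real.exp_le_exp.2 (by linarith)) hl.le
        (by
          have : |α| * P ^ (c - 1) ≤ P ^ (-ε) := by
            calc |α| * P ^ (c - 1) ≤ P ^ (1 - c - ε) * P ^ (c - 1) := by gcongr
              _ = _ := by rw [← Real.rpow_add hP0]; congr 1; ring
          calc _ ≤ Real.exp (w ^ 12) ^ 2 * P ^ (-ε) := by gcongr
            _ ≤ 1 := by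
              rw [hPpow, ← Real.exp_nat_mul, ← Real.exp_add]
              refine Real.exp_le_one_iff.2 ?_
              push_cast
              linarith)
      have hI : ‖(P : ℂ) * oscInt c (α * P ^ c)‖ ≤ 2 * (P * E) := by
        rw [norm_mul, hnorm2, Complex.norm_real, Real.norm_of_nonneg hP0.le]
        have i1 := norm_oscInt_le_rpow hc (β := |α| * P ^ c) (by positivity)
        have i2 : (|α| * P ^ c) ^ (-(1 / c)) ≤ E := by
          calc (|α| * P ^ c) ^ (-(1 / c)) ≤ Real.exp (w ^ 12) ^ (-(1 / c)) :=
                Real.rpow_le_rpow_of_nonpos (Real.exp_pos _) hl.le (by have : 0 < 1 / c := by positivity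
                                                                       linarith)
            _ ≤ E := by
              rw [← Real.exp_mul, hE]
              refine Real.exp_le_exp.2 ?_
              linarith
        calc _ ≤ P * (2 * E) := by gcongr; linarith
          _ = _ := by ring
      have k1 : 640 * Real.exp (w ^ 10) ^ 2 * P * (1 + Real.log P) ^ 4 / √(Real.exp (w ^ 12)) ≤ 640 * (P * E) := by
        rw [hlogP, ← Real.exp_half]
        rw [div_le_iff₀ (Real.exp_pos _)]
        have : Real.exp (w ^ 10) ^ 2 * (1 + w ^ 30) ^ 4 ≤ E * Real.exp (w ^ 12 / 2) := by
          calc _ ≤ Real.exp (w ^ 10) ^ 2 * Real.exp w := by gcongr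
            _ ≤ _ := by
              rw [← Real.exp_nat_mul, ← Real.exp_add, hE, ← Real.exp_add]
              refine Real.exp_le_exp.2 ?_
              push_cast
              linarith
        calc _ = 640 * P * (Real.exp (w ^ 10) ^ 2 * (1 + w ^ 30) ^ 4) := by ring
          _ ≤ 640 * P * (E * Real.exp (w ^ 12 / 2)) := by gcongr
          _ = _ := by ring
      have k2 : 6 * (P / Real.exp (w ^ 10)) ≤ 6 * (P * E) := by
        rw [div_eq_mul_inv, ← Real.exp_neg]
        gcongr
        exact Real.exp_le_exp.2 (by linarith)
      have k3 : 2 * √P * Real.log P ≤ 2 * (P * E) := by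
        rw [hlogP, hsqrtP]
        have i1 : w ^ 30 ≤ Real.exp w := by
          refine le_trans ?_ h5
          have : 1 ≤ 1 + w ^ 30 := by have : 0 ≤ w ^ 30 := by positivity
                                      linarith
          exact le_trans (by linarith) (le_self_pow₀ this (by norm_num))
        calc _ ≤ 2 * Real.exp (w ^ 30 / 2) * Real.exp w := by gcongr
          _ = 2 * Real.exp (w ^ 30 / 2 + w) := by rw [Real.exp_add]; ring
          _ ≤ _ := by
            rw [hP, hE, ← Real.exp_add]
            exact mul_le_mul_of_nonneg_left (Real.exp_le_exp.2 (by linarith)) (by norm_num)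
      rw [← hnorm] at hL
      have := norm_sub_le (primeSum c P α) (P * oscInt c (α * P ^ c))
      have : 0 < C * (P * E) := by positivity
      have : 0 < P * E := by positivity
      linarith
  calc _ = ‖(SS c P α - primeSum c P α) + (primeSum c P α - P * oscInt c (α * P ^ c))‖ := by
        congr 1; ring
    _ ≤ _ := norm_add_le _ _
    _ ≤ 14 * (P * E) + (8 * (1 + C) + 650) * (P * E) := add_le_add hfloor hmain
    _ = _ := by ring

lemma continuous_eC_const_mul (y : ℝ) : Continuous fun α : ℝ => eC (y * α) := continuous_eC.comp (by fun_prop)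

lemma norm_integral_eC_mul_le {y : ℝ} (hy : y ≠ 0) (τ : ℝ) :
    ‖∫ α in (-τ)..τ, eC (y * α)‖ ≤ 1 / |y| := by
  have hd : ∀ α : ℝ, HasDerivAt (fun α : ℝ => eC (y * α) / ((2 * π * y : ℝ) * Complex.I)) (eC (y * α)) α := by
    intro α
    have h1 : HasDerivAt (fun α : ℝ => 2 * π * (y * α)) (2 * π * (y * 1)) α :=
      ((hasDerivAt_id α).const_mul y).const_mul (2 * π)
    have h2 := ((h1.ofReal_comp.mul_const Complex.I).cexp).div_const ((2 * π * y : ℝ) * Complex.I)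
    refine h2.congr_deriv ?_
    have : ((2 * π * y : ℝ) : ℂ) ≠ 0 := by exact_mod_cast (mul_ne_zero (by positivity) hy)
    rw [eC, mul_one, mul_div_assoc, div_self (mul_ne_zero this Complex.I_ne_zero), mul_one]
  rw [intervalIntegral.integral_eq_sub_of_hasDerivAt (fun α _ => hd α)
    ((continuous_eC_const_mul y).intervalIntegrable _ _)]
  have hy0 : 0 < |y| := abs_pos.2 hy
  have hn : ∀ α : ℝ, ‖eC (y * α) / ((2 * π * y : ℝ) * Complex.I)‖ ≤ 1 / (2 * |y|) := by
    intro α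
    rw [norm_div, norm_eC, norm_mul, Complex.norm_I, Complex.norm_real, mul_one, Real.norm_eq_abs, abs_mul,
      abs_of_pos (by positivity : 0 < 2 * π)]
    have := Real.pi_gt_three
    gcongr
    linarith
  calc _ ≤ 1 / (2 * |y|) + 1 / (2 * |y|) := (norm_sub_le _ _).trans (add_le_add (hn _) (hn _))
    _ = _ := by field_simp; norm_num

/-- Mean square of an exponential sum with well-spaced frequencies. -/
lemma integral_norm_sq_sum_le {F : Finset ℕ} {b a : ℕ → ℝ} {ℓ δ τ : ℝ} {H : ℕ} (hτ : 0 ≤ τ) (hδ : 0 < δ)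
    (hb0 : ∀ n ∈ F, 0 ≤ b n) (hb : ∀ n ∈ F, b n ≤ ℓ) (hH : ∀ m ∈ F, ∀ n ∈ F, |(n : ℝ) - m| < H)
    (ha : ∀ m ∈ F, ∀ n ∈ F, δ * |(n : ℝ) - m| ≤ |a n - a m|) :
    ∫ α in (-τ)..τ, ‖∑ n ∈ F, (b n : ℂ) * eC (a n * α)‖ ^ 2 ≤
      ℓ ^ 2 * F.card * (2 * τ + 2 * (1 + Real.log H) / δ) := by
  have hexp : ∀ α : ℝ, ((‖∑ n ∈ F, (b n : ℂ) * eC (a n * α)‖ ^ 2 : ℝ) : ℂ) =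
      ∑ m ∈ F, ∑ n ∈ F, ((b n * b m : ℝ) : ℂ) * eC ((a n - a m) * α) := by
    intro α
    rw [Complex.ofReal_pow, ← Complex.mul_conj', map_sum, Finset.sum_mul_sum, Finset.sum_comm]
    refine Finset.sum_congr rfl fun m _ => Finset.sum_congr rfl fun n _ => ?_
    rw [map_mul, Complex.conj_ofReal, ← eC_neg, show (a n - a m) * α = a n * α + -(a m * α) by ring, eC_add]
    push_cast; ring
  have hintg : ((∫ α in (-τ)..τ, ‖∑ n ∈ F, (b n : ℂ) * eC (a n * α)‖ ^ 2 : ℝ) : ℂ) =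
      ∑ m ∈ F, ∑ n ∈ F, ((b n * b m : ℝ) : ℂ) * ∫ α in (-τ)..τ, eC ((a n - a m) * α) := by
    rw [← intervalIntegral.integral_ofReal]
    simp_rw [hexp]
    have hc1 : ∀ m n, Continuous fun α : ℝ => ((b n * b m : ℝ) : ℂ) * eC ((a n - a m) * α) :=
      fun m n => continuous_const.mul (continuous_eC_const_mul _)
    have hc2 : ∀ m, Continuous fun α : ℝ => ∑ n ∈ F, ((b n * b m : ℝ) : ℂ) * eC ((a n - a m) * α) :=
      fun m => continuous_finsetSum _ fun n _ => hc1 m n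
    rw [intervalIntegral.integral_finsetSum fun m _ => (hc2 m).intervalIntegrable _ _]
    refine Finset.sum_congr rfl fun m _ => ?_
    rw [intervalIntegral.integral_finsetSum fun n _ => (hc1 m n).intervalIntegrable _ _]
    exact Finset.sum_congr rfl fun n _ => intervalIntegral.integral_const_mul _ _
  refine (le_abs_self _).trans ?_
  rw [← Real.norm_eq_abs, ← Complex.norm_real, hintg]
  have hterm : ∀ m ∈ F, ∀ n ∈ F, ‖((b n * b m : ℝ) : ℂ) * ∫ α in (-τ)..τ, eC ((a n - a m) * α)‖ ≤
      ℓ ^ 2 * ((if n = m then 2 * τ else 0) + 1 / δ * (if n = m then 0 else 1 / |(n : ℝ) - m|)) := by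
    intro m hm n hn
    have hbb : ‖((b n * b m : ℝ) : ℂ)‖ ≤ ℓ ^ 2 := by
      rw [Complex.norm_real, Real.norm_of_nonneg (mul_nonneg (hb0 n hn) (hb0 m hm)), pow_two]
      exact mul_le_mul (hb n hn) (hb m hm) (hb0 m hm) ((hb0 n hn).trans (hb n hn))
    rw [norm_mul]
    refine mul_le_mul hbb ?_ (norm_nonneg _) (sq_nonneg _)
    split_ifs with h
    · have := intervalIntegral.norm_integral_le_of_norm_le_const (a := -τ) (b := τ) (C := 1)
        (f := fun α : ℝ => eC ((a n - a m) * α)) (fun α _ => (norm_eC _).le)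
      rw [mul_zero, add_zero]
      refine this.trans_eq ?_
      rw [one_mul, abs_of_nonneg (by linarith)]; ring
    · have hnm : 0 < |(n : ℝ) - m| := abs_pos.2 (sub_ne_zero.2 (by exact_mod_cast h))
      have h1 := ha m hm n hn
      have h2 : 0 < |a n - a m| := lt_of_lt_of_le (by positivity) h1
      rw [zero_add]
      calc _ ≤ 1 / |a n - a m| := norm_integral_eC_mul_le (abs_pos.1 h2) τ
        _ ≤ 1 / (δ * |(n : ℝ) - m|) := by gcongr
        _ = _ := by rw [one_div_mul_one_div]
  calc _ ≤ ∑ m ∈ F, ∑ n ∈ F, ℓ ^ 2 * ((if n = m then 2 * τ else 0) +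
        1 / δ * (if n = m then 0 else 1 / |(n : ℝ) - m|)) :=
        norm_sum_le_of_le _ fun m hm => norm_sum_le_of_le _ fun n hn => hterm m hm n hn
    _ ≤ ∑ m ∈ F, ℓ ^ 2 * (2 * τ + 2 * (1 + Real.log H) / δ) := by
        refine Finset.sum_le_sum fun m hm => ?_
        rw [← Finset.mul_sum, Finset.sum_add_distrib, ← Finset.mul_sum, Finset.sum_ite_eq' F m, if_pos hm]
        have := sum_one_div_abs_sub_le (F := F) (k := m) (H := H) (fun l hl => hH m hm l hl)
        gcongr
        calc _ ≤ 1 / δ * (2 * (1 + Real.log H)) := by gcongr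
          _ = _ := by ring
    _ = _ := by rw [Finset.sum_const, nsmul_eq_mul]; ring

/-- Spacing of the integer parts of `nᶜ`. -/
lemma floor_rpow_spacing {c X : ℝ} (hc : 1 < c) (hX : 1 ≤ X) {m n : ℕ} (hm : X ≤ m) (hn : X ≤ n) :
    (c - 1) * X ^ (c - 1) * |(n : ℝ) - m| ≤ |(⌊(n : ℝ) ^ c⌋ : ℝ) - ⌊(m : ℝ) ^ c⌋| := by
  wlog h : m ≤ n generalizing m n
  · have := this hn hm (by omega)
    rwa [abs_sub_comm, abs_sub_comm (⌊(n : ℝ) ^ c⌋ : ℝ)]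
  rcases h.eq_or_lt with rfl | h
  · simp
  have hm0 : (0 : ℝ) < m := by linarith
  have hd : (1 : ℝ) ≤ (n : ℝ) - m := by
    have : ((m + 1 : ℕ) : ℝ) ≤ n := by exact_mod_cast h
    push_cast at this; linarith
  have h1 := rpow_tangent_le hc.le hm0 (Nat.cast_nonneg n)
  have h2 : X ^ (c - 1) ≤ (m : ℝ) ^ (c - 1) := Real.rpow_le_rpow (by linarith) hm (by linarith)
  have h3 : 1 ≤ X ^ (c - 1) := Real.one_le_rpow hX (by linarith)
  have h4 : 1 ≤ X ^ (c - 1) * ((n : ℝ) - m) := by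
    calc (1 : ℝ) = 1 * 1 := (one_mul 1).symm
      _ ≤ _ := by gcongr
  have h5 : c * X ^ (c - 1) * ((n : ℝ) - m) ≤ c * (m : ℝ) ^ (c - 1) * ((n : ℝ) - m) := by gcongr
  have h6 := Int.lt_floor_add_one ((n : ℝ) ^ c)
  have h7 := Int.floor_le ((m : ℝ) ^ c)
  rw [abs_of_nonneg (by linarith : (0 : ℝ) ≤ (n : ℝ) - m)]
  refine le_trans ?_ (le_abs_self _)
  linarith

/-- Fourth moment of the prime exponential sum over a dyadic block. -/
lemma integral_norm_pow_four_dyadic_le {c P τ : ℝ} {F : Finset ℕ} {k : ℕ} (hc : 1 < c) (hc4 : c ≤ 4) (hP : 1 ≤ P)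
    (hτ : 0 ≤ τ) (hτP : τ ≤ P ^ (1 - c)) (hF : ∀ n ∈ F, 2 ^ k ≤ n ∧ n < 2 ^ (k + 1)) (hFP : ∀ n ∈ F, (n : ℝ) ≤ P)
    (hk : (2 : ℝ) ^ k ≤ P) :
    ∫ α in (-τ)..τ, ‖∑ n ∈ F, (Real.log n : ℂ) * eC ((⌊(n : ℝ) ^ c⌋ : ℝ) * α)‖ ^ 4 ≤
      (2 + 2 / (c - 1)) * P ^ (4 - c) * (1 + Real.log P) ^ 5 := by
  set X : ℝ := (2 : ℝ) ^ k with hX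
  set ℓ := Real.log P with hℓ
  have hℓ0 : 0 ≤ ℓ := Real.log_nonneg hP
  have hX1 : 1 ≤ X := one_le_pow₀ (by norm_num)
  have hX0 : 0 < X := by linarith
  have hP0 : 0 < P := by linarith
  have hc1 : 0 < c - 1 := by linarith
  have hXn : ∀ n ∈ F, X ≤ n := fun n hn => by rw [hX]; exact_mod_cast (hF n hn).1
  have hlog : ∀ n ∈ F, Real.log n ≤ ℓ := fun n hn =>
    Real.log_le_log (lt_of_lt_of_le hX0 (hXn n hn)) (hFP n hn)
  have hcard : (F.card : ℝ) ≤ X := by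
    have h1 : F ⊆ Finset.Ico (2 ^ k) (2 ^ (k + 1)) := fun n hn => Finset.mem_Ico.2 (hF n hn)
    have h2 := Finset.card_le_card h1
    rw [Nat.card_Ico, pow_succ] at h2
    have h3 : F.card ≤ 2 ^ k := by omega
    rw [hX]; exact_mod_cast h3
  have hHH : ∀ m ∈ F, ∀ n ∈ F, |(n : ℝ) - m| < (2 ^ k : ℕ) := by
    intro m hm n hn
    have a1 := hXn m hm
    have a2 := hXn n hn
    have a3 : (m : ℝ) < 2 * X := by
      have : (m : ℝ) < ((2 ^ (k + 1) : ℕ) : ℝ) := by exact_mod_cast (hF m hm).2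
      push_cast at this; rw [pow_succ] at this; linarith
    have a4 : (n : ℝ) < 2 * X := by
      have : (n : ℝ) < ((2 ^ (k + 1) : ℕ) : ℝ) := by exact_mod_cast (hF n hn).2
      push_cast at this; rw [pow_succ] at this; linarith
    push_cast
    rw [abs_lt]; constructor <;> linarith
  have h2 := integral_norm_sq_sum_le (F := F) (b := fun n => Real.log n) (a := fun n => (⌊(n : ℝ) ^ c⌋ : ℝ)) (ℓ := ℓ)
    (δ := (c - 1) * X ^ (c - 1)) (τ := τ) (H := 2 ^ k) hτ (by positivity)
    (fun n _ => Real.log_natCast_nonneg n) hlog hHH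
    (fun m hm n hn => floor_rpow_spacing hc hX1 (hXn m hm) (hXn n hn))
  have hlogX : Real.log ((2 ^ k : ℕ) : ℝ) ≤ ℓ := by
    push_cast
    exact Real.log_le_log hX0 hk
  have hsup : ∀ α : ℝ, ‖∑ n ∈ F, (Real.log n : ℂ) * eC ((⌊(n : ℝ) ^ c⌋ : ℝ) * α)‖ ≤ X * ℓ := by
    intro α
    calc _ ≤ ∑ n ∈ F, ℓ := by
          refine norm_sum_le_of_le _ fun n hn => ?_
          rw [norm_mul, norm_eC, mul_one, Complex.norm_real, Real.norm_of_nonneg (Real.log_natCast_nonneg n)]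
          exact hlog n hn
      _ = F.card * ℓ := by rw [Finset.sum_const, nsmul_eq_mul]
      _ ≤ _ := by gcongr
  have hcont : Continuous fun α : ℝ => ∑ n ∈ F, (Real.log n : ℂ) * eC ((⌊(n : ℝ) ^ c⌋ : ℝ) * α) :=
    continuous_finsetSum _ fun n _ => continuous_const.mul (continuous_eC_const_mul _)
  have h4 : ∫ α in (-τ)..τ, ‖∑ n ∈ F, (Real.log n : ℂ) * eC ((⌊(n : ℝ) ^ c⌋ : ℝ) * α)‖ ^ 4 ≤
      (X * ℓ) ^ 2 * ∫ α in (-τ)..τ, ‖∑ n ∈ F, (Real.log n : ℂ) * eC ((⌊(n : ℝ) ^ c⌋ : ℝ) * α)‖ ^ 2 := by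
    rw [← intervalIntegral.integral_const_mul]
    refine intervalIntegral.integral_mono_on (by linarith) ((hcont.norm.pow 4).intervalIntegrable _ _)
      (((hcont.norm.pow 2).const_mul _).intervalIntegrable _ _) fun α _ => ?_
    rw [show ∀ x : ℝ, x ^ 4 = x ^ 2 * x ^ 2 from fun x => by ring]
    gcongr
    exact hsup α
  have hτX : τ ≤ X ^ (1 - c) :=
    hτP.trans (Real.rpow_le_rpow_of_nonpos hX0 hk (by linarith))
  have hXX : X ^ (1 - c) * X ^ (c - 1) = 1 := by
    rw [← Real.rpow_add hX0, show 1 - c + (c - 1) = 0 by ring, Real.rpow_zero]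
  have h5 : 2 * τ + 2 * (1 + Real.log ((2 ^ k : ℕ) : ℝ)) / ((c - 1) * X ^ (c - 1)) ≤
      (2 + 2 / (c - 1)) * (1 + ℓ) * X ^ (1 - c) := by
    have e1 : 2 * (1 + ℓ) / ((c - 1) * X ^ (c - 1)) = 2 / (c - 1) * (1 + ℓ) * X ^ (1 - c) := by
      have : X ^ (c - 1) ≠ 0 := by positivity
      rw [div_eq_iff (by positivity)]
      calc 2 * (1 + ℓ) = 2 * (1 + ℓ) * (X ^ (1 - c) * X ^ (c - 1)) := by rw [hXX, mul_one]
        _ = _ := by field_simp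
    have e2 : 2 * (1 + Real.log ((2 ^ k : ℕ) : ℝ)) / ((c - 1) * X ^ (c - 1)) ≤
        2 * (1 + ℓ) / ((c - 1) * X ^ (c - 1)) := by gcongr
    have e3 : 2 * τ ≤ 2 * (1 + ℓ) * X ^ (1 - c) := by
      calc 2 * τ ≤ 2 * X ^ (1 - c) := by gcongr
        _ ≤ 2 * (1 + ℓ) * X ^ (1 - c) := by gcongr; linarith
    rw [e1] at e2
    linarith
  have hXP : X ^ (4 - c) ≤ P ^ (4 - c) := Real.rpow_le_rpow hX0.le hk (by linarith)
  have hX4 : X ^ 3 * X ^ (1 - c) = X ^ (4 - c) := by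
    rw [← Real.rpow_natCast X 3, ← Real.rpow_add hX0]; congr 1; push_cast; ring
  calc _ ≤ (X * ℓ) ^ 2 * (ℓ ^ 2 * F.card * (2 * τ + 2 * (1 + Real.log ((2 ^ k : ℕ) : ℝ)) / ((c - 1) * X ^ (c - 1)))) :=
        h4.trans (by gcongr)
    _ ≤ (X * ℓ) ^ 2 * (ℓ ^ 2 * X * ((2 + 2 / (c - 1)) * (1 + ℓ) * X ^ (1 - c))) := by
        have : 0 ≤ Real.log ((2 ^ k : ℕ) : ℝ) := Real.log_natCast_nonneg _
        gcongr
    _ = (2 + 2 / (c - 1)) * (X ^ 3 * X ^ (1 - c)) * (ℓ ^ 4 * (1 + ℓ)) := by ring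
    _ ≤ (2 + 2 / (c - 1)) * P ^ (4 - c) * ((1 + ℓ) ^ 4 * (1 + ℓ)) := by
        rw [hX4]
        gcongr
        linarith
    _ = _ := by ring

/-- Fourth moment of `SS` over the major arc. -/
lemma integral_norm_SS_pow_four_le {c P τ : ℝ} (hc : 1 < c) (hc4 : c ≤ 4) (hP : 1 ≤ P) (hτ : 0 ≤ τ)
    (hτP : τ ≤ P ^ (1 - c)) :
    ∫ α in (-τ)..τ, ‖SS c P α‖ ^ 4 ≤ 16 * (2 + 2 / (c - 1)) * P ^ (4 - c) * (1 + Real.log P) ^ 9 := by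
  set Q := (Finset.range (⌊P⌋₊ + 1)).filter Nat.Prime with hQ
  set K := Nat.log 2 ⌊P⌋₊ + 1 with hK
  have hP0 : 0 < P := by linarith
  have hc1 : 0 < c - 1 := by linarith
  have hfl : 1 ≤ ⌊P⌋₊ := Nat.le_floor (by exact_mod_cast hP)
  have hmaps : ∀ p ∈ Q, Nat.log 2 p ∈ Finset.range K := by
    intro p hp
    have := (Finset.mem_filter.1 hp).1
    rw [Finset.mem_range] at this ⊢
    have := Nat.log_mono_right (b := 2) (show p ≤ ⌊P⌋₊ by omega)
    omega
  set B : ℕ → Finset ℕ := fun k => Q.filter fun p => Nat.log 2 p = k with hB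
  set T : ℕ → ℝ → ℂ := fun k α => ∑ n ∈ B k, (Real.log n : ℂ) * eC ((⌊(n : ℝ) ^ c⌋ : ℝ) * α) with hT
  have hsum : ∀ α, SS c P α = ∑ k ∈ Finset.range K, T k α := fun α =>
    (Finset.sum_fiberwise_of_maps_to hmaps _).symm
  have hTc : ∀ k, Continuous (T k) := fun k =>
    continuous_finsetSum _ fun n _ => continuous_const.mul (continuous_eC_const_mul _)
  have hT4 : ∀ k, Continuous fun α => ‖T k α‖ ^ 4 := fun k => (hTc k).norm.pow 4
  have hKr : (K : ℝ) ≤ 2 * (1 + Real.log P) := by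
    refine (natLog_two_add_one_le hfl).trans ?_
    have := Real.log_le_log (by exact_mod_cast hfl) (Nat.floor_le hP0.le)
    linarith
  have hholder : ∀ α, ‖SS c P α‖ ^ 4 ≤ (K : ℝ) ^ 3 * ∑ k ∈ Finset.range K, ‖T k α‖ ^ 4 := by
    intro α
    have h1 := pow_sum_div_card_le_sum_pow (s := Finset.range K) (f := fun k => ‖T k α‖)
      (fun _ _ => norm_nonneg _) 3
    rw [Finset.card_range, div_le_iff₀ (by positivity)] at h1
    rw [hsum]
    calc _ ≤ (∑ k ∈ Finset.range K, ‖T k α‖) ^ 4 := by gcongr; exact norm_sum_le _ _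
      _ ≤ _ := h1.trans_eq (by ring)
  have hSSc : Continuous (SS c P) := by
    have : SS c P = fun α => ∑ k ∈ Finset.range K, T k α := funext hsum
    rw [this]
    exact continuous_finsetSum _ fun k _ => hTc k
  have hl0 : 0 ≤ Real.log P := Real.log_nonneg hP
  calc _ ≤ ∫ α in (-τ)..τ, (K : ℝ) ^ 3 * ∑ k ∈ Finset.range K, ‖T k α‖ ^ 4 := by
        refine intervalIntegral.integral_mono_on (by linarith) ((hSSc.norm.pow 4).intervalIntegrable _ _)
          (Continuous.intervalIntegrable (continuous_const.mul
            (continuous_finsetSum _ fun k _ => hT4 k)) _ _) fun α _ => hholder α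
    _ = (K : ℝ) ^ 3 * ∑ k ∈ Finset.range K, ∫ α in (-τ)..τ, ‖T k α‖ ^ 4 := by
        rw [intervalIntegral.integral_const_mul, intervalIntegral.integral_finsetSum fun k _ =>
          (hT4 k).intervalIntegrable _ _]
    _ ≤ (K : ℝ) ^ 3 * ∑ k ∈ Finset.range K, (2 + 2 / (c - 1)) * P ^ (4 - c) * (1 + Real.log P) ^ 5 := by
        gcongr with k hk
        refine integral_norm_pow_four_dyadic_le (k := k) hc hc4 hP hτ hτP ?_ ?_ ?_
        · intro n hn
          obtain ⟨h1, h2⟩ := Finset.mem_filter.1 hn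
          have hn0 : n ≠ 0 := (Finset.mem_filter.1 h1).2.ne_zero
          subst h2
          exact ⟨Nat.pow_log_le_self 2 hn0, Nat.lt_pow_succ_log_self (by norm_num) n⟩
        · intro n hn
          obtain ⟨h1, _⟩ := Finset.mem_filter.1 hn
          have := Finset.mem_range.1 (Finset.mem_filter.1 h1).1
          exact (Nat.le_floor_iff hP0.le).1 (by omega)
        · have h1 : 2 ^ k ≤ ⌊P⌋₊ := by
            calc 2 ^ k ≤ 2 ^ Nat.log 2 ⌊P⌋₊ := by
                  have := Finset.mem_range.1 hk
                  exact Nat.pow_le_pow_right (by norm_num) (by omega)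
              _ ≤ _ := Nat.pow_log_le_self 2 (by omega)
          have h2 := (Nat.le_floor_iff hP0.le).1 h1
          push_cast at h2; exact h2
    _ = (K : ℝ) ^ 4 * ((2 + 2 / (c - 1)) * P ^ (4 - c) * (1 + Real.log P) ^ 5) := by
        rw [Finset.sum_const, Finset.card_range, nsmul_eq_mul]; ring
    _ ≤ (2 * (1 + Real.log P)) ^ 4 * ((2 + 2 / (c - 1)) * P ^ (4 - c) * (1 + Real.log P) ^ 5) := by gcongr
    _ = _ := by ring

lemma continuous_SS (c P : ℝ) : Continuous (SS c P) :=
  continuous_finsetSum _ fun _ _ => continuous_const.mul (continuous_eC_const_mul _)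

lemma norm_pow_five_sub_le (x y : ℂ) : ‖x ^ 5 - y ^ 5‖ ≤ 5 * ‖x - y‖ * (‖x‖ ^ 4 + ‖y‖ ^ 4) := by
  have h1 : x ^ 5 - y ^ 5 = (x - y) * (x ^ 4 + x ^ 3 * y + x ^ 2 * y ^ 2 + x * y ^ 3 + y ^ 4) := by ring
  have hx := norm_nonneg x
  have hy := norm_nonneg y
  have key : ∀ i j : ℕ, i + j = 4 → ‖x‖ ^ i * ‖y‖ ^ j ≤ ‖x‖ ^ 4 + ‖y‖ ^ 4 := by
    intro i j hij
    rcases le_total ‖x‖ ‖y‖ with h | h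
    · calc _ ≤ ‖y‖ ^ i * ‖y‖ ^ j := by gcongr
        _ = ‖y‖ ^ 4 := by rw [← pow_add, hij]
        _ ≤ _ := le_add_of_nonneg_left (by positivity)
    · calc _ ≤ ‖x‖ ^ i * ‖x‖ ^ j := by gcongr
        _ = ‖x‖ ^ 4 := by rw [← pow_add, hij]
        _ ≤ _ := le_add_of_nonneg_right (by positivity)
  have h2 : ‖x ^ 4 + x ^ 3 * y + x ^ 2 * y ^ 2 + x * y ^ 3 + y ^ 4‖ ≤ 5 * (‖x‖ ^ 4 + ‖y‖ ^ 4) := by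
    have a1 := key 3 1 rfl
    have a2 := key 2 2 rfl
    have a3 := key 1 3 rfl
    have n1 := norm_add_le (x ^ 4 + x ^ 3 * y + x ^ 2 * y ^ 2 + x * y ^ 3) (y ^ 4)
    have n2 := norm_add_le (x ^ 4 + x ^ 3 * y + x ^ 2 * y ^ 2) (x * y ^ 3)
    have n3 := norm_add_le (x ^ 4 + x ^ 3 * y) (x ^ 2 * y ^ 2)
    have n4 := norm_add_le (x ^ 4) (x ^ 3 * y)
    simp only [norm_mul, norm_pow] at n1 n2 n3 n4
    rw [pow_one] at a1 a3
    have b1 : 0 ≤ ‖x‖ ^ 4 := by positivity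
    have b2 : 0 ≤ ‖y‖ ^ 4 := by positivity
    linarith
  rw [h1, norm_mul]
  calc _ ≤ ‖x - y‖ * (5 * (‖x‖ ^ 4 + ‖y‖ ^ 4)) := by gcongr
    _ = _ := by ring

lemma integral_oscInt_scaled_pow_four_le {c P τ : ℝ} (hc : 1 < c) (hc4 : c < 4) (hP : 0 < P) (hτ : 0 ≤ τ) :
    ∫ α in (-τ)..τ, ‖(P : ℂ) * oscInt c (α * P ^ c)‖ ^ 4 ≤ P ^ (4 - c) * ∫ β, ‖oscInt c β ^ 4‖ := by
  have hPc : 0 < P ^ c := by positivity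
  have h1 : ∀ α, ‖(P : ℂ) * oscInt c (α * P ^ c)‖ ^ 4 = P ^ 4 * ‖oscInt c (α * P ^ c) ^ 4‖ := by
    intro α
    rw [norm_mul, mul_pow, Complex.norm_real, Real.norm_of_nonneg hP.le, norm_pow]
  simp_rw [h1]
  rw [intervalIntegral.integral_const_mul,
    intervalIntegral.integral_comp_mul_right (fun β => ‖oscInt c β ^ 4‖) hPc.ne', smul_eq_mul, ← mul_assoc]
  have h2 : P ^ 4 * (P ^ c)⁻¹ = P ^ (4 - c) := by
    rw [Real.rpow_sub hP, div_eq_mul_inv, ← Real.rpow_natCast P 4]; norm_num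
  rw [h2]
  gcongr
  rw [intervalIntegral.integral_of_le (by nlinarith)]
  exact setIntegral_le_integral (integrable_oscInt_pow hc (k := 4) (by exact_mod_cast hc4)).norm
    (ae_of_all _ fun _ => norm_nonneg _)

lemma integral_oscInt_scaled_pow_five {c P τ : ℝ} (hP : 0 < P) :
    ∫ α in (-τ)..τ, ((P : ℂ) * oscInt c (α * P ^ c)) ^ 5 * eC (-P ^ c * α) =
      ((P ^ (5 - c) : ℝ) : ℂ) * ∫ β in (-(τ * P ^ c))..(τ * P ^ c), oscInt c β ^ 5 * eC (-1 * β) := by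
  have hPc : 0 < P ^ c := by positivity
  have h1 : ∀ α, ((P : ℂ) * oscInt c (α * P ^ c)) ^ 5 * eC (-P ^ c * α) =
      (P : ℂ) ^ 5 * (oscInt c (α * P ^ c) ^ 5 * eC (-1 * (α * P ^ c))) := by
    intro α
    rw [show -1 * (α * P ^ c) = -P ^ c * α by ring]
    ring
  simp_rw [h1]
  rw [intervalIntegral.integral_const_mul,
    intervalIntegral.integral_comp_mul_right (fun β => oscInt c β ^ 5 * eC (-1 * β)) hPc.ne', neg_mul,
    Complex.real_smul, ← mul_assoc]
  congr 1
  have h2 : P ^ 5 * (P ^ c)⁻¹ = P ^ (5 - c) := by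
    rw [Real.rpow_sub hP, div_eq_mul_inv, ← Real.rpow_natCast P 5]; norm_num
  rw [← h2]
  push_cast
  ring

/-- The major arc asymptotic, with `P = exp(w³⁰)`. -/
lemma exists_eventually_majorArc {c ε : ℝ} (hc : 1 < c) (hc2 : 2 * c < 5) (hε : 0 < ε) (hε1 : ε ≤ 1 / 10) :
    ∃ K > 0, ∀ᶠ w : ℝ in Filter.atTop, ∀ P τ : ℝ, P = Real.exp (w ^ 30) → τ = P ^ (1 - c - ε) →
      ‖(∫ α in (-τ)..τ, SS c P α ^ 5 * eC (-P ^ c * α)) -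
        ((Real.Gamma (1 + 1 / c) ^ 5 / Real.Gamma (5 / c) * P ^ (5 - c) : ℝ) : ℂ)‖ ≤
      K * P ^ (5 - c) * Real.exp (-(c * w ^ 8)) := by
  have hc0 : 0 < c := by linarith
  obtain ⟨K₁, hK₁, hS⟩ := exists_eventually_norm_SS_sub_le hc (by linarith) hε
  obtain ⟨C, hC, hT⟩ := exists_norm_integral_oscInt_sub_le hc (k := 5) (η := 1) zero_le_one
    (by push_cast; linarith) (-1)
  set J := ∫ β, ‖oscInt c β ^ 4‖ with hJ
  have hJ0 : 0 ≤ J := integral_nonneg fun _ => norm_nonneg _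
  set K₂ := 16 * (2 + 2 / (c - 1)) with hK₂
  have hK₂0 : 0 < K₂ := by have : 0 < c - 1 := by linarith
                           positivity
  refine ⟨5 * K₁ * (K₂ + J) + C, by positivity, ?_⟩
  filter_upwards [hS, Filter.eventually_ge_atTop 1, eventually_one_add_pow_le_exp 30 9,
    eventually_pow_le_mul_pow (show (0 : ℝ) < 1 / 2 by norm_num) (show 1 < 9 by norm_num),
    eventually_pow_le_mul_pow (show 0 < 1 / (2 * c) by positivity) (show 8 < 9 by norm_num),
    eventually_pow_le_mul_pow (show (0 : ℝ) < 1 / 2 by norm_num) (show 9 < 30 by norm_num)]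
    with w hS hw1 h1 h2 h3 h4 P τ hP hτ
  have hP0 : 0 < P := by rw [hP]; positivity
  have hlogP : Real.log P = w ^ 30 := by rw [hP, Real.log_exp]
  have hP1 : 1 ≤ P := by rw [hP]; exact Real.one_le_exp (by positivity)
  have hτ0 : 0 < τ := by rw [hτ]; positivity
  have hτP : τ ≤ P ^ (1 - c) := by
    rw [hτ]; exact Real.rpow_le_rpow_of_exponent_le hP1 (by linarith)
  have hcw : c * w ^ 8 ≤ w ^ 9 / 2 := by
    calc c * w ^ 8 ≤ c * (1 / (2 * c) * w ^ 9) := by gcongr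
      _ = _ := by field_simp
  rw [pow_one] at h2
  set E := Real.exp (-(c * w ^ 8)) with hE
  set I : ℝ → ℂ := fun α => (P : ℂ) * oscInt c (α * P ^ c) with hI
  have hIc : Continuous I := continuous_const.mul ((continuous_oscInt hc0.le).comp (by fun_prop))
  have hSc := continuous_SS c P
  have hec : Continuous fun α : ℝ => eC (-P ^ c * α) := continuous_eC_const_mul _
  -- replacing `S` by its model
  have hA : ‖(∫ α in (-τ)..τ, SS c P α ^ 5 * eC (-P ^ c * α)) - ∫ α in (-τ)..τ, I α ^ 5 * eC (-P ^ c * α)‖ ≤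
      5 * K₁ * (K₂ + J) * P ^ (5 - c) * E := by
    have s1 : Continuous fun α => SS c P α ^ 5 * eC (-P ^ c * α) := (hSc.pow 5).mul hec
    have s2 : Continuous fun α => I α ^ 5 * eC (-P ^ c * α) := (hIc.pow 5).mul hec
    rw [← intervalIntegral.integral_sub (s1.intervalIntegrable _ _) (s2.intervalIntegrable _ _)]
    have hpt : ∀ α ∈ Set.Ioc (-τ) τ, ‖SS c P α ^ 5 * eC (-P ^ c * α) - I α ^ 5 * eC (-P ^ c * α)‖ ≤
        5 * (K₁ * (P * Real.exp (-w ^ 9))) * (‖SS c P α‖ ^ 4 + ‖I α‖ ^ 4) := by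
      intro α hα
      rw [← sub_mul, norm_mul, norm_eC, mul_one]
      refine (norm_pow_five_sub_le _ _).trans ?_
      have := hS P α hP (by rw [← hτ, abs_le]; exact ⟨hα.1.le, hα.2⟩)
      gcongr
    have hbc : Continuous fun α => ‖SS c P α‖ ^ 4 + ‖I α‖ ^ 4 := (hSc.norm.pow 4).add (hIc.norm.pow 4)
    have i1 : Continuous fun α => ‖SS c P α‖ ^ 4 := hSc.norm.pow 4
    have i2 : Continuous fun α => ‖I α‖ ^ 4 := hIc.norm.pow 4
    have m1 := integral_norm_SS_pow_four_le hc (by linarith : c ≤ 4) hP1 hτ0.le hτP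
    have m2 := integral_oscInt_scaled_pow_four_le hc (by linarith : c < 4) hP0 hτ0.le
    rw [hlogP] at m1
    have hl1 : 1 ≤ (1 + w ^ 30) ^ 9 := one_le_pow₀ (le_add_of_nonneg_right (by positivity))
    calc _ ≤ ∫ α in (-τ)..τ, 5 * (K₁ * (P * Real.exp (-w ^ 9))) * (‖SS c P α‖ ^ 4 + ‖I α‖ ^ 4) :=
          intervalIntegral.norm_integral_le_of_norm_le (by linarith) (ae_of_all _ hpt)
            ((hbc.const_mul _).intervalIntegrable _ _)
      _ = 5 * (K₁ * (P * Real.exp (-w ^ 9))) *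
          ((∫ α in (-τ)..τ, ‖SS c P α‖ ^ 4) + ∫ α in (-τ)..τ, ‖I α‖ ^ 4) := by
          rw [intervalIntegral.integral_const_mul, intervalIntegral.integral_add (i1.intervalIntegrable _ _)
            (i2.intervalIntegrable _ _)]
      _ ≤ 5 * (K₁ * (P * Real.exp (-w ^ 9))) *
          (K₂ * P ^ (4 - c) * (1 + w ^ 30) ^ 9 + P ^ (4 - c) * J * (1 + w ^ 30) ^ 9) := by
          gcongr
          exact m2.trans (le_mul_of_one_le_right (by positivity) hl1)
      _ = 5 * K₁ * (K₂ + J) * (P ^ (4 - c) * P) * ((1 + w ^ 30) ^ 9 * Real.exp (-w ^ 9)) := by ring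
      _ ≤ 5 * K₁ * (K₂ + J) * P ^ (5 - c) * E := by
          rw [← Real.rpow_add_one hP0.ne', show 4 - c + 1 = 5 - c by ring]
          gcongr
          calc _ ≤ Real.exp w * Real.exp (-w ^ 9) := by gcongr
            _ ≤ E := by
              rw [← Real.exp_add, hE]
              exact Real.exp_le_exp.2 (by linarith)
  have hB : ‖(∫ α in (-τ)..τ, I α ^ 5 * eC (-P ^ c * α)) -
      ((Real.Gamma (1 + 1 / c) ^ 5 / Real.Gamma (5 / c) * P ^ (5 - c) : ℝ) : ℂ)‖ ≤ C * P ^ (5 - c) * E := by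
    have hTP := hT (τ * P ^ c) (by positivity)
    rw [integral_oscInt_pow_five hc (by linarith)] at hTP
    rw [integral_oscInt_scaled_pow_five hP0, mul_comm (Real.Gamma (1 + 1 / c) ^ 5 / Real.Gamma (5 / c)),
      Complex.ofReal_mul, ← mul_sub, norm_mul, Complex.norm_real, Real.norm_of_nonneg (by positivity)]
    have hτc : (τ * P ^ c) ^ (-1 : ℝ) ≤ E := by
      rw [hτ, ← Real.rpow_add hP0, ← Real.rpow_mul hP0.le, hP, ← Real.exp_mul, hE]
      refine Real.exp_le_exp.2 ?_
      have : 0 ≤ w ^ 30 * (1 / 10 - ε) := mul_nonneg (by positivity) (by linarith)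
      have : 0 ≤ w ^ 30 := by positivity
      have : 0 ≤ w ^ 9 := by positivity
      linarith
    calc _ ≤ P ^ (5 - c) * (C * E) := by gcongr; exact hTP.trans (by gcongr)
      _ = _ := by ring
  calc _ ≤ _ := norm_sub_le_norm_sub_add_norm_sub _ (∫ α in (-τ)..τ, I α ^ 5 * eC (-P ^ c * α)) _
    _ ≤ 5 * K₁ * (K₂ + J) * P ^ (5 - c) * E + C * P ^ (5 - c) * E := add_le_add hA hB
    _ = _ := by ring

theorem stmt_1 (c : ℝ) (hc1 : 1 < c) (hc2 : c < 4109054 / 1999527) (hc3 : c ≠ 2) :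
    ∃ ε₀ > 0, ∀ ε : ℝ, 0 < ε → ε ≤ ε₀ →
      ∃ C > 0, ∃ N₀ : ℕ, ∀ N : ℕ, N₀ ≤ N →
        ∀ P τ : ℝ, P = (N : ℝ) ^ (1 / c) → τ = P ^ (1 - c - ε) →
          ‖(∫ α in (-τ)..τ, (SS c P α) ^ 5 * eC (-(N : ℝ) * α)) -
              ((Real.Gamma (1 + 1 / c) ^ 5 / Real.Gamma (5 / c) *
                (N : ℝ) ^ (5 / c - 1) : ℝ) : ℂ)‖
            ≤ C * (N : ℝ) ^ (5 / c - 1) * Real.exp (-(Real.log N) ^ ((1 : ℝ) / 4)) := by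
  refine ⟨1 / 10, by norm_num, fun ε hε hε1 => ?_⟩
  have hc0 : 0 < c := by linarith
  obtain ⟨K, hK, hev⟩ := exists_eventually_majorArc hc1 (by linarith) hε hε1
  have htend : Filter.Tendsto (fun N : ℕ => (Real.log N / c) ^ ((1 : ℝ) / 30)) Filter.atTop Filter.atTop :=
    (tendsto_rpow_atTop (by norm_num)).comp
      ((Real.tendsto_log_atTop.comp tendsto_natCast_atTop_atTop).atTop_div_const hc0)
  obtain ⟨N₀, hN₀⟩ := Filter.eventually_atTop.1 (htend.eventually (hev.and (Filter.eventually_ge_atTop 1)))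
  refine ⟨K, hK, N₀ + 1, fun N hN P τ hP hτ => ?_⟩
  obtain ⟨hmain, hw1⟩ := hN₀ N (by omega)
  set w := (Real.log N / c) ^ ((1 : ℝ) / 30) with hw
  have hN1 : (1 : ℝ) ≤ N := by exact_mod_cast (by omega : 1 ≤ N)
  have hN0 : (0 : ℝ) < N := by linarith
  have hlog : 0 ≤ Real.log N := Real.log_nonneg hN1
  have hw30 : w ^ 30 = Real.log N / c := by
    rw [hw, ← Real.rpow_natCast, ← Real.rpow_mul (by positivity)]
    norm_num
  have hPw : P = Real.exp (w ^ 30) := by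
    rw [hP, hw30, Real.rpow_def_of_pos hN0]; congr 1; ring
  have hPc : P ^ c = N := by
    rw [hP, ← Real.rpow_mul hN0.le, one_div, inv_mul_cancel₀ hc0.ne', Real.rpow_one]
  have hP5 : P ^ (5 - c) = (N : ℝ) ^ (5 / c - 1) := by
    rw [hP, ← Real.rpow_mul hN0.le]; congr 1; field_simp
  have h := hmain P τ hPw hτ
  rw [hPc, hP5] at h
  refine h.trans ?_
  gcongr
  have hlogN : Real.log N = c * w ^ 30 := by rw [hw30]; field_simp
  have hw0 : 0 ≤ w := by linarith
  calc (Real.log N) ^ ((1 : ℝ) / 4) ≤ ((c * w ^ 8) ^ (4 : ℝ)) ^ ((1 : ℝ) / 4) := by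
        gcongr
        rw [hlogN]
        have e : (c * w ^ 8) ^ (4 : ℝ) = c ^ 4 * w ^ 32 := by
          rw [show (4 : ℝ) = ((4 : ℕ) : ℝ) by norm_num, Real.rpow_natCast]; ring
        rw [e]
        exact mul_le_mul (le_self_pow₀ hc1.le (by norm_num)) (pow_le_pow_right₀ hw1 (by norm_num)) (by positivity)
          (by positivity)
    _ = c * w ^ 8 := by
        rw [← Real.rpow_mul (by positivity)]; norm_num
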